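/- Let S ⊆ {−1,0,1}³ \ {(0,0,0)} be a stepset such that: (i) for each coordinate i ∈ {1,2,3}, there exists a finite sequence of steps from S whose partial sums are nonnegative in the other two coordinates but attain a negative value in coordinate i (the model is genuinely three-dimensional, so in particular each coordinate admits steps with entries −1 and +1); (ii) the group G of automorphisms of ℚ(x,y,z) generated by φ_x, φ_y, φ_z is finite; (iii) there exists a group homomorphism sgn : G → {±1} with sgn(φ_x) = sgn(φ_y) = sgn(φ_z) = −1; and (iv) the orbit sum Σ_{g∈G} sgn(g) · g(xyz) is a nonzero element of ℚ(x,y,z). Then the generating function F(x,y,z;t) = Σ_{n≥0} (Σ_{i,j,k≥0} f_S(i,j,k;n) x^i y^j z^k) t^n, regarded as a formal power series in t with coefficients in ℚ[x,y,z], is D-finite in t: there exist r ≥ 0 and polynomials c_0, …, c_r ∈ ℚ[x,y,z,t], not all zero, such that Σ_{m=0}^{r} c_m · (d/dt)^m F = 0. -/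

import Mathlib

noncomputable section

/-- The number of `S`-walks of length `n` in the octant that start at the
origin and end at the point `p`. -/
def walkCount (S : Finset (Fin 3 → ℤ)) (p : Fin 3 → ℤ) (n : ℕ) : ℕ :=
  Set.ncard {w : List (Fin 3 → ℤ) |
    w.length = n ∧ (∀ s ∈ w, s ∈ S) ∧
    (∀ m : ℕ, ∀ c : Fin 3, 0 ≤ (w.take m).sum c) ∧ w.sum = p}

/-- The generating function `F(x,y,z;t) = Σ_n (Σ_{i,j,k} f_S(i,j,k;n)
x^i y^j z^k) t^n` of octant walks with steps from `S`, as a formal power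
series in `t` with coefficients in `ℚ[x,y,z]`.  (Since `f(i,j,k;n) = 0`
unless `i,j,k ≤ n`, the inner sum may be truncated at `n`.) -/
def genFun (S : Finset (Fin 3 → ℤ)) : PowerSeries (MvPolynomial (Fin 3) ℚ) :=
  PowerSeries.mk fun n =>
    ∑ i ∈ Finset.range (n + 1), ∑ j ∈ Finset.range (n + 1),
      ∑ k ∈ Finset.range (n + 1),
        (walkCount S ![(i : ℤ), (j : ℤ), (k : ℤ)] n : ℚ) •
          (MvPolynomial.X 0 ^ i * MvPolynomial.X 1 ^ j * MvPolynomial.X 2 ^ k)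

/-- The field `ℚ(x,y,z)` of rational functions in three variables. -/
abbrev K : Type := FractionRing (MvPolynomial (Fin 3) ℚ)

/-- The variables `x = Xv 0`, `y = Xv 1`, `z = Xv 2` of `ℚ(x,y,z)`. -/
def Xv (i : Fin 3) : K := algebraMap (MvPolynomial (Fin 3) ℚ) K (MvPolynomial.X i)

/-- For a stepset `S`, the Laurent polynomial `Bm S c e = Σ_{s ∈ S, s c = e}`
(monomial in the two variables other than the `c`-th one); e.g.
`Bm S 0 (-1) = B₋(y,z) = Σ_{(−1,v,w)∈S} y^v z^w`. -/
def Bm (S : Finset (Fin 3 → ℤ)) (c : Fin 3) (e : ℤ) : K :=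
  ∑ s ∈ S.filter (fun s => s c = e), ∏ i ∈ Finset.univ.erase c, Xv i ^ (s i)

/-- `φ` is the automorphism `φ_c` of `ℚ(x,y,z)` associated to the stepset `S`
and the coordinate `c`: it sends the `c`-th variable `x_c` to
`x_c⁻¹ · B₋/B₊` and fixes the other two variables. -/
def IsPhi (S : Finset (Fin 3 → ℤ)) (c : Fin 3) (φ : K ≃ₐ[ℚ] K) : Prop :=
  φ (Xv c) = (Xv c)⁻¹ * Bm S c (-1) / Bm S c 1 ∧ ∀ i ≠ c, φ (Xv i) = Xv i

section OrbitSumMethod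

open HahnSeries

/-- The lexicographically ordered exponent group `ℤ³`. -/
abbrev LexExp : Type := Lex (Fin 3 → ℤ)

/-- The field of Hahn series with rational coefficients and exponents in `ℤ³`. -/
abbrev Hahn3 : Type := HahnSeries LexExp ℚ

/-- The basis vectors of the exponent group. -/
def expBasis (i : Fin 3) : LexExp := toLex (Pi.single i 1)

/-- The coordinate functions on the exponent group. -/
def expCoord (j : Fin 3) : LexExp →+ ℤ where
  toFun e := ofLex e j
  map_zero' := rfl
  map_add' _ _ := rfl

theorem LexExp.ext {e e' : LexExp} (h : ∀ j, expCoord j e = expCoord j e') : e = e' :=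
  ofLex.injective (funext h)

theorem expCoord_expBasis (i j : Fin 3) : expCoord j (expBasis i) = if j = i then 1 else 0 := by
  simp [expCoord, expBasis, Pi.single_apply]

/-- The exponent vector of a monomial after permuting coordinates. -/
def monExp (σ : Equiv.Perm (Fin 3)) (a : Fin 3 →₀ ℕ) : LexExp :=
  toLex fun j => (a (σ.symm j) : ℤ)

theorem monExp_injective (σ : Equiv.Perm (Fin 3)) : Function.Injective (monExp σ) := by
  intro a b h
  ext i
  have := congrFun (toLex.injective h) (σ i)
  simpa using this

theorem monExp_eq_sum (σ : Equiv.Perm (Fin 3)) (a : Fin 3 →₀ ℕ) :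
    monExp σ a = ∑ i, (a i) • expBasis (σ i) := by
  refine LexExp.ext fun j => ?_
  rw [map_sum, Finset.sum_eq_single (σ.symm j)]
  · rw [map_nsmul, expCoord_expBasis, if_pos (by simp)]
    simp [monExp, expCoord]
  · intro i _ hi
    have : j ≠ σ i := fun h => hi (by simp [h])
    rw [map_nsmul, expCoord_expBasis, if_neg this, smul_zero]
  · simp

/-- The expansion of polynomials as Hahn series, `x_i ↦ t^{e_{σ i}}`. -/
def polyExpand (σ : Equiv.Perm (Fin 3)) : MvPolynomial (Fin 3) ℚ →ₐ[ℚ] Hahn3 :=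
  MvPolynomial.aeval fun i => single (expBasis (σ i)) (1 : ℚ)

theorem single_sum_exp {ι : Type*} (s : Finset ι) (g : ι → LexExp) :
    single (∑ i ∈ s, g i) (1 : ℚ) = ∏ i ∈ s, single (g i) (1 : ℚ) := by
  classical
  induction s using Finset.induction_on with
  | empty => simp
  | insert a s ha ih => rw [Finset.sum_insert ha, Finset.prod_insert ha, ← ih, single_mul_single,
      one_mul]

theorem polyExpand_monomial (σ : Equiv.Perm (Fin 3)) (a : Fin 3 →₀ ℕ) (c : ℚ) :
    polyExpand σ (MvPolynomial.monomial a c) = single (monExp σ a) c := by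
  rw [polyExpand, MvPolynomial.aeval_monomial, monExp_eq_sum, Finsupp.prod_fintype _ _ (by simp)]
  simp_rw [single_pow, one_pow]
  rw [← single_sum_exp, HahnSeries.algebraMap_apply, HahnSeries.C_apply, single_mul_single]
  simp

/-- `Lead h e c`: the series `h` is nonzero with leading term `c t^e`. -/
def Lead (h : Hahn3) (e : LexExp) (c : ℚ) : Prop :=
  h ≠ 0 ∧ h.order = e ∧ h.leadingCoeff = c

theorem Lead.ne_zero {h : Hahn3} {e : LexExp} {c : ℚ} (H : Lead h e c) : c ≠ 0 := by
  rw [← H.2.2]; exact leadingCoeff_ne_zero.mpr H.1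

theorem lead_self {h : Hahn3} (h0 : h ≠ 0) : Lead h h.order h.leadingCoeff := ⟨h0, rfl, rfl⟩

theorem lead_iff {h : Hahn3} {e : LexExp} {c : ℚ} :
    Lead h e c ↔ c ≠ 0 ∧ h.coeff e = c ∧ ∀ δ < e, h.coeff δ = 0 := by
  constructor
  · intro H
    refine ⟨H.ne_zero, ?_, fun δ hδ => coeff_eq_zero_of_lt_order (H.2.1 ▸ hδ)⟩
    rw [← H.2.1, ← H.2.2, leadingCoeff_eq]
  · rintro ⟨hc, he, hlt⟩
    have h0 : h ≠ 0 := by rintro rfl; exact hc (by simpa using he.symm)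
    have ho : h.order = e := by
      apply le_antisymm (order_le_of_coeff_ne_zero (he ▸ hc))
      by_contra hh
      push Not at hh
      have := hlt _ hh
      rw [← leadingCoeff_eq] at this
      exact leadingCoeff_ne_zero.mpr h0 this
    exact ⟨h0, ho, by rw [leadingCoeff_eq, ho, he]⟩

theorem lead_single (e : LexExp) {c : ℚ} (hc : c ≠ 0) : Lead (single e c) e c :=
  ⟨by simpa using hc, order_single hc, leadingCoeff_of_single⟩

theorem lead_one : Lead 1 0 1 := by
  have := lead_single 0 (one_ne_zero (α := ℚ))
  simpa using this

theorem Lead.mul {h h' : Hahn3} {e e' : LexExp} {c c' : ℚ} (H : Lead h e c) (H' : Lead h' e' c') :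
    Lead (h * h') (e + e') (c * c') :=
  ⟨mul_ne_zero H.1 H'.1, by rw [order_mul H.1 H'.1, H.2.1, H'.2.1],
    by rw [leadingCoeff_mul, H.2.2, H'.2.2]⟩

theorem Lead.pow {h : Hahn3} {e : LexExp} {c : ℚ} (H : Lead h e c) (n : ℕ) :
    Lead (h ^ n) (n • e) (c ^ n) := by
  induction n with
  | zero => simpa using lead_one
  | succ n ih => rw [pow_succ, succ_nsmul, pow_succ]; exact ih.mul H

theorem Lead.unique {h : Hahn3} {e e' : LexExp} {c c' : ℚ} (H : Lead h e c) (H' : Lead h e' c') :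
    e = e' ∧ c = c' :=
  ⟨H.2.1.symm.trans H'.2.1, H.2.2.symm.trans H'.2.2⟩

theorem Lead.inv {h : Hahn3} {e : LexExp} {c : ℚ} (H : Lead h e c) : Lead h⁻¹ (-e) c⁻¹ := by
  have h1 := lead_self (inv_ne_zero H.1)
  have h2 := (H.mul h1)
  rw [mul_inv_cancel₀ H.1] at h2
  obtain ⟨he, hc⟩ := h2.unique lead_one
  rw [eq_neg_of_add_eq_zero_right he, eq_inv_of_mul_eq_one_right hc] at h1
  exact h1

theorem lead_prod {ι : Type*} (s : Finset ι) {h : ι → Hahn3} {e : ι → LexExp} {c : ι → ℚ}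
    (H : ∀ i ∈ s, Lead (h i) (e i) (c i)) :
    Lead (∏ i ∈ s, h i) (∑ i ∈ s, e i) (∏ i ∈ s, c i) := by
  classical
  induction s using Finset.induction_on with
  | empty => simpa using lead_one
  | insert a s ha ih =>
    rw [Finset.prod_insert ha, Finset.sum_insert ha, Finset.prod_insert ha]
    exact (H a (by simp)).mul (ih fun i hi => H i (by simp [hi]))

/-- The leading term of the image of a polynomial under a substitution whose leading exponents
are an order-preserving linear image of the standard ones. -/
theorem exists_lead_of_substitution (σ : Equiv.Perm (Fin 3)) (j : MvPolynomial (Fin 3) ℚ →ₐ[ℚ] Hahn3)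
    (M : LexExp →+ LexExp) (hM : StrictMono M) (c : Fin 3 → ℚ)
    (hj : ∀ i, Lead (j (MvPolynomial.X i)) (M (expBasis (σ i))) (c i))
    {p : MvPolynomial (Fin 3) ℚ} {a : Fin 3 →₀ ℕ} (ha : a ∈ p.support)
    (hmin : ∀ b ∈ p.support, monExp σ a ≤ monExp σ b) :
    Lead (j p) (M (monExp σ a)) (p.coeff a * ∏ i, c i ^ a i) := by
  have hmon : ∀ b ∈ p.support, Lead (j (MvPolynomial.monomial b (p.coeff b))) (M (monExp σ b))
      (p.coeff b * ∏ i, c i ^ b i) := by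
    intro b hb
    have hb' : p.coeff b ≠ 0 := MvPolynomial.mem_support_iff.mp hb
    rw [MvPolynomial.monomial_eq, map_mul, Finsupp.prod_fintype _ _ (by simp), map_prod]
    have h1 : Lead (j (MvPolynomial.C (p.coeff b))) 0 (p.coeff b) := by
      have : j (MvPolynomial.C (p.coeff b)) = single 0 (p.coeff b) := by
        rw [← MvPolynomial.algebraMap_eq, AlgHom.commutes, HahnSeries.algebraMap_apply,
          HahnSeries.C_apply]
        rfl
      rw [this]
      exact lead_single 0 hb'
    have h2 := lead_prod Finset.univ fun i _ => (hj i).pow (b i)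
    have h3 := h1.mul h2
    rw [monExp_eq_sum, map_sum]
    simp only [map_nsmul, map_pow]
    simpa using h3
  rw [lead_iff]
  have hsum : ∀ δ, (j p).coeff δ
      = ∑ b ∈ p.support, (j (MvPolynomial.monomial b (p.coeff b))).coeff δ := by
    intro δ
    conv_lhs => rw [p.as_sum, map_sum]
    rw [HahnSeries.coeff_sum]
  refine ⟨(hmon a ha).ne_zero, ?_, fun δ hδ => ?_⟩
  · rw [hsum, Finset.sum_eq_single a]
    · exact (lead_iff.mp (hmon a ha)).2.1
    · intro b hb hba
      refine (lead_iff.mp (hmon b hb)).2.2 _ (hM (lt_of_le_of_ne (hmin b hb) ?_))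
      exact fun h => hba (monExp_injective σ h).symm
    · exact fun h => absurd ha h
  · rw [hsum]
    exact Finset.sum_eq_zero fun b hb =>
      (lead_iff.mp (hmon b hb)).2.2 _ (hδ.trans_le (hM.monotone (hmin b hb)))

theorem exists_min_monExp (σ : Equiv.Perm (Fin 3)) {p : MvPolynomial (Fin 3) ℚ} (hp : p ≠ 0) :
    ∃ a ∈ p.support, ∀ b ∈ p.support, monExp σ a ≤ monExp σ b :=
  p.support.exists_min_image (monExp σ) (MvPolynomial.support_nonempty.mpr hp)

theorem polyExpand_X (σ : Equiv.Perm (Fin 3)) (i : Fin 3) :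
    polyExpand σ (MvPolynomial.X i) = single (expBasis (σ i)) 1 := by simp [polyExpand]

theorem polyExpand_lead (σ : Equiv.Perm (Fin 3)) {p : MvPolynomial (Fin 3) ℚ} {a : Fin 3 →₀ ℕ}
    (ha : a ∈ p.support) (hmin : ∀ b ∈ p.support, monExp σ a ≤ monExp σ b) :
    Lead (polyExpand σ p) (monExp σ a) (p.coeff a) := by
  have := exists_lead_of_substitution σ (polyExpand σ) (AddMonoidHom.id _) strictMono_id (fun _ => 1)
    (fun i => by rw [polyExpand_X]; exact lead_single _ one_ne_zero) ha hmin
  simpa using this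

theorem polyExpand_injective (σ : Equiv.Perm (Fin 3)) : Function.Injective (polyExpand σ) := by
  rw [injective_iff_map_eq_zero]
  intro p hp
  by_contra h
  obtain ⟨a, ha, hmin⟩ := exists_min_monExp σ h
  exact (polyExpand_lead σ ha hmin).1 hp

/-- The expansion of rational functions as Hahn series. -/
def expand (σ : Equiv.Perm (Fin 3)) : K →ₐ[ℚ] Hahn3 :=
  IsFractionRing.liftAlgHom (polyExpand_injective σ)

theorem expand_algebraMap (σ : Equiv.Perm (Fin 3)) (p : MvPolynomial (Fin 3) ℚ) :
    expand σ (algebraMap _ K p) = polyExpand σ p :=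
  IsFractionRing.lift_algebraMap (g := (polyExpand σ).toRingHom) (polyExpand_injective σ) p

theorem expand_Xv (σ : Equiv.Perm (Fin 3)) (i : Fin 3) :
    expand σ (Xv i) = single (expBasis (σ i)) 1 := by
  rw [Xv, expand_algebraMap, polyExpand_X]

/-- The leading term of the image of a rational function under an automorphism which acts on
leading exponents in an order-preserving linear way. -/
theorem lead_map (σ : Equiv.Perm (Fin 3)) (g : K ≃ₐ[ℚ] K) (M : LexExp →+ LexExp)
    (hM : StrictMono M) (c : Fin 3 → ℚ)
    (hg : ∀ i, Lead (expand σ (g (Xv i))) (M (expBasis (σ i))) (c i)) {f : K} (hf : f ≠ 0) :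
    Lead (expand σ (g f)) (M (expand σ f).order)
      ((expand σ f).leadingCoeff * ∏ i, c i ^ (ofLex (expand σ f).order (σ i))) := by
  obtain ⟨p, q, hq, rfl⟩ := IsFractionRing.div_surjective (A := MvPolynomial (Fin 3) ℚ) f
  have hq0 : q ≠ 0 := nonZeroDivisors.ne_zero hq
  have hp0 : p ≠ 0 := by rintro rfl; simp at hf
  obtain ⟨a, ha, hamin⟩ := exists_min_monExp σ hp0
  obtain ⟨b, hb, hbmin⟩ := exists_min_monExp σ hq0
  let j : MvPolynomial (Fin 3) ℚ →ₐ[ℚ] Hahn3 :=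
    ((expand σ).comp g.toAlgHom).comp (Algebra.algHom ℚ _ K)
  have hj : ∀ r, expand σ (g (algebraMap _ K r)) = j r := fun r => rfl
  have h1 := exists_lead_of_substitution σ j M hM c hg ha hamin
  have h2 := exists_lead_of_substitution σ j M hM c hg hb hbmin
  have h3 := polyExpand_lead σ ha hamin
  have h4 := polyExpand_lead σ hb hbmin
  have h5 := h3.mul h4.inv
  rw [← expand_algebraMap, ← expand_algebraMap, ← div_eq_mul_inv, ← map_div₀] at h5
  have h6 := h1.mul h2.inv
  rw [← hj, ← hj, ← div_eq_mul_inv, ← map_div₀, ← map_div₀] at h6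
  have hc : ∀ i, c i ≠ 0 := fun i => (hg i).ne_zero
  rw [h5.2.1, h5.2.2]
  convert h6 using 1
  · rw [map_add, map_neg]
  · have : ∀ i, c i ^ (ofLex (monExp σ a + -monExp σ b) (σ i)) = c i ^ a i * (c i ^ b i)⁻¹ := by
      intro i
      have : ofLex (monExp σ a + -monExp σ b) (σ i) = (a i : ℤ) - b i := by
        change ofLex (monExp σ a) (σ i) + -ofLex (monExp σ b) (σ i) = _
        simp [monExp, sub_eq_add_neg]
      rw [this, zpow_sub₀ (hc i), zpow_natCast, zpow_natCast, div_eq_mul_inv]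
    simp_rw [this]
    rw [Finset.prod_mul_distrib, Finset.prod_inv_distrib, mul_inv]
    ring

theorem LexExp.addHom_ext {M M' : LexExp →+ LexExp} (h : ∀ i, M (expBasis i) = M' (expBasis i)) :
    M = M' := by
  ext1 e
  have he : e = ∑ i, (expCoord i e) • expBasis i := by
    refine LexExp.ext fun j => ?_
    rw [map_sum, Finset.sum_eq_single j]
    · rw [map_zsmul, expCoord_expBasis, if_pos rfl]; simp
    · intro i _ hi
      rw [map_zsmul, expCoord_expBasis, if_neg hi.symm, smul_zero]
    · simp
  rw [he, map_sum, map_sum]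
  simp_rw [map_zsmul, h]

/-- Two ring homomorphisms out of `ℚ(x,y,z)` agreeing on the variables are equal. -/
theorem K.ringHom_ext {L : Type*} [Semiring L] {f g : K →+* L}
    (h : ∀ i, f (Xv i) = g (Xv i)) : f = g := by
  refine IsLocalization.ringHom_ext (nonZeroDivisors (MvPolynomial (Fin 3) ℚ)) ?_
  refine MvPolynomial.ringHom_ext (fun r => ?_) h
  have := Subsingleton.elim (((f.comp (algebraMap (MvPolynomial (Fin 3) ℚ) K)).comp MvPolynomial.C))
    (((g.comp (algebraMap (MvPolynomial (Fin 3) ℚ) K)).comp MvPolynomial.C))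
  exact DFunLike.congr_fun this r

theorem K.algEquiv_ext {f g : K ≃ₐ[ℚ] K} (h : ∀ i, f (Xv i) = g (Xv i)) : f = g := by
  have := K.ringHom_ext (f := (f : K →+* K)) (g := (g : K →+* K)) h
  ext x
  exact DFunLike.congr_fun this x

theorem Xv_ne_zero (i : Fin 3) : Xv i ≠ 0 := by
  intro h
  have := expand_Xv 1 i
  rw [h, map_zero] at this
  exact one_ne_zero (α := ℚ) (by simpa using this.symm)

theorem lead_Xv (σ : Equiv.Perm (Fin 3)) (i : Fin 3) :
    Lead (expand σ (Xv i)) (expBasis (σ i)) 1 := by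
  rw [expand_Xv]; exact lead_single _ one_ne_zero

theorem expand_ne_zero (σ : Equiv.Perm (Fin 3)) {f : K} (hf : f ≠ 0) : expand σ f ≠ 0 :=
  (map_ne_zero (expand σ)).mpr hf

theorem lead_map_of_lead (σ : Equiv.Perm (Fin 3)) (g : K ≃ₐ[ℚ] K) (M : LexExp →+ LexExp)
    (hM : StrictMono M) (c : Fin 3 → ℚ)
    (hg : ∀ i, Lead (expand σ (g (Xv i))) (M (expBasis (σ i))) (c i)) {f : K}
    {e : LexExp} {b : ℚ} (hf : Lead (expand σ f) e b) :
    Lead (expand σ (g f)) (M e) (b * ∏ i, c i ^ (expCoord (σ i) e)) := by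
  have := lead_map σ g M hM c hg (f := f) (by rintro rfl; exact hf.1 (map_zero _))
  rwa [hf.2.1, hf.2.2] at this

/-- An automorphism of finite order of `ℚ(x,y,z)` which acts on leading exponents in an
order-preserving way and has positive leading coefficients is the identity. -/
theorem eq_one_of_pow_eq_one (σ : Equiv.Perm (Fin 3)) (g : K ≃ₐ[ℚ] K) {n : ℕ} (hn : 0 < n)
    (hgn : g ^ n = 1) (M : LexExp →+ LexExp) (hM : StrictMono M) (c : Fin 3 → ℚ)
    (hg : ∀ i, Lead (expand σ (g (Xv i))) (M (expBasis (σ i))) (c i)) (hc : ∀ i, 0 < c i) :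
    g = 1 := by
  have hM1 : ∀ e, M e = e := by
    have hk : ∀ k : ℕ, ∀ i, ∃ b, Lead (expand σ ((g ^ k) (Xv i))) (M^[k] (expBasis (σ i))) b := by
      intro k i
      induction k with
      | zero => exact ⟨_, by simpa using lead_Xv σ i⟩
      | succ k ih =>
        obtain ⟨b, hb⟩ := ih
        have := lead_map_of_lead σ g M hM c hg hb
        rw [← Function.iterate_succ_apply' M] at this
        rw [pow_succ']
        exact ⟨_, this⟩
    have hMn : ∀ e, M^[n] e = e := by
      have h1 : ∀ i, M^[n] (expBasis i) = expBasis i := by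
        intro i
        obtain ⟨b, hb⟩ := hk n (σ.symm i)
        rw [hgn, Equiv.apply_symm_apply] at hb
        have := lead_Xv σ (σ.symm i)
        rw [Equiv.apply_symm_apply] at this
        exact (hb.unique this).1
      have h2 : ∀ k : ℕ, ∃ M' : LexExp →+ LexExp, ∀ e, M' e = M^[k] e := by
        intro k
        induction k with
        | zero => exact ⟨AddMonoidHom.id _, fun e => rfl⟩
        | succ k ih =>
          obtain ⟨M', h⟩ := ih
          exact ⟨M.comp M', fun e => by simp [Function.iterate_succ_apply', h]⟩
      obtain ⟨M', hM'⟩ := h2 n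
      have : M' = AddMonoidHom.id _ := LexExp.addHom_ext fun i => by rw [hM', h1]; rfl
      intro e
      rw [← hM', this]; rfl
    intro e
    rcases lt_trichotomy e (M e) with h | h | h
    · have := (hM.strictMono_iterate_of_lt_map h) hn
      simp only [hMn, Function.iterate_zero, id] at this
      exact absurd this (lt_irrefl _)
    · exact h.symm
    · have := (hM.strictAnti_iterate_of_map_lt h) hn
      simp only [hMn, Function.iterate_zero, id] at this
      exact absurd this (lt_irrefl _)
  have hMid : M = AddMonoidHom.id _ := AddMonoidHom.ext hM1
  subst hMid
  simp only [AddMonoidHom.id_apply] at hg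
  have hc1 : ∀ i, c i = 1 := by
    intro i
    have hk : ∀ k : ℕ, Lead (expand σ ((g ^ k) (Xv i))) (expBasis (σ i)) (c i ^ k) := by
      intro k
      induction k with
      | zero => simpa using lead_Xv σ i
      | succ k ih =>
        rw [pow_succ', pow_succ]
        have := lead_map_of_lead σ g (AddMonoidHom.id _) hM c hg ih
        rw [Finset.prod_eq_single i] at this
        · simpa [expCoord_expBasis] using this
        · intro j _ hj
          rw [expCoord_expBasis, if_neg (by simpa using hj), zpow_zero]
        · simp
    have := hk n
    rw [hgn] at this
    have := (this.unique (lead_Xv σ i)).2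
    exact (pow_eq_one_iff_of_nonneg (hc i).le hn.ne').mp this
  have key : ∀ f : K, ∀ e b, Lead (expand σ f) e b → Lead (expand σ (g f)) e b := by
    intro f e b hf
    have := lead_map_of_lead σ g (AddMonoidHom.id _) hM c hg hf
    simpa [hc1] using this
  apply K.algEquiv_ext
  intro i
  by_contra hne
  set d := g (Xv i) - Xv i with hd
  have hd0 : d ≠ 0 := sub_ne_zero.mpr hne
  have hdk : ∀ k : ℕ, Lead (expand σ ((g ^ k) d)) (expand σ d).order (expand σ d).leadingCoeff := by
    intro k
    induction k with
    | zero => exact lead_self (expand_ne_zero σ hd0)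
    | succ k ih => rw [pow_succ']; exact key _ _ _ ih
  have hsum : ∀ k : ℕ, ∑ j ∈ Finset.range k, (g ^ j) d = (g ^ k) (Xv i) - Xv i := by
    intro k
    induction k with
    | zero => simp
    | succ k ih =>
      rw [Finset.sum_range_succ, ih, hd, map_sub, pow_succ]
      simp
  have h0 := hsum n
  rw [hgn] at h0
  have h1 := congrArg (fun h => (expand σ h).coeff (expand σ d).order) h0
  simp only [map_sum, HahnSeries.coeff_sum, AlgEquiv.one_apply, sub_self, map_zero,
    coeff_zero] at h1
  rw [Finset.sum_congr rfl fun j _ => (lead_iff.mp (hdk j)).2.1] at h1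
  simp [hn.ne'] at h1
  exact hd0 (by simpa using h1)

/-- Rational functions with positive leading coefficient. -/
def PosLead (σ : Equiv.Perm (Fin 3)) (f : K) : Prop :=
  0 < (expand σ f).leadingCoeff

section LeadingExponent

variable {σ : Equiv.Perm (Fin 3)}

theorem PosLead.ne_zero {f : K} (h : PosLead σ f) : f ≠ 0 := by
  rintro rfl
  simp [PosLead] at h

/-- The leading exponent of a rational function. -/
def val (σ : Equiv.Perm (Fin 3)) (f : K) : LexExp := (expand σ f).order

theorem PosLead.lead {f : K} (h : PosLead σ f) :
    Lead (expand σ f) (val σ f) (expand σ f).leadingCoeff :=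
  lead_self (expand_ne_zero σ h.ne_zero)

theorem Lead.posLead {f : K} {e : LexExp} {c : ℚ} (h : Lead (expand σ f) e c) (hc : 0 < c) :
    PosLead σ f := by rw [PosLead, h.2.2]; exact hc

theorem PosLead.mul {f f' : K} (h : PosLead σ f) (h' : PosLead σ f') : PosLead σ (f * f') := by
  have := h.lead.mul h'.lead
  rw [← map_mul] at this
  exact this.posLead (mul_pos h h')

theorem val_mul {f f' : K} (h : f ≠ 0) (h' : f' ≠ 0) : val σ (f * f') = val σ f + val σ f' := by
  rw [val, map_mul, order_mul (expand_ne_zero σ h) (expand_ne_zero σ h')]; rfl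

theorem PosLead.inv {f : K} (h : PosLead σ f) : PosLead σ f⁻¹ := by
  have := h.lead.inv
  rw [← map_inv₀] at this
  exact this.posLead (inv_pos.mpr h)

theorem PosLead.div {f f' : K} (h : PosLead σ f) (h' : PosLead σ f') : PosLead σ (f / f') := by
  rw [div_eq_mul_inv]; exact h.mul h'.inv

theorem val_inv {f : K} (h : f ≠ 0) : val σ f⁻¹ = -val σ f := by
  have := (lead_self (expand_ne_zero σ h)).inv
  rw [← map_inv₀] at this
  exact this.2.1

theorem val_div {f f' : K} (h : f ≠ 0) (h' : f' ≠ 0) : val σ (f / f') = val σ f - val σ f' := by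
  rw [div_eq_mul_inv, val_mul h (inv_ne_zero h'), val_inv h', sub_eq_add_neg]

theorem val_one : val σ 1 = 0 := by rw [val, map_one, order_one]

theorem posLead_one : PosLead σ 1 := by simp [PosLead]

theorem PosLead.pow {f : K} (h : PosLead σ f) (n : ℕ) : PosLead σ (f ^ n) := by
  induction n with
  | zero => simpa using posLead_one
  | succ n ih => rw [pow_succ]; exact ih.mul h

theorem PosLead.zpow {f : K} (h : PosLead σ f) (n : ℤ) : PosLead σ (f ^ n) := by
  cases n with
  | ofNat n => simpa using h.pow n
  | negSucc n => rw [zpow_negSucc]; exact (h.pow _).inv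

theorem val_pow {f : K} (h : f ≠ 0) (n : ℕ) : val σ (f ^ n) = n • val σ f := by
  induction n with
  | zero => rw [pow_zero, val_one, zero_smul]
  | succ n ih => rw [pow_succ, val_mul (pow_ne_zero _ h) h, ih, succ_nsmul]

theorem val_zpow {f : K} (h : f ≠ 0) (n : ℤ) : val σ (f ^ n) = n • val σ f := by
  cases n with
  | ofNat n => simpa using val_pow h n
  | negSucc n => rw [zpow_negSucc, val_inv (pow_ne_zero _ h), val_pow h, negSucc_zsmul]

theorem posLead_Xv (i : Fin 3) : PosLead σ (Xv i) := (lead_Xv σ i).posLead one_pos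

theorem val_Xv (i : Fin 3) : val σ (Xv i) = expBasis (σ i) := (lead_Xv σ i).2.1

theorem PosLead.add_aux {f f' : K} (h : PosLead σ f) (h' : PosLead σ f')
    (hle : val σ f ≤ val σ f') : PosLead σ (f + f') ∧ val σ (f + f') = val σ f := by
  have H := lead_iff.mp h.lead
  have H' := lead_iff.mp h'.lead
  have hnn : 0 ≤ (expand σ f').coeff (val σ f) := by
    rcases hle.eq_or_lt with he | hlt
    · rw [he, H'.2.1]; exact h'.le
    · rw [H'.2.2 _ hlt]
  have hp : (0 : ℚ) < (expand σ f).leadingCoeff := h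
  have : Lead (expand σ (f + f')) (val σ f)
      ((expand σ f).leadingCoeff + (expand σ f').coeff (val σ f)) := by
    rw [lead_iff, map_add]
    refine ⟨by positivity, by rw [coeff_add, H.2.1], fun δ hδ => ?_⟩
    rw [coeff_add, H.2.2 δ hδ, H'.2.2 δ (hδ.trans_le hle), add_zero]
  exact ⟨this.posLead (by positivity), this.2.1⟩

theorem PosLead.add {f f' : K} (h : PosLead σ f) (h' : PosLead σ f') : PosLead σ (f + f') := by
  rcases le_total (val σ f) (val σ f') with hle | hle
  · exact (h.add_aux h' hle).1
  · rw [add_comm]; exact (h'.add_aux h hle).1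

theorem val_add {f f' : K} (h : PosLead σ f) (h' : PosLead σ f') :
    val σ (f + f') = min (val σ f) (val σ f') := by
  rcases le_total (val σ f) (val σ f') with hle | hle
  · rw [(h.add_aux h' hle).2, min_eq_left hle]
  · rw [add_comm, (h'.add_aux h hle).2, min_eq_right hle]

end LeadingExponent

/-- Additive maps satisfying the Leibniz rule along a ring homomorphism. -/
structure IsDer {L : Type*} [Field L] (ι : K →+* L) (d : K → L) : Prop where
  add : ∀ a b, d (a + b) = d a + d b
  mul : ∀ a b, d (a * b) = ι a * d b + ι b * d a

namespace IsDer

variable {L : Type*} [Field L] {ι : K →+* L} {d : K → L}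

theorem zero (h : IsDer ι d) : d 0 = 0 := by simpa using h.add 0 0

theorem one (h : IsDer ι d) : d 1 = 0 := by simpa using h.mul 1 1

theorem neg (h : IsDer ι d) (a : K) : d (-a) = -d a := by
  have := h.add a (-a)
  rw [add_neg_cancel, h.zero] at this
  exact (neg_eq_of_add_eq_zero_right this.symm).symm

theorem inv (h : IsDer ι d) (a : K) : d a⁻¹ = -(ι a)⁻¹ ^ 2 * d a := by
  rcases eq_or_ne a 0 with rfl | ha
  · simp [h.zero]
  have hι : ι a ≠ 0 := (map_ne_zero ι).mpr ha
  have := h.mul a a⁻¹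
  rw [mul_inv_cancel₀ ha, h.one, map_inv₀] at this
  field_simp
  field_simp at this
  linear_combination -this

theorem inv_eq_zero (h : IsDer ι d) {a : K} (ha : d a = 0) : d a⁻¹ = 0 := by
  rw [h.inv, ha, mul_zero]

theorem mul_eq_zero (h : IsDer ι d) {a b : K} (ha : d a = 0) (hb : d b = 0) : d (a * b) = 0 := by
  rw [h.mul, ha, hb, mul_zero, mul_zero, add_zero]

theorem natCast (h : IsDer ι d) (n : ℕ) : d n = 0 := by
  induction n with
  | zero => simpa using h.zero
  | succ n ih => rw [Nat.cast_succ, h.add, ih, h.one, add_zero]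

theorem algebraMap (h : IsDer ι d) (q : ℚ) : d (algebraMap ℚ K q) = 0 := by
  have hi : ∀ n : ℤ, d n = 0 := by
    rintro (n | n)
    · simpa using h.natCast n
    · rw [Int.cast_negSucc, h.neg, h.natCast, neg_zero]
  rw [eq_ratCast, Rat.cast_def, div_eq_mul_inv]
  exact h.mul_eq_zero (hi _) (h.inv_eq_zero (h.natCast _))

theorem eq_zero_of_mem_adjoin (h : IsDer ι d) {s : Set K} (hs : ∀ x ∈ s, d x = 0) {f : K}
    (hf : f ∈ IntermediateField.adjoin ℚ s) : d f = 0 := by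
  induction hf using IntermediateField.adjoin_induction with
  | mem x hx => exact hs x hx
  | algebraMap q => exact h.algebraMap q
  | add a b _ _ ha hb => rw [h.add, ha, hb, add_zero]
  | inv a _ ha => exact h.inv_eq_zero ha
  | mul a b _ _ ha hb => exact h.mul_eq_zero ha hb

end IsDer

theorem mem_adjoin_range_Xv (f : K) : f ∈ IntermediateField.adjoin ℚ (Set.range Xv) := by
  have hp : ∀ p : MvPolynomial (Fin 3) ℚ,
      algebraMap _ K p ∈ IntermediateField.adjoin ℚ (Set.range Xv) := by
    intro p
    induction p using MvPolynomial.induction_on with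
    | C a =>
      have := IntermediateField.algebraMap_mem (IntermediateField.adjoin ℚ (Set.range Xv)) a
      rwa [IsScalarTower.algebraMap_apply ℚ (MvPolynomial (Fin 3) ℚ) K] at this
    | add p q hp hq => rw [map_add]; exact add_mem hp hq
    | mul_X p i hp =>
      rw [map_mul]
      exact mul_mem hp (IntermediateField.subset_adjoin _ _ ⟨i, rfl⟩)
  obtain ⟨p, q, hq, rfl⟩ := IsFractionRing.div_surjective (A := MvPolynomial (Fin 3) ℚ) f
  exact div_mem (hp p) (hp q)

/-- The homomorphism `f ↦ f + ε ∂_i f` on polynomials. -/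
def polyDualHom (i : Fin 3) : MvPolynomial (Fin 3) ℚ →+* DualNumber K :=
  MvPolynomial.eval₂Hom ((TrivSqZeroExt.inlHom K K).comp (algebraMap ℚ K))
    fun j => TrivSqZeroExt.inl (Xv j) + TrivSqZeroExt.inr (if j = i then 1 else 0)

theorem fst_polyDualHom (i : Fin 3) (p : MvPolynomial (Fin 3) ℚ) :
    (polyDualHom i p).fst = algebraMap _ K p := by
  induction p using MvPolynomial.induction_on with
  | C a =>
    simp only [polyDualHom, MvPolynomial.coe_eval₂Hom, MvPolynomial.eval₂_C]
    rw [← MvPolynomial.algebraMap_eq, ← IsScalarTower.algebraMap_apply]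
    rfl
  | add p q hp hq => rw [map_add, TrivSqZeroExt.fst_add, hp, hq, map_add]
  | mul_X p j hp =>
    rw [map_mul, TrivSqZeroExt.fst_mul, hp, map_mul]
    congr 1
    simp only [polyDualHom, MvPolynomial.coe_eval₂Hom, MvPolynomial.eval₂_X,
      TrivSqZeroExt.fst_add, TrivSqZeroExt.fst_inl, TrivSqZeroExt.fst_inr, add_zero]
    rfl

/-- The homomorphism to dual numbers `f ↦ f + ε ∂_i f`. -/
def dualHom (i : Fin 3) : K →+* DualNumber K :=
  IsLocalization.lift (M := nonZeroDivisors (MvPolynomial (Fin 3) ℚ)) (g := polyDualHom i) (by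
    intro y
    rw [TrivSqZeroExt.isUnit_iff_isUnit_fst, fst_polyDualHom]
    exact isUnit_iff_ne_zero.mpr (IsFractionRing.to_map_ne_zero_of_mem_nonZeroDivisors y.2))

theorem dualHom_Xv (i j : Fin 3) : dualHom i (Xv j) = (TrivSqZeroExt.inl (Xv j) +
    TrivSqZeroExt.inr (if j = i then 1 else 0) : DualNumber K) := by
  rw [dualHom, Xv, IsLocalization.lift_eq]
  simp only [polyDualHom, MvPolynomial.coe_eval₂Hom, MvPolynomial.eval₂_X]
  rfl

theorem fst_dualHom (i : Fin 3) (f : K) : (dualHom i f).fst = f := by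
  have : ((TrivSqZeroExt.fstHom K K K).toRingHom.comp (dualHom i)) = RingHom.id K := by
    refine K.ringHom_ext fun j => ?_
    change (dualHom i (Xv j)).fst = Xv j
    rw [dualHom_Xv, TrivSqZeroExt.fst_add, TrivSqZeroExt.fst_inl, TrivSqZeroExt.fst_inr, add_zero]
  exact DFunLike.congr_fun this f

/-- Partial derivatives of rational functions. -/
def pd (i : Fin 3) (f : K) : K := (dualHom i f).snd

theorem isDer_pd (i : Fin 3) : IsDer (RingHom.id K) (pd i) where
  add a b := by simp [pd]
  mul a b := by
    simp only [pd, map_mul, TrivSqZeroExt.snd_mul, fst_dualHom, RingHom.id_apply]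
    simp [mul_comm]

theorem pd_Xv (i j : Fin 3) : pd i (Xv j) = if j = i then 1 else 0 := by
  rw [pd, dualHom_Xv, TrivSqZeroExt.snd_add, TrivSqZeroExt.snd_inl, TrivSqZeroExt.snd_inr, zero_add]

theorem pd_comp (φ : K →+* K) (j : Fin 3) (f : K) :
    pd j (φ f) = ∑ i, φ (pd i f) * pd j (φ (Xv i)) := by
  have h : IsDer φ (fun f => pd j (φ f) - ∑ i, φ (pd i f) * pd j (φ (Xv i))) := by
    constructor
    · intro a b
      simp only [map_add, (isDer_pd _).add, add_mul, Finset.sum_add_distrib]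
      ring
    · intro a b
      simp only [map_mul, (isDer_pd _).mul, map_add, add_mul, Finset.sum_add_distrib,
        RingHom.id_apply, mul_assoc, ← Finset.mul_sum]
      ring
  have := h.eq_zero_of_mem_adjoin (s := Set.range Xv) (by
    rintro _ ⟨k, rfl⟩
    simp only [pd_Xv]
    rw [Finset.sum_eq_single k]
    · simp
    · intro i _ hi; rw [if_neg hi.symm, map_zero, zero_mul]
    · simp) (mem_adjoin_range_Xv f)
  exact sub_eq_zero.mp this

/-- The field of rational functions which do not depend on the `j`-th variable. -/
def Free (j : Fin 3) : IntermediateField ℚ K :=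
  IntermediateField.adjoin ℚ (Xv '' {i | i ≠ j})

theorem Xv_mem_free {i j : Fin 3} (h : i ≠ j) : Xv i ∈ Free j :=
  IntermediateField.subset_adjoin _ _ ⟨i, h, rfl⟩

theorem pd_eq_zero_of_mem_free {j : Fin 3} {f : K} (hf : f ∈ Free j) : pd j f = 0 :=
  (isDer_pd j).eq_zero_of_mem_adjoin (by
    rintro _ ⟨i, hi, rfl⟩
    rw [pd_Xv, if_neg hi]) hf

theorem map_eq_self_of_mem_free {j : Fin 3} {φ : K ≃ₐ[ℚ] K} (hφ : ∀ i ≠ j, φ (Xv i) = Xv i) {f : K}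
    (hf : f ∈ Free j) : φ f = f := by
  induction hf using IntermediateField.adjoin_induction with
  | mem x hx => obtain ⟨i, hi, rfl⟩ := hx; exact hφ i hi
  | algebraMap q => exact φ.commutes q
  | add a b _ _ ha hb => rw [map_add, ha, hb]
  | inv a _ ha => rw [map_inv₀, ha]
  | mul a b _ _ ha hb => rw [map_mul, ha, hb]

/-- The Euler derivation on Hahn series. -/
def hahnEuler (j : Fin 3) (h : Hahn3) : Hahn3 where
  coeff e := expCoord j e * h.coeff e
  isPWO_support' := h.isPWO_support.mono fun e he => by
    simp only [Function.mem_support] at he ⊢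
    exact right_ne_zero_of_mul he

theorem hahnEuler_add (j : Fin 3) (u v : Hahn3) :
    hahnEuler j (u + v) = hahnEuler j u + hahnEuler j v := by
  ext e
  simp [hahnEuler, mul_add]

theorem hahnEuler_mul (j : Fin 3) (u v : Hahn3) :
    hahnEuler j (u * v) = u * hahnEuler j v + hahnEuler j u * v := by
  have hsub : ∀ w : Hahn3, (hahnEuler j w).support ⊆ w.support := fun w e he =>
    right_ne_zero_of_mul he
  ext e
  rw [coeff_add, coeff_mul_right' v.isPWO_support (hsub v),
    coeff_mul_left' u.isPWO_support (hsub u), ← Finset.sum_add_distrib]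
  change (expCoord j e : ℚ) * (u * v).coeff e = _
  rw [coeff_mul, Finset.mul_sum]
  refine Finset.sum_congr rfl fun p hp => ?_
  have h1 : p.1 + p.2 = e := (Finset.mem_antidiagonal.mp hp).2.2
  change _ = u.coeff p.1 * ((expCoord j p.2 : ℚ) * v.coeff p.2) +
    ((expCoord j p.1 : ℚ) * u.coeff p.1) * v.coeff p.2
  rw [← h1, map_add]
  push_cast
  ring

theorem isDer_hahnEuler (σ : Equiv.Perm (Fin 3)) (j : Fin 3) :
    IsDer (expand σ : K →+* Hahn3) (fun f => hahnEuler j (expand σ f)) where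
  add a b := by rw [map_add, hahnEuler_add]
  mul a b := by rw [map_mul, hahnEuler_mul, mul_comm (hahnEuler j (expand σ a))]; rfl

theorem hahnEuler_expand_of_mem_free {j : Fin 3} {f : K} (σ : Equiv.Perm (Fin 3))
    (hf : f ∈ Free j) : hahnEuler (σ j) (expand σ f) = 0 := by
  refine (isDer_hahnEuler σ (σ j)).eq_zero_of_mem_adjoin ?_ hf
  rintro _ ⟨i, hi, rfl⟩
  ext e
  change (expCoord (σ j) e : ℚ) * (expand σ (Xv i)).coeff e = 0
  rw [expand_Xv, coeff_single]
  split_ifs with h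
  · have : ¬ σ j = σ i := fun h => hi (σ.injective h.symm)
    rw [h, expCoord_expBasis, if_neg this]
    simp
  · simp

theorem expand_coeff_eq_zero_of_mem_free {j : Fin 3} {f : K} (σ : Equiv.Perm (Fin 3))
    (hf : f ∈ Free j) {e : LexExp} (he : expCoord (σ j) e ≠ 0) : (expand σ f).coeff e = 0 := by
  have := congrArg (fun h => h.coeff e) (hahnEuler_expand_of_mem_free σ hf)
  have h2 : (expCoord (σ j) e : ℚ) * (expand σ f).coeff e = 0 := this
  exact (mul_eq_zero.mp h2).resolve_left (by exact_mod_cast he)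

/-- Subtraction-free rational functions. -/
inductive SubFree : K → Prop
  | X (i : Fin 3) : SubFree (Xv i)
  | one : SubFree 1
  | add {f g : K} : SubFree f → SubFree g → SubFree (f + g)
  | mul {f g : K} : SubFree f → SubFree g → SubFree (f * g)
  | inv {f : K} : SubFree f → SubFree f⁻¹

theorem SubFree.posLead (σ : Equiv.Perm (Fin 3)) {f : K} (h : SubFree f) : PosLead σ f := by
  induction h with
  | X i => exact posLead_Xv i
  | one => exact posLead_one
  | add _ _ h1 h2 => exact h1.add h2
  | mul _ _ h1 h2 => exact h1.mul h2
  | inv _ h => exact h.inv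

theorem SubFree.ne_zero {f : K} (h : SubFree f) : f ≠ 0 := (h.posLead 1).ne_zero

theorem SubFree.div {f g : K} (hf : SubFree f) (hg : SubFree g) : SubFree (f / g) := by
  rw [div_eq_mul_inv]; exact hf.mul hg.inv

theorem SubFree.pow {f : K} (h : SubFree f) (n : ℕ) : SubFree (f ^ n) := by
  induction n with
  | zero => rw [pow_zero]; exact .one
  | succ n ih => rw [pow_succ]; exact ih.mul h

theorem SubFree.zpow {f : K} (h : SubFree f) (n : ℤ) : SubFree (f ^ n) := by
  cases n with
  | ofNat n => simpa using h.pow n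
  | negSucc n => rw [zpow_negSucc]; exact (h.pow _).inv

theorem SubFree.sum {ι : Type*} {s : Finset ι} (hs : s.Nonempty) {f : ι → K}
    (h : ∀ i ∈ s, SubFree (f i)) : SubFree (∑ i ∈ s, f i) := by
  induction hs using Finset.Nonempty.cons_induction with
  | singleton a => simpa using h
  | cons a s ha hs ih =>
    rw [Finset.sum_cons]
    exact (h a (by simp)).add (ih fun i hi => h i (by simp [hi]))

theorem SubFree.prod {ι : Type*} {s : Finset ι} {f : ι → K}
    (h : ∀ i ∈ s, SubFree (f i)) : SubFree (∏ i ∈ s, f i) := by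
  classical
  induction s using Finset.induction_on with
  | empty => simpa using SubFree.one
  | insert a s ha ih =>
    rw [Finset.prod_insert ha]
    exact (h a (by simp)).mul (ih fun i hi => h i (by simp [hi]))

/-- Three involutions `x_c ↦ R_c / x_c` of `ℚ(x,y,z)`. -/
structure ReflSystem (φ : Fin 3 → K ≃ₐ[ℚ] K) (R : Fin 3 → K) : Prop where
  self : ∀ c, φ c (Xv c) = R c / Xv c
  other : ∀ c, ∀ i ≠ c, φ c (Xv i) = Xv i
  free : ∀ c, R c ∈ Free c
  subFree : ∀ c, SubFree (R c)
  indep : ∀ c j, pd j (R c) = 0 → R c ∈ Free j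

namespace ReflSystem

variable {φ : Fin 3 → K ≃ₐ[ℚ] K} {R : Fin 3 → K}

theorem ne_zero (H : ReflSystem φ R) (c : Fin 3) : R c ≠ 0 := (H.subFree c).ne_zero

theorem map_free (H : ReflSystem φ R) {c : Fin 3} {f : K} (hf : f ∈ Free c) : φ c f = f :=
  map_eq_self_of_mem_free (H.other c) hf

theorem mul_self (H : ReflSystem φ R) (c : Fin 3) : φ c * φ c = 1 := by
  refine K.algEquiv_ext fun i => ?_
  rw [AlgEquiv.mul_apply, AlgEquiv.one_apply]
  rcases eq_or_ne i c with rfl | h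
  · have := H.ne_zero i
    have := Xv_ne_zero i
    rw [H.self, map_div₀, H.self, H.map_free (H.free i)]
    field_simp
  · rw [H.other c i h, H.other c i h]

theorem apply_apply (H : ReflSystem φ R) (c : Fin 3) (f : K) : φ c (φ c f) = f :=
  DFunLike.congr_fun (H.mul_self c) f

theorem inv_eq (H : ReflSystem φ R) (c : Fin 3) : (φ c)⁻¹ = φ c :=
  inv_eq_of_mul_eq_one_left (H.mul_self c)

theorem subFree_map (H : ReflSystem φ R) (c : Fin 3) {f : K} (hf : SubFree f) :
    SubFree (φ c f) := by
  induction hf with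
  | X i =>
    rcases eq_or_ne i c with rfl | h
    · rw [H.self]; exact (H.subFree i).div (.X i)
    · rw [H.other c i h]; exact .X i
  | one => rw [map_one]; exact .one
  | add _ _ h1 h2 => rw [map_add]; exact h1.add h2
  | mul _ _ h1 h2 => rw [map_mul]; exact h1.mul h2
  | inv _ h => rw [map_inv₀]; exact h.inv

/-- `φ_c` preserves the functions independent of `x_d` if `R_c` does not depend on `x_d`. -/
theorem map_mem_free (H : ReflSystem φ R) {c d : Fin 3} (hcd : c ≠ d) (h : R c ∈ Free d) {f : K}
    (hf : f ∈ Free d) : φ c f ∈ Free d := by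
  induction hf using IntermediateField.adjoin_induction with
  | mem x hx =>
    obtain ⟨i, hi, rfl⟩ := hx
    rcases eq_or_ne i c with rfl | hic
    · rw [H.self]; exact div_mem h (Xv_mem_free hcd)
    · rw [H.other c i hic]; exact Xv_mem_free hi
  | algebraMap q => rw [AlgEquiv.commutes]; exact IntermediateField.algebraMap_mem _ q
  | add a b _ _ ha hb => rw [map_add]; exact add_mem ha hb
  | inv a _ ha => rw [map_inv₀]; exact inv_mem ha
  | mul a b _ _ ha hb => rw [map_mul]; exact mul_mem ha hb

/-- If `R_c` does not depend on `x_d` and `φ_c φ_d` has finite order then `φ_c` fixes `R_d`. -/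
theorem map_eq_self_of_free (H : ReflSystem φ R) {c d : Fin 3} (hcd : c ≠ d) (h : R c ∈ Free d)
    {n : ℕ} (hn : 0 < n) (hfin : (φ c * φ d) ^ n = 1) : φ c (R d) = R d := by
  set g := φ c * φ d with hg
  have hRd : φ c (R d) ∈ Free d := H.map_mem_free hcd h (H.free d)
  have hc0 := H.ne_zero c
  have hd0 := H.ne_zero d
  have hxc := Xv_ne_zero c
  have hxd := Xv_ne_zero d
  have hpos : SubFree (φ c (R d)) := H.subFree_map c (H.subFree d)
  have hpos0 := hpos.ne_zero
  set ρ := R d / φ c (R d) with hρ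
  have hρSF : SubFree ρ := (H.subFree d).div hpos
  have hρfree : ρ ∈ Free d := div_mem (H.free d) hRd
  have hgc : g (g (Xv c)) = Xv c := by
    simp only [hg, AlgEquiv.mul_apply]
    rw [H.other d c hcd, H.self, map_div₀, H.map_free h, H.other d c hcd, map_div₀, H.self,
      H.map_free (H.free c)]
    field_simp
  have hgd : g (g (Xv d)) = Xv d * ρ := by
    simp only [hg, AlgEquiv.mul_apply]
    rw [H.self d, map_div₀, H.other c d hcd.symm, map_div₀, H.map_free hRd, H.self d, map_div₀,
      H.apply_apply, map_div₀, H.other c d hcd.symm, hρ]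
    field_simp
  have hge : ∀ i, i ≠ c → i ≠ d → g (g (Xv i)) = Xv i := by
    intro i hic hid
    simp only [hg, AlgEquiv.mul_apply]
    rw [H.other d i hid, H.other c i hic, H.other d i hid, H.other c i hic]
  have hg2 : ∀ i ≠ d, (g * g) (Xv i) = Xv i := by
    intro i hi
    rw [AlgEquiv.mul_apply]
    rcases eq_or_ne i c with rfl | hic
    · exact hgc
    · exact hge i hic hi
  have hgρ : (g * g) ρ = ρ := map_eq_self_of_mem_free hg2 hρfree
  have hpow : ∀ k : ℕ, ((g * g) ^ k) (Xv d) = Xv d * ρ ^ k := by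
    intro k
    induction k with
    | zero => simp
    | succ k ih =>
      rw [pow_succ', AlgEquiv.mul_apply, ih, map_mul, map_pow, hgρ, AlgEquiv.mul_apply, hgd]
      ring
  have hgn : (g * g) ^ n = 1 := by rw [← pow_two, ← pow_mul, mul_comm, pow_mul, hfin, one_pow]
  have hρn : ρ ^ n = 1 := by
    have := hpow n
    rw [hgn, AlgEquiv.one_apply] at this
    exact mul_left_cancel₀ hxd (by rw [← this, mul_one])
  have hv : val 1 ρ = 0 := by
    have := val_pow (σ := 1) hρSF.ne_zero n
    rw [hρn, val_one] at this
    exact (smul_eq_zero_iff_right hn.ne').mp this.symm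
  have h1 : g * g = 1 := by
    refine eq_one_of_pow_eq_one 1 (g * g) hn hgn (AddMonoidHom.id _) strictMono_id
      (fun i => if i = d then (expand 1 ρ).leadingCoeff else 1) ?_ ?_
    · intro i
      split_ifs with hi
      · subst hi
        have := (lead_Xv 1 i).mul (hρSF.posLead 1).lead
        rw [← map_mul, hv, add_zero, one_mul, ← hgd] at this
        exact this
      · rw [hg2 i hi]; exact lead_Xv 1 i
    · intro i
      split_ifs
      · exact hρSF.posLead 1
      · exact one_pos
  have h2 := hgd
  rw [← AlgEquiv.mul_apply, h1, AlgEquiv.one_apply] at h2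
  have h3 : ρ = 1 := mul_left_cancel₀ hxd (by rw [← h2, mul_one])
  rw [hρ, div_eq_one_iff_eq hpos0] at h3
  exact h3.symm

/-- A function of `x_k` alone which is fixed by `φ_k` is constant as soon as `R_k` depends on some
variable. -/
theorem pd_eq_zero_of_map_eq (H : ReflSystem φ R) {k i : Fin 3} (hik : i ≠ k) {r : K}
    (hr : ∀ l ≠ k, pd l r = 0) (hfix : φ k r = r) (hR : R k ∉ Free i) : pd k r = 0 := by
  have h1 : pd i (φ k r) = _ := pd_comp (φ k : K →+* K) i r
  rw [hfix, hr i hik, Finset.sum_eq_single k] at h1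
  · have h2 : pd i (φ k (Xv k)) = (Xv k)⁻¹ * pd i (R k) := by
      rw [H.self, div_eq_mul_inv, (isDer_pd i).mul, (isDer_pd i).inv, pd_Xv, if_neg hik.symm]
      simp
    have h3 : φ k (pd k r) * pd i (φ k (Xv k)) = 0 := h1.symm
    rw [h2] at h3
    have h4 : pd i (R k) ≠ 0 := fun h => hR (H.indep k i h)
    have h5 := (mul_eq_zero.mp h3).resolve_right
      (mul_ne_zero (inv_ne_zero (Xv_ne_zero k)) h4)
    simpa using h5
  · intro l _ hl
    simp [hr l hl]
  · simp

end ReflSystem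

/-- The vector with entries `e, k, m` at the positions `c, j` and the remaining one. -/
def stepVec (c j : Fin 3) (e k m : ℤ) : Fin 3 → ℤ := fun i => if i = c then e else if i = j then k else m

/-- The possible entries of a step. -/
abbrev entries : Finset ℤ := {-1, 0, 1}

/-- The coefficient of `x_j^k` in `Bm S c e`. -/
def stepCoeff (S : Finset (Fin 3 → ℤ)) (c j l : Fin 3) (e k : ℤ) : K :=
  ∑ m ∈ entries, if stepVec c j e k m ∈ S then Xv l ^ m else 0

theorem eq_or_of_distinct {c j l : Fin 3} (h1 : c ≠ j) (h2 : c ≠ l) (h3 : j ≠ l) (i : Fin 3) :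
    i = c ∨ i = j ∨ i = l := by
  revert c j l i; decide

theorem univ_erase_eq {c j l : Fin 3} (h1 : c ≠ j) (h2 : c ≠ l) (h3 : j ≠ l) :
    Finset.univ.erase c = {j, l} := by
  revert c j l; decide

theorem Bm_eq_sum_stepCoeff {S : Finset (Fin 3 → ℤ)}
    (hS : ∀ s ∈ S, (∀ c : Fin 3, s c = -1 ∨ s c = 0 ∨ s c = 1) ∧ s ≠ 0) {c j l : Fin 3}
    (h1 : c ≠ j) (h2 : c ≠ l) (h3 : j ≠ l) (e : ℤ) :
    Bm S c e = ∑ k ∈ entries, stepCoeff S c j l e k * Xv j ^ k := by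
  have hval : ∀ e k m, stepVec c j e k m c = e ∧ stepVec c j e k m j = k ∧
      stepVec c j e k m l = m := by
    intro e k m
    simp [stepVec, h1.symm, h2.symm, h3.symm]
  have hmem : ∀ s ∈ S, ∀ i, s i ∈ entries := by
    intro s hs i
    simpa using (hS s hs).1 i
  simp_rw [stepCoeff, Finset.sum_mul, ite_mul, zero_mul]
  rw [← Finset.sum_product', ← Finset.sum_filter, Bm]
  refine Finset.sum_nbij' (fun s => (s j, s l)) (fun p => stepVec c j e p.1 p.2) ?_ ?_ ?_ ?_ ?_
  · intro s hs
    obtain ⟨hsS, hsc⟩ := Finset.mem_filter.mp hs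
    refine Finset.mem_filter.mpr ⟨Finset.mem_product.mpr ⟨hmem s hsS j, hmem s hsS l⟩, ?_⟩
    convert hsS
    funext i
    rcases eq_or_of_distinct h1 h2 h3 i with rfl | rfl | rfl
    · exact (hval _ _ _).1.trans hsc.symm
    · exact (hval _ _ _).2.1
    · exact (hval _ _ _).2.2
  · intro p hp
    exact Finset.mem_filter.mpr ⟨(Finset.mem_filter.mp hp).2, (hval _ _ _).1⟩
  · intro s hs
    funext i
    rcases eq_or_of_distinct h1 h2 h3 i with rfl | rfl | rfl
    · exact (hval _ _ _).1.trans (Finset.mem_filter.mp hs).2.symm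
    · exact (hval _ _ _).2.1
    · exact (hval _ _ _).2.2
  · intro p _
    exact Prod.ext (hval _ _ _).2.1 (hval _ _ _).2.2
  · intro s _
    rw [univ_erase_eq h1 h2 h3, Finset.prod_pair h3, mul_comm]

theorem stepCoeff_mem_free (S : Finset (Fin 3 → ℤ)) {c j l i : Fin 3} (h : l ≠ i) (e k : ℤ) :
    stepCoeff S c j l e k ∈ Free i := by
  refine sum_mem fun m _ => ?_
  split_ifs
  · exact zpow_mem (Xv_mem_free h) m
  · exact zero_mem _

theorem subFree_Bm {S : Finset (Fin 3 → ℤ)} {c : Fin 3} {e : ℤ} (h : Bm S c e ≠ 0) :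
    SubFree (Bm S c e) :=
  SubFree.sum (Finset.nonempty_of_sum_ne_zero h) fun _ _ => SubFree.prod fun i _ => (SubFree.X i).zpow _

theorem Bm_mem_free (S : Finset (Fin 3 → ℤ)) (c : Fin 3) (e : ℤ) : Bm S c e ∈ Free c :=
  sum_mem fun _ _ => prod_mem fun _ hi => zpow_mem (Xv_mem_free (Finset.ne_of_mem_erase hi)) _

/-- A quotient of quadratic polynomials in `x_j` with vanishing derivative with respect to `x_j`
does not depend on `x_j`. -/
theorem mem_free_of_pd_eq_zero {j : Fin 3} {a b : ℤ → K} (ha : ∀ k, a k ∈ Free j)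
    (hb : ∀ k, b k ∈ Free j) (hb0 : ∑ k ∈ entries, b k * Xv j ^ k ≠ 0)
    (h : pd j ((∑ k ∈ entries, a k * Xv j ^ k) / ∑ k ∈ entries, b k * Xv j ^ k) = 0) :
    (∑ k ∈ entries, a k * Xv j ^ k) / (∑ k ∈ entries, b k * Xv j ^ k) ∈ Free j := by
  set R := (∑ k ∈ entries, a k * Xv j ^ k) / ∑ k ∈ entries, b k * Xv j ^ k with hR
  have hx := Xv_ne_zero j
  have hexp : ∀ a : ℤ → K, Xv j * ∑ k ∈ entries, a k * Xv j ^ k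
      = a (-1) + a 0 * Xv j + a 1 * (Xv j * Xv j) := by
    intro a
    simp [entries]
    field_simp
    ring
  have hD := isDer_pd j
  have hXX : pd j (Xv j) = 1 := by rw [pd_Xv, if_pos rfl]
  have hd1 : ∀ a : ℤ → K, (∀ k, a k ∈ Free j) → pd j (a (-1) + a 0 * Xv j + a 1 * (Xv j * Xv j))
      = a 0 + 2 * a 1 * Xv j := by
    intro a ha
    have h0 := fun k => pd_eq_zero_of_mem_free (ha k)
    simp only [hD.add, hD.mul, h0, hXX, RingHom.id_apply]
    ring
  have hd2 : ∀ a : ℤ → K, (∀ k, a k ∈ Free j) → pd j (a 0 + 2 * a 1 * Xv j) = 2 * a 1 := by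
    intro a ha
    have h0 := fun k => pd_eq_zero_of_mem_free (ha k)
    have h2 : pd j 2 = 0 := by simpa using hD.natCast 2
    simp only [hD.add, hD.mul, h0, hXX, RingHom.id_apply, h2]
    ring
  have hm : ∀ u : K, pd j (R * u) = R * pd j u := by
    intro u
    rw [hD.mul, h]
    simp
  have e0 : a (-1) + a 0 * Xv j + a 1 * (Xv j * Xv j)
      = R * (b (-1) + b 0 * Xv j + b 1 * (Xv j * Xv j)) := by
    rw [← hexp, ← hexp, hR]
    field_simp
  have e1 := congrArg (pd j) e0
  rw [hm, hd1 a ha, hd1 b hb] at e1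
  have e2 := congrArg (pd j) e1
  rw [hm, hd2 a ha, hd2 b hb] at e2
  have f1 : a 1 = R * b 1 := by linear_combination e2 / 2
  have f0 : a 0 = R * b 0 := by linear_combination e1 - 2 * Xv j * f1
  have fm : a (-1) = R * b (-1) := by linear_combination e0 - Xv j * f0 - Xv j * Xv j * f1
  obtain ⟨k, hk, hbk⟩ : ∃ k, a k = R * b k ∧ b k ≠ 0 := by
    by_contra hcon
    push Not at hcon
    apply hb0
    simp [entries, hcon _ f1, hcon _ f0, hcon _ fm]
  have : R = a k / b k := by rw [hk, mul_div_cancel_right₀ _ hbk]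
  rw [this]
  exact div_mem (ha k) (hb k)

theorem exists_distinct {c j : Fin 3} (h : c ≠ j) : ∃ l, c ≠ l ∧ j ≠ l := by
  revert c j; decide

/-- The involutions attached to a stepset. -/
theorem reflSystem_of_isPhi {S : Finset (Fin 3 → ℤ)}
    (hS : ∀ s ∈ S, (∀ c : Fin 3, s c = -1 ∨ s c = 0 ∨ s c = 1) ∧ s ≠ 0)
    {φ : Fin 3 → K ≃ₐ[ℚ] K} (hφ : ∀ c, IsPhi S c (φ c)) :
    ReflSystem φ (fun c => Bm S c (-1) / Bm S c 1) := by
  have hne : ∀ c, Bm S c (-1) ≠ 0 ∧ Bm S c 1 ≠ 0 := by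
    intro c
    have h1 := (hφ c).1
    have h2 : φ c (Xv c) ≠ 0 := (map_ne_zero (φ c)).mpr (Xv_ne_zero c)
    constructor
    · intro h; rw [h] at h1; simp at h1; exact Xv_ne_zero c h1
    · intro h; rw [h] at h1; simp at h1; exact Xv_ne_zero c h1
  refine ⟨fun c => ?_, fun c => (hφ c).2, fun c => div_mem (Bm_mem_free _ _ _) (Bm_mem_free _ _ _),
    fun c => (subFree_Bm (hne c).1).div (subFree_Bm (hne c).2), fun c j h => ?_⟩
  · rw [(hφ c).1]; ring
  · rcases eq_or_ne j c with rfl | hjc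
    · exact div_mem (Bm_mem_free _ _ _) (Bm_mem_free _ _ _)
    · obtain ⟨l, h2, h3⟩ := exists_distinct hjc.symm
      have h4 := (hne c).2
      simp only [Bm_eq_sum_stepCoeff hS hjc.symm h2 h3] at h h4 ⊢
      exact mem_free_of_pd_eq_zero (fun k => stepCoeff_mem_free S h3.symm _ k)
        (fun k => stepCoeff_mem_free S h3.symm _ k) h4 h

/-! ### Weighted two-dimensional models: computations -/

/-- The homogeneous quadratic polynomial `a d² + b n d + c n²`. -/
def quad {R : Type*} [CommSemiring R] (a b c n d : R) : R := a * (d * d) + n * (b * d + c * n)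

/-- The polynomial in `z` whose coefficients are the three lowest binary digits of `m`. -/
def maskPoly {R : Type*} [CommSemiring R] (z : R) (m : ℕ) : R :=
  ((m % 2 : ℕ) : R) + ((m / 2 % 2 : ℕ) : R) * z + ((m / 4 : ℕ) : R) * (z * z)

/-- The weights of the steps of a two-dimensional model. -/
structure Weights (R : Type*) where
  (a₀₀ a₀₁ a₀₂ a₁₀ a₁₂ a₂₀ a₂₁ a₂₂ : R)

/-- Apply a function to all weights. -/
def Weights.map {R R' : Type*} (f : R → R') (w : Weights R) : Weights R' :=
  ⟨f w.a₀₀, f w.a₀₁, f w.a₀₂, f w.a₁₀, f w.a₁₂, f w.a₂₀, f w.a₂₁, f w.a₂₂⟩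

/-- The action of the product of the two reflections of a model on pairs of fractions. -/
def doubleStep {R : Type*} [CommSemiring R] (w : Weights R) (s : R × R × R × R) : R × R × R × R :=
  let n := quad w.a₀₀ w.a₀₁ w.a₀₂ s.2.2.1 s.2.2.2 * s.2.1
  let d := quad w.a₂₀ w.a₂₁ w.a₂₂ s.2.2.1 s.2.2.2 * s.1
  (n, d, quad w.a₀₀ w.a₁₀ w.a₂₀ n d * s.2.2.2, quad w.a₀₂ w.a₁₂ w.a₂₂ n d * s.2.2.1)

theorem map_quad {R R' : Type*} [CommSemiring R] [CommSemiring R'] (f : R →+* R') (a b c n d : R) :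
    f (quad a b c n d) = quad (f a) (f b) (f c) (f n) (f d) := by
  simp [quad]

theorem map_maskPoly {R R' : Type*} [CommSemiring R] [CommSemiring R'] (f : R →+* R') (z : R)
    (m : ℕ) : f (maskPoly z m) = maskPoly (f z) m := by
  simp [maskPoly]

theorem map_doubleStep_iterate {R R' : Type*} [CommSemiring R] [CommSemiring R'] (f : R →+* R')
    (w : Weights R) (n : ℕ) (s : R × R × R × R) :
    Prod.map f (Prod.map f (Prod.map f f)) ((doubleStep w)^[n] s) =
      (doubleStep (w.map f))^[n] (Prod.map f (Prod.map f (Prod.map f f)) s) := by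
  induction n generalizing s with
  | zero => rfl
  | succ n ih =>
    rw [Function.iterate_succ_apply, ih, Function.iterate_succ_apply]
    simp [doubleStep, Weights.map, map_quad]

/-- `quad` for natural numbers, with reduction modulo `1000003`. -/
def quadMod (a b c n d e : ℕ) : ℕ := (a * (d * d) + n * (b * d + c * n)) * e % 1000003

/-- Is the first coordinate equal to `3` after `k` double steps, modulo `1000003`? -/
def runMod (k a₀₀ a₀₁ a₀₂ a₁₀ a₁₂ a₂₀ a₂₁ a₂₂ : ℕ) : ℕ → ℕ → ℕ → ℕ → Bool :=
  Nat.rec (fun n₀ d₀ _ _ => Nat.beq n₀ (3 * d₀ % 1000003))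
    (fun _ ih n₀ d₀ n₁ d₁ => (fun n₂ d₂ =>
        ih n₂ d₂ (quadMod a₀₀ a₁₀ a₂₀ n₂ d₂ d₁) (quadMod a₀₂ a₁₂ a₂₂ n₂ d₂ n₁))
      (quadMod a₀₀ a₀₁ a₀₂ n₁ d₁ d₀) (quadMod a₂₀ a₂₁ a₂₂ n₁ d₁ n₀)) k

theorem cast_quadMod (a b c n d e : ℕ) :
    ((quadMod a b c n d e : ℕ) : ZMod 1000003) =
      quad (a : ZMod 1000003) (b : ZMod 1000003) (c : ZMod 1000003) (n : ZMod 1000003)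
        (d : ZMod 1000003) * (e : ZMod 1000003) := by
  rw [quadMod, ZMod.natCast_mod, quad]
  push_cast
  ring

theorem runMod_eq_true (k : ℕ) (w : Weights ℕ) (n₀ d₀ n₁ d₁ : ℕ) (hn : n₀ < 1000003)
    (h : ((doubleStep (w.map (Nat.cast : ℕ → ZMod 1000003)))^[k]
        ((n₀ : ZMod 1000003), (d₀ : ZMod 1000003), (n₁ : ZMod 1000003), (d₁ : ZMod 1000003))).1 =
      3 * ((doubleStep (w.map (Nat.cast : ℕ → ZMod 1000003)))^[k]
        ((n₀ : ZMod 1000003), (d₀ : ZMod 1000003), (n₁ : ZMod 1000003), (d₁ : ZMod 1000003))).2.1) :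
    runMod k w.a₀₀ w.a₀₁ w.a₀₂ w.a₁₀ w.a₁₂ w.a₂₀ w.a₂₁ w.a₂₂ n₀ d₀ n₁ d₁ = true := by
  induction k generalizing n₀ d₀ n₁ d₁ with
  | zero =>
    change Nat.beq n₀ (3 * d₀ % 1000003) = true
    rw [Nat.beq_eq]
    have h1 : ((n₀ : ℕ) : ZMod 1000003) = ((3 * d₀ : ℕ) : ZMod 1000003) := by
      push_cast; exact h
    rw [ZMod.natCast_eq_natCast_iff'] at h1
    rwa [Nat.mod_eq_of_lt hn] at h1
  | succ k ih =>
    refine ih _ _ _ _ (Nat.mod_lt _ (by norm_num)) ?_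
    rw [Function.iterate_succ_apply] at h
    convert h using 3 <;> simp [doubleStep, cast_quadMod, Weights.map]

/-- Conjunction over the two truth values. -/
def allBool (f : Bool → Bool) : Bool := f false && f true

/-- Conjunction over the possible numbers of steps with two given coordinates. -/
def allCount (b : Bool) (f : ℕ → Bool) : Bool := cond b (f 1 && (f 2 && f 3)) (f 0)

/-- Conjunction over the masks with a given number of binary digits. -/
def allMask (n : ℕ) (f : ℕ → Bool) : Bool :=
  Nat.rec (f 0) (fun k _ => Nat.rec (f 1 && (f 2 && f 4))
    (fun k _ => Nat.rec (f 3 && (f 5 && f 6)) (fun _ _ => f 7) k) k) n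

theorem of_allBool {f : Bool → Bool} (h : allBool f = true) (b : Bool) : f b = true := by
  simp only [allBool, Bool.and_eq_true] at h
  cases b; exacts [h.1, h.2]

theorem of_allMask_of_allCount {b : Bool} {f : ℕ → Bool} (h : allCount b f = true)
    {m : ℕ} (hm : m < 8) (hb : b = decide (m ≠ 0)) :
    f (maskPoly 1 m) = true ∧ ∀ g, allMask (maskPoly 1 m) g = true → g m = true := by
  have h0 : ∀ g, allMask 0 g = g 0 := fun _ => rfl
  have h1 : ∀ g, allMask 1 g = (g 1 && (g 2 && g 4)) := fun _ => rfl
  have h2 : ∀ g, allMask 2 g = (g 3 && (g 5 && g 6)) := fun _ => rfl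
  have h3 : ∀ g, allMask 3 g = g 7 := fun _ => rfl
  subst hb
  interval_cases m <;> simp_all [allCount, maskPoly]

/-- The value at `z = 11` of a mask. -/
def maskEleven (m : ℕ) : ℕ := m % 2 + m / 2 % 2 * 11 + m / 4 * 121

/-- `a₀ + a₁ y + a₂ y²` is `y` times `b₀ + b₁ y + b₂ y²` up to a factor independent of `y`. -/
def isLinear (a₀ a₁ a₂ b₀ b₁ b₂ : ℕ) : Bool :=
  Nat.beq a₀ 0 && (Nat.beq b₂ 0 && (Nat.beq (maskPoly 10 a₁ * maskPoly 10 b₁)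
    (maskPoly 10 a₂ * maskPoly 10 b₀) && (Nat.beq a₁ 0 == Nat.beq b₀ 0 &&
      (Nat.beq a₂ 0 == Nat.beq b₁ 0))))

/-- `a₀ + a₁ y + a₂ y²` is `y²` times `b₀ + b₁ y + b₂ y²` up to a factor independent of `y`. -/
def isSquare (a₀ a₁ _a₂ _b₀ b₁ b₂ : ℕ) : Bool :=
  Nat.beq a₀ 0 && (Nat.beq a₁ 0 && (Nat.beq b₁ 0 && Nat.beq b₂ 0))

/-- The model is monomial with positive exponents. -/
def isMonomial (P P' Q Q' : (ℕ → ℕ → ℕ → ℕ → ℕ → ℕ → Bool) → Bool) : Bool :=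
  P isLinear && Q isLinear || (P isLinear && Q isSquare || P isSquare && Q isLinear) ||
  (P' isLinear && Q' isLinear || (P' isLinear && Q' isSquare || P' isSquare && Q' isLinear))

/-- Are all masks of a two-dimensional model for which the composition of the reflections has order
`N` monomial? -/
def checkOrder (N : ℕ) (b₀₀ b₀₁ b₀₂ b₁₀ b₁₂ b₂₀ b₂₁ b₂₂ : Bool) : Bool :=
  allCount b₀₀ fun c₀₀ => allCount b₀₁ fun c₀₁ => allCount b₀₂ fun c₀₂ =>
  allCount b₁₀ fun c₁₀ => allCount b₁₂ fun c₁₂ =>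
  allCount b₂₀ fun c₂₀ => allCount b₂₁ fun c₂₁ => allCount b₂₂ fun c₂₂ =>
  cond (runMod N c₀₀ c₀₁ c₀₂ c₁₀ c₁₂ c₂₀ c₂₁ c₂₂ 3 1 5 1)
    (allMask c₀₀ fun m₀₀ => allMask c₀₁ fun m₀₁ => allMask c₀₂ fun m₀₂ =>
      allMask c₁₀ fun m₁₀ => allMask c₁₂ fun m₁₂ =>
      allMask c₂₀ fun m₂₀ => allMask c₂₁ fun m₂₁ => allMask c₂₂ fun m₂₂ =>
      cond (runMod N (maskEleven m₀₀) (maskEleven m₀₁) (maskEleven m₀₂) (maskEleven m₁₀)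
          (maskEleven m₁₂) (maskEleven m₂₀) (maskEleven m₂₁) (maskEleven m₂₂) 3 1 5 1)
        (isMonomial (fun f => f m₀₀ m₀₁ m₀₂ m₂₀ m₂₁ m₂₂) (fun f => f m₂₀ m₂₁ m₂₂ m₀₀ m₀₁ m₀₂)
          (fun f => f m₀₀ m₁₀ m₂₀ m₀₂ m₁₂ m₂₂) (fun f => f m₀₂ m₁₂ m₂₂ m₀₀ m₁₀ m₂₀)) true) true

/-- The pairs of integers, ordered lexicographically. -/
abbrev LexPair : Type := ℤ ×ₗ ℤ

/-- The smallest exponent in the support of a quadratic polynomial. -/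
def lowExp (b₀ b₁ : Bool) : ℤ := cond b₀ 0 (cond b₁ 1 2)

/-- The largest exponent in the support of a quadratic polynomial. -/
def highExp (b₁ b₂ : Bool) : ℤ := cond b₂ 2 (cond b₁ 1 0)

/-- The parameters of a tropical reflection. -/
structure Slopes where
  (A B C D : ℤ)

/-- The piecewise linear function with slopes `A` and `B`. -/
def piecewise {V : Type*} [AddCommGroup V] [LinearOrder V] (A B : ℤ) (u : V) : V :=
  if 0 ≤ u then A • u else B • u

/-- The tropical counterpart of `doubleStep`. -/
def tropStep {V : Type*} [AddCommGroup V] [LinearOrder V] (p : Slopes) (s : V × V) : V × V :=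
  let x := piecewise p.A p.B s.2 - s.1
  (x, piecewise p.C p.D x - s.2)

/-- A set of states whose orbits under `tropStep` are unbounded. -/
def IsGrowing {V : Type*} [AddCommGroup V] [LinearOrder V] (p : Slopes) (s : V × V) : Prop :=
  (p.A = 2 ∧ p.C = 2 ∧ 0 < s.1 ∧ s.1 < s.2) ∨ (p.B = 2 ∧ p.D = 2 ∧ 0 < -s.1 ∧ -s.1 < -s.2) ∨
  (p.B = -2 ∧ p.C = -2 ∧ 0 < s.1 ∧ s.1 < -s.2) ∨ (p.A = -2 ∧ p.D = -2 ∧ 0 < -s.1 ∧ -s.1 < s.2)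

instance {V : Type*} [AddCommGroup V] [LinearOrder V] (p : Slopes) (s : V × V) :
    Decidable (IsGrowing p s) := by
  unfold IsGrowing; infer_instance

/-- The initial state. -/
def tropStart : LexPair × LexPair := (toLex (0, 1), toLex (1, 0))

/-- The order of the tropical map if it is finite, `0` if it is infinite, and `100` if this
is not known. -/
def tropOrder (p : Slopes) (fuel : ℕ) : ℕ → LexPair × LexPair → ℕ :=
  Nat.rec (fun _ _ => 100) (fun _ ih n s =>
    if IsGrowing p s then 0 else if n ≠ 0 ∧ s = tropStart then n else ih (n + 1) (tropStep p s)) fuel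

theorem tropOrder_spec (p : Slopes) (fuel n : ℕ) :
    tropOrder p fuel n ((tropStep p)^[n] tropStart) = 100 ∨
    (∃ m, IsGrowing p ((tropStep p)^[m] tropStart)) ∨
    tropOrder p fuel n ((tropStep p)^[n] tropStart) ≠ 0 ∧
      (tropStep p)^[tropOrder p fuel n ((tropStep p)^[n] tropStart)] tropStart = tropStart := by
  induction fuel generalizing n with
  | zero => exact Or.inl rfl
  | succ k ih =>
    have : tropOrder p (k + 1) n ((tropStep p)^[n] tropStart) =
      if IsGrowing p ((tropStep p)^[n] tropStart) then 0 else
      if n ≠ 0 ∧ ((tropStep p)^[n] tropStart) = tropStart then n else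
      tropOrder p k (n + 1) (tropStep p ((tropStep p)^[n] tropStart)) := rfl
    rw [this]
    split_ifs with h1 h2
    · exact Or.inr (Or.inl ⟨n, h1⟩)
    · exact Or.inr (Or.inr ⟨h2.1, h2.2⟩)
    · rw [← Function.iterate_succ_apply' (tropStep p)]
      exact ih (n + 1)

/-- The slopes of a model with given support. -/
def slopes (b₀₀ b₀₁ b₀₂ b₁₀ b₁₂ b₂₀ b₂₁ b₂₂ : Bool) : Slopes :=
  ⟨lowExp b₀₀ b₀₁ - lowExp b₂₀ b₂₁, highExp b₀₁ b₀₂ - highExp b₂₁ b₂₂,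
    lowExp b₀₀ b₁₀ - lowExp b₀₂ b₁₂, highExp b₁₀ b₂₀ - highExp b₁₂ b₂₂⟩

/-- The classification of supports. -/
def checkSupport (b₀₀ b₀₁ b₀₂ b₁₀ b₁₂ b₂₀ b₂₁ b₂₂ : Bool) : Bool :=
  cond ((b₀₀ || (b₀₁ || b₀₂)) && ((b₂₀ || (b₂₁ || b₂₂)) && ((b₀₀ || (b₁₀ || b₂₀)) &&
      (b₀₂ || (b₁₂ || b₂₂)))))
    ((fun n => cond (Nat.beq n 0 || Nat.beq n 2) true (cond (Nat.beq n 100) false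
      (checkOrder n b₀₀ b₀₁ b₀₂ b₁₀ b₁₂ b₂₀ b₂₁ b₂₂)))
      (tropOrder (slopes b₀₀ b₀₁ b₀₂ b₁₀ b₁₂ b₂₀ b₂₁ b₂₂) 9 0 tropStart)) true

theorem checkSupport_eq_true : (allBool fun b₀₀ => allBool fun b₀₁ => allBool fun b₀₂ =>
    allBool fun b₁₀ => allBool fun b₁₂ => allBool fun b₂₀ => allBool fun b₂₁ => allBool fun b₂₂ =>
    checkSupport b₀₀ b₀₁ b₀₂ b₁₀ b₁₂ b₂₀ b₂₁ b₂₂) = true := by decide +kernel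

/-! ### The tropical dynamics -/

/-- The orbit of a growing state does not return to that state. -/
theorem IsGrowing.iterate_ne {V : Type*} [AddCommGroup V] [LinearOrder V] [IsOrderedAddMonoid V]
    {p : Slopes} {s : V × V} (h : IsGrowing p s) {n : ℕ} (hn : 0 < n) : (tropStep p)^[n] s ≠ s := by
  have key : ∀ s : V × V, IsGrowing p s → IsGrowing p (tropStep p s) ∧
      |s.2| < |(tropStep p s).2| := by
    rintro ⟨x, y⟩ h
    simp only [IsGrowing] at h
    rcases h with ⟨h1, h2, h3, h4⟩ | ⟨h1, h2, h3, h4⟩ | ⟨h1, h2, h3, h4⟩ | ⟨h1, h2, h3, h4⟩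
    · have hy : 0 ≤ y := (h3.trans h4).le
      have e1 : piecewise p.A p.B y - x = y + (y - x) := by
        rw [piecewise, if_pos hy, h1, two_zsmul]; abel
      have hx' : y < y + (y - x) := lt_add_of_pos_right _ (sub_pos.mpr h4)
      have e2 : piecewise p.C p.D (y + (y - x)) - y = (y + (y - x)) + (y - x) := by
        rw [piecewise, if_pos (hy.trans hx'.le), h2, two_zsmul]; abel
      have hy' : y + (y - x) < (y + (y - x)) + (y - x) := lt_add_of_pos_right _ (sub_pos.mpr h4)
      simp only [tropStep, e1, e2, IsGrowing]
      refine ⟨Or.inl ⟨h1, h2, (h3.trans h4).trans hx', hy'⟩, ?_⟩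
      rw [abs_of_nonneg hy, abs_of_pos ((h3.trans h4).trans (hx'.trans hy'))]
      exact hx'.trans hy'
    · have hxy : y < x := neg_lt_neg_iff.mp h4
      have hx : x < 0 := neg_pos.mp h3
      have hy : y < 0 := hxy.trans hx
      have e1 : piecewise p.A p.B y - x = y + (y - x) := by
        rw [piecewise, if_neg hy.not_ge, h1, two_zsmul]; abel
      have hx' : y + (y - x) < y := add_lt_of_neg_right _ (sub_neg.mpr hxy)
      have e2 : piecewise p.C p.D (y + (y - x)) - y = (y + (y - x)) + (y - x) := by
        rw [piecewise, if_neg (hx'.trans hy).not_ge, h2, two_zsmul]; abel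
      have hy' : (y + (y - x)) + (y - x) < y + (y - x) := add_lt_of_neg_right _ (sub_neg.mpr hxy)
      simp only [tropStep, e1, e2, IsGrowing]
      refine ⟨Or.inr (Or.inl ⟨h1, h2, neg_pos.mpr (hx'.trans hy), neg_lt_neg hy'⟩), ?_⟩
      rw [abs_of_neg hy, abs_of_neg ((hy'.trans hx').trans hy)]
      exact neg_lt_neg (hy'.trans hx')
    · have hy : y < 0 := neg_pos.mp (h3.trans h4)
      have e1 : piecewise p.A p.B y - x = -y + (-y - x) := by
        rw [piecewise, if_neg hy.not_ge, h1, neg_zsmul, two_zsmul]; abel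
      have hx' : -y < -y + (-y - x) := lt_add_of_pos_right _ (sub_pos.mpr h4)
      have hx0 : 0 < -y + (-y - x) := (neg_pos.mpr hy).trans hx'
      have e2 : piecewise p.C p.D (-y + (-y - x)) - y = -((-y + (-y - x)) + (-y - x)) := by
        rw [piecewise, if_pos hx0.le, h2, neg_zsmul, two_zsmul]; abel
      have hy' : -y + (-y - x) < (-y + (-y - x)) + (-y - x) :=
        lt_add_of_pos_right _ (sub_pos.mpr h4)
      simp only [tropStep, e1, e2, IsGrowing]
      refine ⟨Or.inr (Or.inr (Or.inl ⟨h1, h2, hx0, by rwa [neg_neg]⟩)), ?_⟩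
      rw [abs_of_neg hy, abs_neg, abs_of_pos (hx0.trans hy')]
      exact hx'.trans hy'
    · have hy : 0 < y := h3.trans h4
      have hd : 0 < y + x := by simpa using sub_pos.mpr h4
      have e1 : piecewise p.A p.B y - x = -(y + (y + x)) := by
        rw [piecewise, if_pos hy.le, h1, neg_zsmul, two_zsmul]; abel
      have hx' : y < y + (y + x) := lt_add_of_pos_right _ hd
      have hx0 : 0 < y + (y + x) := hy.trans hx'
      have e2 : piecewise p.C p.D (-(y + (y + x))) - y = (y + (y + x)) + (y + x) := by
        rw [piecewise, if_neg (neg_neg_of_pos hx0).not_ge, h2, neg_zsmul, two_zsmul]; abel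
      have hy' : y + (y + x) < (y + (y + x)) + (y + x) := lt_add_of_pos_right _ hd
      simp only [tropStep, e1, e2, IsGrowing]
      refine ⟨Or.inr (Or.inr (Or.inr ⟨h1, h2, by rwa [neg_neg], by rwa [neg_neg]⟩)), ?_⟩
      rw [abs_of_pos hy, abs_of_pos (hx0.trans hy')]
      exact hx'.trans hy'
  have hk : ∀ k, IsGrowing p ((tropStep p)^[k] s) ∧ |s.2| ≤ |((tropStep p)^[k] s).2| ∧
      (0 < k → |s.2| < |((tropStep p)^[k] s).2|) := by
    intro k
    induction k with
    | zero => exact ⟨h, le_rfl, fun h => absurd h (lt_irrefl 0)⟩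
    | succ k ih =>
      rw [Function.iterate_succ_apply']
      obtain ⟨h1, h2⟩ := key _ ih.1
      exact ⟨h1, ih.2.1.trans h2.le, fun _ => ih.2.1.trans_lt h2⟩
  intro he
  have := (hk n).2.2 hn
  rw [he] at this
  exact lt_irrefl _ this

/-- The two most significant coordinates of an exponent. -/
def LexExp.topPair : LexExp →+ LexPair where
  toFun e := toLex (expCoord 0 e, expCoord 1 e)
  map_zero' := by simp only [map_zero]; rfl
  map_add' a b := by simp only [map_add]; rfl

theorem LexExp.topPair_monotone : Monotone LexExp.topPair := by
  intro a b h
  rcases h.eq_or_lt with rfl | h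
  · exact le_rfl
  obtain ⟨i, hi, hlt⟩ := h
  refine Prod.Lex.toLex_le_toLex.mpr ?_
  change ofLex a 0 < ofLex b 0 ∨ ofLex a 0 = ofLex b 0 ∧ ofLex a 1 ≤ ofLex b 1
  change ofLex a i < ofLex b i at hlt
  have hi : ∀ j < i, ofLex a j = ofLex b j := hi
  fin_cases i
  · exact Or.inl hlt
  · exact Or.inr ⟨hi 0 (by decide), hlt.le⟩
  · exact Or.inr ⟨hi 0 (by decide), (hi 1 (by decide)).le⟩

/-- The valuation of rank two with values in the two most significant coordinates. -/
def topVal (σ : Equiv.Perm (Fin 3)) (f : K) : LexPair := LexExp.topPair (val σ f)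

theorem topVal_mul {σ : Equiv.Perm (Fin 3)} {f g : K} (hf : f ≠ 0) (hg : g ≠ 0) :
    topVal σ (f * g) = topVal σ f + topVal σ g := by
  rw [topVal, val_mul hf hg, map_add]; rfl

theorem topVal_div {σ : Equiv.Perm (Fin 3)} {f g : K} (hf : f ≠ 0) (hg : g ≠ 0) :
    topVal σ (f / g) = topVal σ f - topVal σ g := by
  rw [topVal, val_div hf hg, map_sub]; rfl

theorem topVal_add {σ : Equiv.Perm (Fin 3)} {f g : K} (hf : SubFree f) (hg : SubFree g) :
    topVal σ (f + g) = min (topVal σ f) (topVal σ g) := by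
  rw [topVal, val_add (hf.posLead σ) (hg.posLead σ), LexExp.topPair_monotone.map_min]; rfl

theorem topVal_eq_zero {σ : Equiv.Perm (Fin 3)} {c d : Fin 3} (hc : σ c = 1) (hd : σ d = 0) {f : K}
    (hf : f ≠ 0) (h1 : f ∈ Free c) (h2 : f ∈ Free d) : topVal σ f = 0 := by
  have h0 : (expand σ f).coeff (val σ f) ≠ 0 := coeff_order_eq_zero.not.mpr (expand_ne_zero σ hf)
  have e1 : expCoord 1 (val σ f) = 0 := by
    by_contra h
    rw [← hc] at h
    exact h0 (expand_coeff_eq_zero_of_mem_free σ h1 h)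
  have e2 : expCoord 0 (val σ f) = 0 := by
    by_contra h
    rw [← hd] at h
    exact h0 (expand_coeff_eq_zero_of_mem_free σ h2 h)
  change toLex (expCoord 0 (val σ f), expCoord 1 (val σ f)) = 0
  rw [e1, e2]; rfl

theorem SubFree.natCast {n : ℕ} (h : n ≠ 0) : SubFree (n : K) := by
  induction n with
  | zero => exact absurd rfl h
  | succ n ih =>
    rcases eq_or_ne n 0 with rfl | hn
    · simpa using SubFree.one
    · rw [Nat.cast_succ]; exact (ih hn).add .one

/-- Weights which are either zero or subtraction-free of valuation zero. -/
def IsWeight (σ : Equiv.Perm (Fin 3)) (b : Bool) (a : K) : Prop :=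
  cond b (SubFree a ∧ topVal σ a = 0) (a = 0)

theorem topVal_quad {σ : Equiv.Perm (Fin 3)} {a b c u : K} {β₀ β₁ β₂ : Bool}
    (ha : IsWeight σ β₀ a) (hb : IsWeight σ β₁ b) (hc : IsWeight σ β₂ c)
    (hβ : (β₀ || (β₁ || β₂)) = true) (hu : SubFree u) :
    SubFree (quad a b c u 1) ∧
      topVal σ (quad a b c u 1) = piecewise (lowExp β₀ β₁) (highExp β₁ β₂) (topVal σ u) := by
  have hu0 := hu.ne_zero
  have hq : quad a b c u 1 = a + (u * b + u * u * c) := by rw [quad]; ring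
  rw [hq]
  have hpair : 0 ≤ topVal σ u ∨ topVal σ u < 0 := le_or_gt _ _
  have huu : topVal σ (u * u) = topVal σ u + topVal σ u := topVal_mul hu0 hu0
  cases β₀ <;> cases β₁ <;> cases β₂ <;> simp only [IsWeight, cond_true, cond_false] at ha hb hc <;>
    try simp at hβ
  all_goals
    try rw [ha]
    try rw [hb]
    try rw [hc]
    try have ha0 := ha.1.ne_zero
    try have hb0 := hb.1.ne_zero
    try have hc0 := hc.1.ne_zero
    try have hub := topVal_mul (σ := σ) hu0 hb0
    try have huc := topVal_mul (σ := σ) (mul_ne_zero hu0 hu0) hc0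
    try have sb := hu.mul hb.1
    try have sc := (hu.mul hu).mul hc.1
    try have sa := ha.1
    try rw [hb.2, add_zero] at hub
    try rw [hc.2, add_zero, huu] at huc
    try simp only [mul_zero, add_zero, zero_add]
  · exact ⟨sc, by simp [huc, piecewise, lowExp, highExp, two_mul]⟩
  · exact ⟨sb, by simp [hub, piecewise, lowExp, highExp]⟩
  · refine ⟨sb.add sc, ?_⟩
    rw [topVal_add sb sc, hub, huc]
    rcases hpair with h | h
    · simp [piecewise, lowExp, h]
    · simp [piecewise, highExp, h.not_ge, two_mul, h.le]
  · exact ⟨sa, by simp [ha.2, piecewise, lowExp, highExp]⟩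
  · refine ⟨sa.add sc, ?_⟩
    rw [topVal_add sa sc, ha.2, huc]
    rcases hpair with h | h
    · simp [piecewise, lowExp, h, add_nonneg h h]
    · simp [piecewise, highExp, h.not_ge, two_mul, (add_neg h h).le]
  · refine ⟨sa.add sb, ?_⟩
    rw [topVal_add sa sb, ha.2, hub]
    rcases hpair with h | h
    · simp [piecewise, lowExp, h]
    · simp [piecewise, highExp, h.not_ge, h.le]
  · refine ⟨sa.add (sb.add sc), ?_⟩
    rw [topVal_add sa (sb.add sc), topVal_add sb sc, ha.2, hub, huc]
    rcases hpair with h | h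
    · simp [piecewise, lowExp, h]
    · simp [piecewise, highExp, h.not_ge, h.le, (add_neg h h).le, two_mul]

theorem SubFree.maskPoly {z : K} (hz : SubFree z) {m : ℕ} (hm : m < 8) (h0 : m ≠ 0) :
    SubFree (maskPoly z m) := by
  have h1 := SubFree.one
  have h2 := hz.mul hz
  have h3 := h1.add hz
  interval_cases m <;> simp_all [_root_.maskPoly, SubFree.add]

theorem maskPoly_zero {R : Type*} [CommSemiring R] (z : R) : maskPoly z 0 = 0 := by simp [maskPoly]

theorem maskPoly_mem {L : IntermediateField ℚ K} {z : K} (hz : z ∈ L) (m : ℕ) :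
    maskPoly z m ∈ L :=
  add_mem (add_mem (natCast_mem _ _) (mul_mem (natCast_mem _ _) hz))
    (mul_mem (natCast_mem _ _) (mul_mem hz hz))

theorem isWeight_maskPoly {σ : Equiv.Perm (Fin 3)} {c d l : Fin 3} (h2 : c ≠ l) (h3 : d ≠ l)
    (hc : σ c = 1) (hd : σ d = 0) {m : ℕ} (hm : m < 8) :
    IsWeight σ (decide (m ≠ 0)) (maskPoly (Xv l) m) := by
  rcases eq_or_ne m 0 with rfl | h0
  · simp [IsWeight, maskPoly_zero]
  · have hs := (SubFree.X l).maskPoly hm h0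
    rw [decide_eq_true h0]
    exact ⟨hs, topVal_eq_zero hc hd hs.ne_zero (maskPoly_mem (Xv_mem_free h2.symm) m)
      (maskPoly_mem (Xv_mem_free h3.symm) m)⟩

/-- The first coordinate of the orbit of a pair of fractions. -/
theorem iterate_doubleStep_eq {W : Weights K} {x y : K} {A B : ℕ → K}
    (hA0 : A 0 = x) (hB0 : B 0 = y) (hAne : ∀ n, A n ≠ 0) (hBne : ∀ n, B n ≠ 0)
    (hA : ∀ n, A (n + 1) = quad W.a₀₀ W.a₀₁ W.a₀₂ (B n) 1 / quad W.a₂₀ W.a₂₁ W.a₂₂ (B n) 1 / A n)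
    (hB : ∀ n, B (n + 1) = quad W.a₀₀ W.a₁₀ W.a₂₀ (A (n + 1)) 1 /
      quad W.a₀₂ W.a₁₂ W.a₂₂ (A (n + 1)) 1 / B n) (n : ℕ) :
    ∃ d e, d ≠ 0 ∧ e ≠ 0 ∧
      (doubleStep W)^[n] (x, 1, y, 1) = (A n * d, d, B n * e, e) := by
  induction n with
  | zero => exact ⟨1, 1, one_ne_zero, one_ne_zero, by simp [hA0, hB0]⟩
  | succ n ih =>
    obtain ⟨d, e, hd, he, h⟩ := ih
    have hAn := hAne n
    have hBn := hBne n
    have hA1 := hAne (n + 1)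
    have hB1 := hBne (n + 1)
    have hom : ∀ a b c u v : K, quad a b c (u * v) v = v * v * quad a b c u 1 := by
      intro a b c u v; rw [quad, quad]; ring
    have q1 : quad W.a₀₀ W.a₀₁ W.a₀₂ (B n) 1 ≠ 0 := fun h0 => hA1 (by rw [hA, h0]; simp)
    have q2 : quad W.a₂₀ W.a₂₁ W.a₂₂ (B n) 1 ≠ 0 := fun h0 => hA1 (by rw [hA, h0]; simp)
    have q3 : quad W.a₀₀ W.a₁₀ W.a₂₀ (A (n + 1)) 1 ≠ 0 := fun h0 => hB1 (by rw [hB, h0]; simp)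
    have q4 : quad W.a₀₂ W.a₁₂ W.a₂₂ (A (n + 1)) 1 ≠ 0 := fun h0 => hB1 (by rw [hB, h0]; simp)
    rw [Function.iterate_succ_apply', h]
    have e1 : quad W.a₀₀ W.a₀₁ W.a₀₂ (B n * e) e * d =
        A (n + 1) * (quad W.a₂₀ W.a₂₁ W.a₂₂ (B n * e) e * (A n * d)) := by
      rw [hom, hom, hA]; field_simp
    set D := quad W.a₂₀ W.a₂₁ W.a₂₂ (B n * e) e * (A n * d) with hD
    have hD0 : D ≠ 0 := by
      rw [hD, hom]
      exact mul_ne_zero (mul_ne_zero (mul_ne_zero he he) q2) (mul_ne_zero hAn hd)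
    have e2 : quad W.a₀₀ W.a₁₀ W.a₂₀ (A (n + 1) * D) D * e =
        B (n + 1) * (quad W.a₀₂ W.a₁₂ W.a₂₂ (A (n + 1) * D) D * (B n * e)) := by
      rw [hom, hom, hB]; field_simp
    refine ⟨D, quad W.a₀₂ W.a₁₂ W.a₂₂ (A (n + 1) * D) D * (B n * e), hD0, ?_, ?_⟩
    · rw [hom]
      exact mul_ne_zero (mul_ne_zero (mul_ne_zero hD0 hD0) q4) (mul_ne_zero hBn he)
    · simp only [doubleStep]
      rw [← hD, e1, e2]

/-- An identity between orbits of fractions over `ℚ(x,y,z)` can be tested modulo a prime. -/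
theorem runMod_of_iterate_eq {c d l : Fin 3} (h1 : c ≠ d) (h2 : c ≠ l) (h3 : d ≠ l) (m : Weights ℕ)
    (N z₀ : ℕ) (h : ((doubleStep (m.map (maskPoly (Xv l))))^[N] (Xv c, 1, Xv d, 1)).1 =
      Xv c * ((doubleStep (m.map (maskPoly (Xv l))))^[N] (Xv c, 1, Xv d, 1)).2.1) :
    runMod N (maskPoly z₀ m.a₀₀) (maskPoly z₀ m.a₀₁) (maskPoly z₀ m.a₀₂) (maskPoly z₀ m.a₁₀)
      (maskPoly z₀ m.a₁₂) (maskPoly z₀ m.a₂₀) (maskPoly z₀ m.a₂₁) (maskPoly z₀ m.a₂₂)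
      3 1 5 1 = true := by
  let P := MvPolynomial (Fin 3) ℤ
  let f : P →+* K := (algebraMap (MvPolynomial (Fin 3) ℚ) K).comp
    (MvPolynomial.map (Int.castRingHom ℚ))
  have hf : Function.Injective f :=
    (IsFractionRing.injective (MvPolynomial (Fin 3) ℚ) K).comp
      (MvPolynomial.map_injective _ Int.cast_injective)
  have hfX : ∀ i, f (MvPolynomial.X i) = Xv i := by
    intro i
    change algebraMap _ K (MvPolynomial.map (Int.castRingHom ℚ) (MvPolynomial.X i)) = _
    rw [MvPolynomial.map_X]; rfl
  let pt : Fin 3 → ZMod 1000003 := fun i => if i = c then 3 else if i = d then 5 else z₀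
  let e : P →+* ZMod 1000003 := MvPolynomial.eval₂Hom (Int.castRingHom _) pt
  have heX : ∀ i, e (MvPolynomial.X i) = pt i := fun i => MvPolynomial.eval₂Hom_X' _ _ _
  have hmap : ∀ {R R' : Type} [CommSemiring R] [CommSemiring R'] (g : R →+* R') (z : R),
      (m.map (maskPoly z)).map g = m.map (maskPoly (g z)) := by
    intro R R' _ _ g z
    simp [Weights.map, map_maskPoly]
  let s : P × P × P × P := (doubleStep (m.map (maskPoly (MvPolynomial.X l))))^[N]
    (MvPolynomial.X c, 1, MvPolynomial.X d, 1)
  have hs : s.1 = MvPolynomial.X c * s.2.1 := by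
    apply hf
    have := map_doubleStep_iterate f (m.map (maskPoly (MvPolynomial.X l))) N
      (MvPolynomial.X c, 1, MvPolynomial.X d, 1)
    rw [hmap, hfX] at this
    simp only [Prod.map, map_one, hfX] at this
    rw [← this] at h
    rw [map_mul, hfX]
    exact h
  have h4 := map_doubleStep_iterate e (m.map (maskPoly (MvPolynomial.X l))) N
      (MvPolynomial.X c, 1, MvPolynomial.X d, 1)
  have hz : pt l = ((z₀ : ℕ) : ZMod 1000003) := by simp [pt, h2.symm, h3.symm]
  have hw : (m.map (maskPoly z₀)).map (Nat.cast : ℕ → ZMod 1000003) =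
      m.map (maskPoly (z₀ : ZMod 1000003)) := hmap (Nat.castRingHom (ZMod 1000003)) z₀
  refine runMod_eq_true N (m.map (maskPoly z₀)) 3 1 5 1 (by norm_num) ?_
  rw [hw]
  rw [hmap, heX, hz] at h4
  simp only [Prod.map, map_one, heX] at h4
  have hc : pt c = 3 := by simp [pt]
  have hd : pt d = 5 := by simp [pt, h1.symm]
  rw [hc, hd] at h4
  have h5 := congrArg e hs
  rw [map_mul, heX, hc] at h5
  simp only [Nat.cast_ofNat, Nat.cast_one]
  rw [← h4]
  exact h5

theorem exists_perm {c d l : Fin 3} (h1 : c ≠ d) (h2 : c ≠ l) (h3 : d ≠ l) :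
    ∃ σ : Equiv.Perm (Fin 3), σ c = 1 ∧ σ d = 0 ∧ σ l = 2 := by
  revert c d l; decide

/-- An automorphism of finite order which fixes the least significant variable and the two most
significant coordinates of the valuations of the other two variables is the identity. -/
theorem eq_one_of_topVal_eq {σ : Equiv.Perm (Fin 3)} {c d l : Fin 3} (hl : σ l = 2)
    (hcdl : ∀ i, i = c ∨ i = d ∨ i = l) {g : K ≃ₐ[ℚ] K} {n : ℕ} (hn : 0 < n) (hgn : g ^ n = 1)
    (hgl : g (Xv l) = Xv l) (hpos : ∀ i, PosLead σ (g (Xv i)))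
    (hc : topVal σ (g (Xv c)) = topVal σ (Xv c)) (hd : topVal σ (g (Xv d)) = topVal σ (Xv d)) :
    g = 1 := by
  let w : Fin 3 → ℤ := fun i => expCoord 2 (val σ (g (Xv i)) - val σ (Xv i))
  let M : LexExp →+ LexExp :=
    { toFun e := e + (∑ i, expCoord (σ i) e * w i) • expBasis 2
      map_zero' := by simp
      map_add' a b := by
        simp only [map_add, add_mul, Finset.sum_add_distrib, add_smul]; abel }
  have hcoord : ∀ e : LexExp, ∀ j ≠ 2, expCoord j (M e) = expCoord j e := by
    intro e j hj
    change expCoord j (e + (∑ i, expCoord (σ i) e * w i) • expBasis 2) = _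
    rw [map_add, map_zsmul, expCoord_expBasis, if_neg hj, smul_zero, add_zero]
  have hwl : w l = 0 := by simp [w, hgl]
  have hlt : ∀ e e' : LexExp, (∀ j ≠ 2, expCoord j e = expCoord j e') → M e' - M e = e' - e := by
    intro e e' h
    have : ∀ i, expCoord (σ i) e * w i = expCoord (σ i) e' * w i := by
      intro i
      rcases eq_or_ne (σ i) 2 with h2 | h2
      · rw [σ.injective (h2.trans hl.symm), hwl]; simp
      · rw [h _ h2]
    change e' + (∑ i, expCoord (σ i) e' * w i) • expBasis 2 -
      (e + (∑ i, expCoord (σ i) e * w i) • expBasis 2) = _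
    rw [Finset.sum_congr rfl fun i _ => this i]
    abel
  have hM : StrictMono M := by
    intro e e' h
    obtain ⟨i, hi, hlt'⟩ := id h
    by_cases hi2 : i = 2
    · have := hlt e e' fun j hj => hi j (by subst hi2; revert hj; revert j; decide)
      rw [← sub_pos, this]
      exact sub_pos.mpr h
    · refine ⟨i, fun j hj => ?_, ?_⟩
      · have hj2 : j ≠ 2 := by
          rintro rfl
          revert hj; revert hi2; clear hi hlt'; revert i; decide
        exact (hcoord e j hj2).trans ((hi j hj).trans (hcoord e' j hj2).symm)
      · have h1 := hcoord e i hi2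
        have h2 := hcoord e' i hi2
        change expCoord i (M e) < expCoord i (M e')
        rw [h1, h2]
        exact hlt'
  have htop : ∀ i, topVal σ (g (Xv i)) = topVal σ (Xv i) := by
    intro i
    rcases hcdl i with rfl | rfl | rfl
    exacts [hc, hd, by rw [hgl]]
  refine eq_one_of_pow_eq_one σ g hn hgn M hM
    (fun i => (expand σ (g (Xv i))).leadingCoeff) (fun i => ?_) hpos
  convert (hpos i).lead using 1
  have hMi : M (expBasis (σ i)) = expBasis (σ i) + w i • expBasis 2 := by
    change expBasis (σ i) + (∑ k, expCoord (σ k) (expBasis (σ i)) * w k) • expBasis 2 = _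
    rw [Finset.sum_eq_single i]
    · rw [expCoord_expBasis, if_pos rfl, one_mul]
    · intro k _ hk
      rw [expCoord_expBasis, if_neg fun h => hk (σ.injective h), zero_mul]
    · simp
  rw [hMi]
  refine LexExp.ext fun j => ?_
  rw [map_add, map_zsmul, expCoord_expBasis 2 j]
  by_cases hj : j = 2
  · subst hj
    rw [if_pos rfl, smul_eq_mul, mul_one]
    change _ + expCoord 2 (val σ (g (Xv i)) - val σ (Xv i)) = _
    rw [map_sub, val_Xv]
    exact add_sub_cancel _ _
  · rw [if_neg hj, smul_zero, add_zero, ← val_Xv (σ := σ) i]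
    have h1 := htop i
    have h2 : (expCoord 0 (val σ (g (Xv i))), expCoord 1 (val σ (g (Xv i)))) =
      (expCoord 0 (val σ (Xv i)), expCoord 1 (val σ (Xv i))) := toLex.injective h1
    rw [Prod.mk.injEq] at h2
    have : j = 0 ∨ j = 1 := by revert hj; revert j; decide
    rcases this with rfl | rfl
    exacts [h2.1.symm, h2.2.symm]

theorem topVal_Xv (σ : Equiv.Perm (Fin 3)) (i : Fin 3) :
    topVal σ (Xv i) = toLex ((if 0 = σ i then 1 else 0 : ℤ), (if 1 = σ i then 1 else 0 : ℤ)) := by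
  change toLex (expCoord 0 (val σ (Xv i)), expCoord 1 (val σ (Xv i))) = _
  rw [val_Xv, expCoord_expBasis, expCoord_expBasis]

theorem piecewise_sub {V : Type*} [AddCommGroup V] [LinearOrder V] (A B A' B' : ℤ) (u : V) :
    piecewise A B u - piecewise A' B' u = piecewise (A - A') (B - B') u := by
  simp only [piecewise]
  split_ifs <;> rw [sub_zsmul, sub_eq_add_neg]

theorem ReflSystem.pd_map {φ : Fin 3 → K ≃ₐ[ℚ] K} {R : Fin 3 → K} (H : ReflSystem φ R) {k i : Fin 3}
    (hik : i ≠ k) (f : K) :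
    pd i (φ k f) = φ k (pd i f) + φ k (pd k f) * (pd i (R k) / Xv k) := by
  have h1 : pd i (φ k f) = _ := pd_comp (φ k : K →+* K) i f
  have h2 : pd i (φ k (Xv k)) = pd i (R k) / Xv k := by
    rw [H.self, div_eq_mul_inv, (isDer_pd i).mul, (isDer_pd i).inv, pd_Xv, if_neg hik.symm,
      div_eq_mul_inv]
    simp [mul_comm]
  rw [h1, ← Finset.add_sum_erase _ _ (Finset.mem_univ k)]
  have h3 : ∑ x ∈ Finset.univ.erase k, (φ k : K →+* K) (pd x f) * pd i ((φ k : K →+* K) (Xv x)) =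
      φ k (pd i f) := by
    rw [Finset.sum_eq_single i]
    · change φ k (pd i f) * pd i (φ k (Xv i)) = _
      rw [H.other k i hik, pd_Xv, if_pos rfl, mul_one]
    · intro j hj hji
      change φ k (pd j f) * pd i (φ k (Xv j)) = _
      rw [H.other k j (Finset.ne_of_mem_erase hj), pd_Xv, if_neg hji, mul_zero]
    · intro h; exact absurd (Finset.mem_erase.mpr ⟨hik, Finset.mem_univ i⟩) h
  rw [h3]
  change φ k (pd k f) * pd i (φ k (Xv k)) + _ = _
  rw [h2, add_comm]

theorem maskEleven_eq (m : ℕ) : maskEleven m = maskPoly 11 m := by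
  simp [maskEleven, maskPoly]

/-- The masks of a mutually dependent pair of reflections with product of finite order. -/
theorem ReflSystem.isMonomial_of_pow_eq_one {φ : Fin 3 → K ≃ₐ[ℚ] K} {R : Fin 3 → K}
    (H : ReflSystem φ R) {c d l : Fin 3} (h1 : c ≠ d) (h2 : c ≠ l) (h3 : d ≠ l) (m : Weights ℕ)
    (l₀₀ : m.a₀₀ < 8) (l₀₁ : m.a₀₁ < 8) (l₀₂ : m.a₀₂ < 8) (l₁₀ : m.a₁₀ < 8) (l₁₂ : m.a₁₂ < 8)
    (l₂₀ : m.a₂₀ < 8) (l₂₁ : m.a₂₁ < 8) (l₂₂ : m.a₂₂ < 8)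
    (hRc : R c = quad (maskPoly (Xv l) m.a₀₀) (maskPoly (Xv l) m.a₀₁) (maskPoly (Xv l) m.a₀₂)
      (Xv d) 1 / quad (maskPoly (Xv l) m.a₂₀) (maskPoly (Xv l) m.a₂₁) (maskPoly (Xv l) m.a₂₂)
      (Xv d) 1)
    (hRd : R d = quad (maskPoly (Xv l) m.a₀₀) (maskPoly (Xv l) m.a₁₀) (maskPoly (Xv l) m.a₂₀)
      (Xv c) 1 / quad (maskPoly (Xv l) m.a₀₂) (maskPoly (Xv l) m.a₁₂) (maskPoly (Xv l) m.a₂₂)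
      (Xv c) 1)
    {n : ℕ} (hn : 0 < n) (hfin : (φ c * φ d) ^ n = 1) (hcd : R c ∉ Free d) (hdc : R d ∉ Free c) :
    isMonomial (fun f => f m.a₀₀ m.a₀₁ m.a₀₂ m.a₂₀ m.a₂₁ m.a₂₂)
      (fun f => f m.a₂₀ m.a₂₁ m.a₂₂ m.a₀₀ m.a₀₁ m.a₀₂)
      (fun f => f m.a₀₀ m.a₁₀ m.a₂₀ m.a₀₂ m.a₁₂ m.a₂₂)
      (fun f => f m.a₀₂ m.a₁₂ m.a₂₂ m.a₀₀ m.a₁₀ m.a₂₀) = true := by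
  obtain ⟨σ, hσc, hσd, hσl⟩ := exists_perm h1 h2 h3
  set g := φ c * φ d with hg
  have hgl : ∀ k, (g ^ k) (Xv l) = Xv l := by
    intro k
    induction k with
    | zero => rfl
    | succ k ih => rw [pow_succ', AlgEquiv.mul_apply, ih, hg, AlgEquiv.mul_apply,
        H.other d l h3.symm, H.other c l h2.symm]
  have hgm : ∀ k m, (g ^ k) (maskPoly (Xv l) m) = maskPoly (Xv l) m := by
    intro k m
    have := map_maskPoly ((g ^ k : K ≃ₐ[ℚ] K) : K →+* K) (Xv l) m
    exact this.trans (by congr 1; exact hgl k)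
  have hgq : ∀ k a b e u, (g ^ k) (quad (maskPoly (Xv l) a) (maskPoly (Xv l) b)
      (maskPoly (Xv l) e) u 1) = quad (maskPoly (Xv l) a) (maskPoly (Xv l) b)
      (maskPoly (Xv l) e) ((g ^ k) u) 1 := by
    intro k a b e u
    have := map_quad ((g ^ k : K ≃ₐ[ℚ] K) : K →+* K) (maskPoly (Xv l) a) (maskPoly (Xv l) b)
      (maskPoly (Xv l) e) u 1
    refine this.trans ?_
    change quad ((g ^ k) _) ((g ^ k) _) ((g ^ k) _) ((g ^ k) _) ((g ^ k) 1) = _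
    rw [hgm, hgm, hgm, map_one]
  let A : ℕ → K := fun k => (g ^ k) (Xv c)
  let B : ℕ → K := fun k => (g ^ k) (Xv d)
  have hSF : ∀ k f, SubFree f → SubFree ((g ^ k) f) := by
    intro k
    induction k with
    | zero => exact fun f hf => hf
    | succ k ih =>
      intro f hf
      rw [pow_succ, AlgEquiv.mul_apply]
      exact ih _ (H.subFree_map c (H.subFree_map d hf))
  have hAS : ∀ k, SubFree (A k) := fun k => hSF k _ (.X c)
  have hBS : ∀ k, SubFree (B k) := fun k => hSF k _ (.X d)
  have hA : ∀ k, A (k + 1) = quad (maskPoly (Xv l) m.a₀₀) (maskPoly (Xv l) m.a₀₁)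
      (maskPoly (Xv l) m.a₀₂) (B k) 1 / quad (maskPoly (Xv l) m.a₂₀) (maskPoly (Xv l) m.a₂₁)
      (maskPoly (Xv l) m.a₂₂) (B k) 1 / A k := by
    intro k
    change (g ^ (k + 1)) (Xv c) = _
    rw [pow_succ, AlgEquiv.mul_apply, hg, AlgEquiv.mul_apply, H.other d c h1, H.self, hRc,
      ← hg, map_div₀, map_div₀, hgq, hgq]
  have hB : ∀ k, B (k + 1) = quad (maskPoly (Xv l) m.a₀₀) (maskPoly (Xv l) m.a₁₀)
      (maskPoly (Xv l) m.a₂₀) (A (k + 1)) 1 / quad (maskPoly (Xv l) m.a₀₂) (maskPoly (Xv l) m.a₁₂)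
      (maskPoly (Xv l) m.a₂₂) (A (k + 1)) 1 / B k := by
    intro k
    have hgd : g (Xv d) = φ c (R d) / Xv d := by
      rw [hg, AlgEquiv.mul_apply, H.self, map_div₀, H.other c d h1.symm]
    have hgR : φ c (R d) = g (R d) := by
      rw [hg, AlgEquiv.mul_apply, H.map_free (H.free d)]
    change (g ^ (k + 1)) (Xv d) = _
    rw [pow_succ, AlgEquiv.mul_apply, hgd, hgR, map_div₀, ← AlgEquiv.mul_apply, ← pow_succ, hRd,
      map_div₀, hgq, hgq]
  have hq0 := H.ne_zero c
  have hr0 := H.ne_zero d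
  rw [hRc, div_ne_zero_iff] at hq0
  rw [hRd, div_ne_zero_iff] at hr0
  have hquad0 : ∀ {a b e : ℕ} {u : K}, quad (maskPoly (Xv l) a) (maskPoly (Xv l) b)
      (maskPoly (Xv l) e) u 1 ≠ 0 →
      (decide (a ≠ 0) || (decide (b ≠ 0) || decide (e ≠ 0))) = true := by
    intro a b e u h
    by_contra hc
    simp only [Bool.or_eq_true, decide_eq_true_eq, not_or, not_not] at hc
    obtain ⟨rfl, rfl, rfl⟩ := hc
    exact h (by simp [quad, maskPoly_zero])
  have hw : ∀ {k : ℕ}, k < 8 → IsWeight σ (decide (k ≠ 0)) (maskPoly (Xv l) k) :=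
    fun hk => isWeight_maskPoly h2 h3 hσc hσd hk
  let p := slopes (decide (m.a₀₀ ≠ 0)) (decide (m.a₀₁ ≠ 0)) (decide (m.a₀₂ ≠ 0))
    (decide (m.a₁₀ ≠ 0)) (decide (m.a₁₂ ≠ 0)) (decide (m.a₂₀ ≠ 0)) (decide (m.a₂₁ ≠ 0))
    (decide (m.a₂₂ ≠ 0))
  have htrop : ∀ k, (tropStep p)^[k] tropStart = (topVal σ (A k), topVal σ (B k)) := by
    intro k
    induction k with
    | zero =>
      change tropStart = (topVal σ (Xv c), topVal σ (Xv d))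
      rw [topVal_Xv, topVal_Xv, hσc, hσd]; rfl
    | succ k ih =>
      rw [Function.iterate_succ_apply', ih]
      have e1 := topVal_quad (hw l₀₀) (hw l₀₁) (hw l₀₂) (hquad0 hq0.1) (hBS k)
      have e2 := topVal_quad (hw l₂₀) (hw l₂₁) (hw l₂₂) (hquad0 hq0.2) (hBS k)
      have e3 := topVal_quad (hw l₀₀) (hw l₁₀) (hw l₂₀) (hquad0 hr0.1) (hAS (k + 1))
      have e4 := topVal_quad (hw l₀₂) (hw l₁₂) (hw l₂₂) (hquad0 hr0.2) (hAS (k + 1))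
      have f1 : topVal σ (A (k + 1)) = piecewise p.A p.B (topVal σ (B k)) - topVal σ (A k) := by
        rw [hA, topVal_div (e1.1.div e2.1).ne_zero (hAS k).ne_zero,
          topVal_div e1.1.ne_zero e2.1.ne_zero, e1.2, e2.2, piecewise_sub]
        rfl
      have f2 : topVal σ (B (k + 1)) =
          piecewise p.C p.D (topVal σ (A (k + 1))) - topVal σ (B k) := by
        rw [hB, topVal_div (e3.1.div e4.1).ne_zero (hBS k).ne_zero,
          topVal_div e3.1.ne_zero e4.1.ne_zero, e3.2, e4.2, piecewise_sub]
        rfl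
      simp only [tropStep]
      rw [f2, f1]
  have hper : (tropStep p)^[n] tropStart = tropStart := by
    rw [htrop]
    change (topVal σ ((g ^ n) (Xv c)), topVal σ ((g ^ n) (Xv d))) = _
    rw [hfin]
    exact (htrop 0).symm
  have hcs := of_allBool (of_allBool (of_allBool (of_allBool (of_allBool (of_allBool (of_allBool
    (of_allBool checkSupport_eq_true (decide (m.a₀₀ ≠ 0))) (decide (m.a₀₁ ≠ 0)))
    (decide (m.a₀₂ ≠ 0))) (decide (m.a₁₀ ≠ 0))) (decide (m.a₁₂ ≠ 0))) (decide (m.a₂₀ ≠ 0)))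
    (decide (m.a₂₁ ≠ 0))) (decide (m.a₂₂ ≠ 0))
  rw [checkSupport, hquad0 hq0.1, hquad0 hq0.2, hquad0 hr0.1, hquad0 hr0.2] at hcs
  simp only [Bool.and_self, cond_true] at hcs
  change (fun n => cond (Nat.beq n 0 || Nat.beq n 2) true (cond (Nat.beq n 100) false
      (checkOrder n _ _ _ _ _ _ _ _))) (tropOrder p 9 0 tropStart) = true at hcs
  have hspec := tropOrder_spec p 9 0
  rw [Function.iterate_zero, id] at hspec
  generalize hN : tropOrder p 9 0 tropStart = N at hcs hspec
  rcases hspec with rfl | ⟨k, hk⟩ | ⟨hN0, hret⟩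
  · simp at hcs
  · exfalso
    refine hk.iterate_ne hn ?_
    rw [← Function.iterate_add_apply, add_comm, Function.iterate_add_apply, hper]
  have hgN : g ^ N = 1 := by
    have h0 : (topVal σ (A N), topVal σ (B N)) = (topVal σ (Xv c), topVal σ (Xv d)) :=
      (htrop N).symm.trans (hret.trans (htrop 0))
    refine eq_one_of_topVal_eq hσl (n := n) (eq_or_of_distinct h1 h2 h3) hn ?_ (hgl N)
      (fun i => (hSF N _ (.X i)).posLead σ) (congrArg Prod.fst h0) (congrArg Prod.snd h0)
    rw [← pow_mul, mul_comm, pow_mul, hfin, one_pow]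
  rcases eq_or_ne N 2 with rfl | hN2
  · exfalso
    have hcomm : φ c * φ d = φ d * φ c := by
      have e1 : φ c * φ d * (φ c * φ d) = 1 := by rw [← pow_two]; exact hgN
      have e2 := mul_eq_one_iff_eq_inv.mp e1
      rw [e2, mul_inv_rev, H.inv_eq, H.inv_eq]
    have hfix : φ d (R c) = R c := by
      have := DFunLike.congr_fun hcomm (Xv c)
      rw [AlgEquiv.mul_apply, AlgEquiv.mul_apply, H.other d c h1, H.self, map_div₀,
        H.other d c h1] at this
      exact ((div_left_inj' (Xv_ne_zero c)).mp this).symm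
    have h4 := H.pd_map h1 (R c)
    rw [hfix, pd_eq_zero_of_mem_free (H.free c), map_zero, zero_add] at h4
    rcases mul_eq_zero.mp h4.symm with h | h
    · exact hcd (H.indep c d (by simpa using h))
    · exact hdc (H.indep d c ((div_eq_zero_iff.mp h).resolve_right (Xv_ne_zero d)))
  have e0 : Nat.beq N 0 = false := Bool.eq_false_iff.mpr fun h => hN0 (Nat.eq_of_beq_eq_true h)
  have e2 : Nat.beq N 2 = false := Bool.eq_false_iff.mpr fun h => hN2 (Nat.eq_of_beq_eq_true h)
  simp only [e0, e2, Bool.or_self, cond_false] at hcs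
  cases e100 : Nat.beq N 100 with
  | true => simp [e100] at hcs
  | false =>
  rw [e100, cond_false] at hcs
  have horb := iterate_doubleStep_eq (W := m.map (maskPoly (Xv l))) (A := A) (B := B) rfl rfl
    (fun k => (hAS k).ne_zero) (fun k => (hBS k).ne_zero) hA hB N
  have hrun : ∀ z₀, _ := fun z₀ => runMod_of_iterate_eq h1 h2 h3 m N z₀ (by
    obtain ⟨d', e', _, _, h⟩ := horb
    have : A N = Xv c := by change (g ^ N) (Xv c) = _; rw [hgN]; rfl
    change (((doubleStep (m.map (maskPoly (Xv l))))^[N] (A 0, 1, B 0, 1))).1 =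
      Xv c * ((doubleStep (m.map (maskPoly (Xv l))))^[N] (A 0, 1, B 0, 1)).2.1
    rw [h, this])
  have hr1 := hrun 1
  have hr11 := hrun 11
  rw [checkOrder] at hcs
  obtain ⟨hcs, k₀₀⟩ := of_allMask_of_allCount hcs l₀₀ rfl
  obtain ⟨hcs, k₀₁⟩ := of_allMask_of_allCount hcs l₀₁ rfl
  obtain ⟨hcs, k₀₂⟩ := of_allMask_of_allCount hcs l₀₂ rfl
  obtain ⟨hcs, k₁₀⟩ := of_allMask_of_allCount hcs l₁₀ rfl
  obtain ⟨hcs, k₁₂⟩ := of_allMask_of_allCount hcs l₁₂ rfl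
  obtain ⟨hcs, k₂₀⟩ := of_allMask_of_allCount hcs l₂₀ rfl
  obtain ⟨hcs, k₂₁⟩ := of_allMask_of_allCount hcs l₂₁ rfl
  obtain ⟨hcs, k₂₂⟩ := of_allMask_of_allCount hcs l₂₂ rfl
  rw [hr1, cond_true] at hcs
  have hcs := k₂₂ _ (k₂₁ _ (k₂₀ _ (k₁₂ _ (k₁₀ _ (k₀₂ _ (k₀₁ _ (k₀₀ _ hcs)))))))
  simp only [maskEleven_eq] at hcs
  rw [hr11, cond_true] at hcs
  exact hcs

theorem maskPoly_mul_eq_of_ten {a b a' b' : ℕ} (ha : a < 8) (hb : b < 8) (ha' : a' < 8)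
    (hb' : b' < 8) (h : maskPoly 10 a * maskPoly 10 b = maskPoly 10 a' * maskPoly 10 b') (z : K) :
    maskPoly z a * maskPoly z b = maskPoly z a' * maskPoly z b' := by
  have key : ∀ a b a' b' : Fin 8, maskPoly 10 (a : ℕ) * maskPoly 10 (b : ℕ) =
      maskPoly 10 (a' : ℕ) * maskPoly 10 (b' : ℕ) →
      (a : ℕ) % 2 * (b % 2) = a' % 2 * (b' % 2) ∧
      (a : ℕ) % 2 * (b / 2 % 2) + a / 2 % 2 * (b % 2) =
        a' % 2 * (b' / 2 % 2) + a' / 2 % 2 * (b' % 2) ∧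
      (a : ℕ) % 2 * (b / 4) + a / 2 % 2 * (b / 2 % 2) + a / 4 * (b % 2) =
        a' % 2 * (b' / 4) + a' / 2 % 2 * (b' / 2 % 2) + a' / 4 * (b' % 2) ∧
      (a : ℕ) / 2 % 2 * (b / 4) + a / 4 * (b / 2 % 2) =
        a' / 2 % 2 * (b' / 4) + a' / 4 * (b' / 2 % 2) ∧
      (a : ℕ) / 4 * (b / 4) = a' / 4 * (b' / 4) := by
    simp only [maskPoly]
    decide +kernel
  obtain ⟨h0, h1, h2, h3, h4⟩ := key ⟨a, ha⟩ ⟨b, hb⟩ ⟨a', ha'⟩ ⟨b', hb'⟩ h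
  simp only at h0 h1 h2 h3 h4
  have h0 := congrArg (Nat.cast : ℕ → K) h0
  have h1 := congrArg (Nat.cast : ℕ → K) h1
  have h2 := congrArg (Nat.cast : ℕ → K) h2
  have h3 := congrArg (Nat.cast : ℕ → K) h3
  have h4 := congrArg (Nat.cast : ℕ → K) h4
  simp only [Nat.cast_add, Nat.cast_mul] at h0 h1 h2 h3 h4
  simp only [maskPoly]
  linear_combination h0 + z * h1 + z ^ 2 * h2 + z ^ 3 * h3 + z ^ 4 * h4

theorem exists_of_isLinear {z y : K} (hz : SubFree z) (hy : SubFree y)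
    {a₀ a₁ a₂ b₀ b₁ b₂ : ℕ} (l₁ : a₁ < 8) (l₂ : a₂ < 8) (l₃ : b₀ < 8) (l₄ : b₁ < 8)
    (h : isLinear a₀ a₁ a₂ b₀ b₁ b₂ = true)
    (h0 : quad (maskPoly z b₀) (maskPoly z b₁) (maskPoly z b₂) y 1 ≠ 0) :
    ∃ a b, quad (maskPoly z a₀) (maskPoly z a₁) (maskPoly z a₂) y 1 /
      quad (maskPoly z b₀) (maskPoly z b₁) (maskPoly z b₂) y 1 =
      maskPoly z a / maskPoly z b * y := by
  simp only [isLinear, Bool.and_eq_true, Nat.beq_eq, beq_iff_eq] at h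
  obtain ⟨rfl, rfl, h1, h2, h3⟩ := h
  have hm := maskPoly_mul_eq_of_ten l₁ l₄ l₂ l₃ h1 z
  rcases eq_or_ne b₀ 0 with rfl | hb
  · have hb1 : b₁ ≠ 0 := by
      rintro rfl
      exact h0 (by simp [quad, maskPoly_zero])
    have ha : a₁ = 0 := by simpa [Nat.beq_eq] using (show Nat.beq a₁ 0 = true from h2.trans rfl)
    subst ha
    refine ⟨a₂, b₁, ?_⟩
    have := (hz.maskPoly l₄ hb1).ne_zero
    have := hy.ne_zero
    simp only [quad, maskPoly_zero]
    field_simp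
    ring
  · refine ⟨a₁, b₀, ?_⟩
    have h4 := (hz.maskPoly l₃ hb).ne_zero
    rw [div_eq_iff h0, div_mul_eq_mul_div, div_mul_eq_mul_div, eq_div_iff h4]
    simp only [quad, maskPoly_zero]
    linear_combination (-y ^ 2) * hm

theorem exists_of_isSquare {z y : K} (hz : SubFree z)
    {a₀ a₁ a₂ b₀ b₁ b₂ : ℕ} (l₃ : b₀ < 8) (h : isSquare a₀ a₁ a₂ b₀ b₁ b₂ = true)
    (h0 : quad (maskPoly z b₀) (maskPoly z b₁) (maskPoly z b₂) y 1 ≠ 0) :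
    ∃ a b, quad (maskPoly z a₀) (maskPoly z a₁) (maskPoly z a₂) y 1 /
      quad (maskPoly z b₀) (maskPoly z b₁) (maskPoly z b₂) y 1 =
      maskPoly z a / maskPoly z b * y ^ 2 := by
  simp only [isSquare, Bool.and_eq_true, Nat.beq_eq] at h
  obtain ⟨rfl, rfl, rfl, rfl⟩ := h
  have hb : b₀ ≠ 0 := by
    rintro rfl
    exact h0 (by simp [quad, maskPoly_zero])
  have h4 := (hz.maskPoly l₃ hb).ne_zero
  refine ⟨a₂, b₀, ?_⟩
  rw [div_eq_iff h0, div_mul_eq_mul_div, div_mul_eq_mul_div, eq_div_iff h4]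
  simp only [quad, maskPoly_zero]
  ring

/-- The exponents of a mutually dependent pair of reflections generating a finite group. -/
def exponentPairs : Finset (ℤ × ℤ) := {(1, 1), (1, 2), (2, 1), (-1, -1), (-1, -2), (-2, -1)}

theorem ReflSystem.exists_exponents_of_masks {φ : Fin 3 → K ≃ₐ[ℚ] K} {R : Fin 3 → K}
    (H : ReflSystem φ R) {c d l : Fin 3} (h1 : c ≠ d) (h2 : c ≠ l) (h3 : d ≠ l) (m : Weights ℕ)
    (l₀₀ : m.a₀₀ < 8) (l₀₁ : m.a₀₁ < 8) (l₀₂ : m.a₀₂ < 8) (l₁₀ : m.a₁₀ < 8) (l₁₂ : m.a₁₂ < 8)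
    (l₂₀ : m.a₂₀ < 8) (l₂₁ : m.a₂₁ < 8) (l₂₂ : m.a₂₂ < 8)
    (hRc : R c = quad (maskPoly (Xv l) m.a₀₀) (maskPoly (Xv l) m.a₀₁) (maskPoly (Xv l) m.a₀₂)
      (Xv d) 1 / quad (maskPoly (Xv l) m.a₂₀) (maskPoly (Xv l) m.a₂₁) (maskPoly (Xv l) m.a₂₂)
      (Xv d) 1)
    (hRd : R d = quad (maskPoly (Xv l) m.a₀₀) (maskPoly (Xv l) m.a₁₀) (maskPoly (Xv l) m.a₂₀)
      (Xv c) 1 / quad (maskPoly (Xv l) m.a₀₂) (maskPoly (Xv l) m.a₁₂) (maskPoly (Xv l) m.a₂₂)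
      (Xv c) 1)
    {n : ℕ} (hn : 0 < n) (hfin : (φ c * φ d) ^ n = 1) (hcd : R c ∉ Free d) (hdc : R d ∉ Free c) :
    ∃ e ∈ exponentPairs, ∃ r t : K, (r ∈ Free c ∧ r ∈ Free d) ∧ (t ∈ Free c ∧ t ∈ Free d) ∧
      R c = r * Xv d ^ e.1 ∧ R d = t * Xv c ^ e.2 := by
  have hmono := H.isMonomial_of_pow_eq_one h1 h2 h3 m l₀₀ l₀₁ l₀₂ l₁₀ l₁₂ l₂₀ l₂₁ l₂₂ hRc hRd hn
    hfin hcd hdc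
  have hfree : ∀ a b, maskPoly (Xv l) a / maskPoly (Xv l) b ∈ Free c ∧
      maskPoly (Xv l) a / maskPoly (Xv l) b ∈ Free d := fun a b =>
    ⟨div_mem (maskPoly_mem (Xv_mem_free h2.symm) _) (maskPoly_mem (Xv_mem_free h2.symm) _),
      div_mem (maskPoly_mem (Xv_mem_free h3.symm) _) (maskPoly_mem (Xv_mem_free h3.symm) _)⟩
  have hc0 := H.ne_zero c
  have hd0 := H.ne_zero d
  rw [hRc, div_ne_zero_iff] at hc0
  rw [hRd, div_ne_zero_iff] at hd0
  have sl := SubFree.X l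
  have sc := SubFree.X c
  have sd := SubFree.X d
  have hinv : ∀ {f g w y : K} {k : ℤ}, f / g = w * y ^ k → g / f = w⁻¹ * y ^ (-k) := by
    intro f g w y k h
    rw [← inv_div, h, mul_inv, zpow_neg]
  have neg : ∀ {u u' v v' : K} {k m' : ℤ}, (-k, -m') ∈ exponentPairs →
      R c = u / v → R d = u' / v' →
      (∃ a b, v / u = maskPoly (Xv l) a / maskPoly (Xv l) b * Xv d ^ k) →
      (∃ a b, v' / u' = maskPoly (Xv l) a / maskPoly (Xv l) b * Xv c ^ m') →
      ∃ e ∈ exponentPairs, ∃ r t : K, (r ∈ Free c ∧ r ∈ Free d) ∧ (t ∈ Free c ∧ t ∈ Free d) ∧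
      R c = r * Xv d ^ e.1 ∧ R d = t * Xv c ^ e.2 := by
    rintro u u' v v' k m' he e1 e2 ⟨a, b, h⟩ ⟨a', b', h'⟩
    exact ⟨_, he, _, _, ⟨inv_mem (hfree a b).1, inv_mem (hfree a b).2⟩,
      ⟨inv_mem (hfree a' b').1, inv_mem (hfree a' b').2⟩, e1.trans (hinv h), e2.trans (hinv h')⟩
  have pos : ∀ {u u' v v' : K} {k m' : ℤ}, (k, m') ∈ exponentPairs →
      R c = u / v → R d = u' / v' →
      (∃ a b, u / v = maskPoly (Xv l) a / maskPoly (Xv l) b * Xv d ^ k) →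
      (∃ a b, u' / v' = maskPoly (Xv l) a / maskPoly (Xv l) b * Xv c ^ m') →
      ∃ e ∈ exponentPairs, ∃ r t : K, (r ∈ Free c ∧ r ∈ Free d) ∧ (t ∈ Free c ∧ t ∈ Free d) ∧
      R c = r * Xv d ^ e.1 ∧ R d = t * Xv c ^ e.2 := by
    rintro u u' v v' k m' he e1 e2 ⟨a, b, h⟩ ⟨a', b', h'⟩
    exact ⟨_, he, _, _, hfree a b, hfree a' b', e1.trans h, e2.trans h'⟩
  have z1 : ∀ y : K, y ^ (1 : ℤ) = y := fun y => zpow_one y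
  have z2 : ∀ y : K, y ^ (2 : ℤ) = y ^ 2 := fun y => zpow_ofNat y 2
  simp only [isMonomial, Bool.or_eq_true, Bool.and_eq_true] at hmono
  rcases hmono with (⟨p, q⟩ | ⟨p, q⟩ | ⟨p, q⟩) | ⟨p, q⟩ | ⟨p, q⟩ | ⟨p, q⟩
  · refine pos (k := 1) (m' := 1) (by decide) hRc hRd ?_ ?_
    · rw [z1]; exact exists_of_isLinear sl sd l₀₁ l₀₂ l₂₀ l₂₁ p hc0.2
    · rw [z1]; exact exists_of_isLinear sl sc l₁₀ l₂₀ l₀₂ l₁₂ q hd0.2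
  · refine pos (k := 1) (m' := 2) (by decide) hRc hRd ?_ ?_
    · rw [z1]; exact exists_of_isLinear sl sd l₀₁ l₀₂ l₂₀ l₂₁ p hc0.2
    · rw [z2]; exact exists_of_isSquare sl l₀₂ q hd0.2
  · refine pos (k := 2) (m' := 1) (by decide) hRc hRd ?_ ?_
    · rw [z2]; exact exists_of_isSquare sl l₂₀ p hc0.2
    · rw [z1]; exact exists_of_isLinear sl sc l₁₀ l₂₀ l₀₂ l₁₂ q hd0.2
  · refine neg (k := 1) (m' := 1) (by decide) hRc hRd ?_ ?_
    · rw [z1]; exact exists_of_isLinear sl sd l₂₁ l₂₂ l₀₀ l₀₁ p hc0.1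
    · rw [z1]; exact exists_of_isLinear sl sc l₁₂ l₂₂ l₀₀ l₁₀ q hd0.1
  · refine neg (k := 1) (m' := 2) (by decide) hRc hRd ?_ ?_
    · rw [z1]; exact exists_of_isLinear sl sd l₂₁ l₂₂ l₀₀ l₀₁ p hc0.1
    · rw [z2]; exact exists_of_isSquare sl l₀₀ q hd0.1
  · refine neg (k := 2) (m' := 1) (by decide) hRc hRd ?_ ?_
    · rw [z2]; exact exists_of_isSquare sl l₀₀ p hc0.1
    · rw [z1]; exact exists_of_isLinear sl sc l₁₂ l₂₂ l₀₀ l₁₀ q hd0.1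

/-- The steps with given entries at the positions `c` and `d`, as a binary mask. -/
def stepMask (S : Finset (Fin 3 → ℤ)) (c d : Fin 3) (e k : ℤ) : ℕ :=
  (if stepVec c d e k (-1) ∈ S then 1 else 0) + 2 * (if stepVec c d e k 0 ∈ S then 1 else 0) +
    4 * (if stepVec c d e k 1 ∈ S then 1 else 0)

theorem stepMask_lt (S : Finset (Fin 3 → ℤ)) (c d : Fin 3) (e k : ℤ) : stepMask S c d e k < 8 := by
  unfold stepMask; split_ifs <;> norm_num

theorem maskPoly_stepMask (S : Finset (Fin 3 → ℤ)) (c d l : Fin 3) (e k : ℤ) :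
    maskPoly (Xv l) (stepMask S c d e k) = Xv l * stepCoeff S c d l e k := by
  have hx := Xv_ne_zero l
  simp only [stepMask, stepCoeff, entries, maskPoly]
  rw [Finset.sum_insert (by decide), Finset.sum_insert (by decide), Finset.sum_singleton]
  split_ifs <;> simp [zpow_neg, mul_add, add_assoc, hx]

theorem stepMask_comm (S : Finset (Fin 3 → ℤ)) {c d : Fin 3} (h : c ≠ d) (e k : ℤ) :
    stepMask S d c e k = stepMask S c d k e := by
  have : ∀ m, stepVec d c e k m = stepVec c d k e m := by
    intro m
    funext i
    simp only [stepVec]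
    split_ifs with h1 h2 <;> first | rfl | exact absurd (h2.symm.trans h1) h
  simp only [stepMask, this]

theorem quad_stepMask {S : Finset (Fin 3 → ℤ)}
    (hS : ∀ s ∈ S, (∀ c : Fin 3, s c = -1 ∨ s c = 0 ∨ s c = 1) ∧ s ≠ 0) {c d l : Fin 3}
    (h1 : c ≠ d) (h2 : c ≠ l) (h3 : d ≠ l) (e : ℤ) :
    quad (maskPoly (Xv l) (stepMask S c d e (-1))) (maskPoly (Xv l) (stepMask S c d e 0))
      (maskPoly (Xv l) (stepMask S c d e 1)) (Xv d) 1 = Xv l * Xv d * Bm S c e := by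
  have hx := Xv_ne_zero d
  rw [Bm_eq_sum_stepCoeff hS h1 h2 h3, maskPoly_stepMask S c d l, maskPoly_stepMask S c d l,
    maskPoly_stepMask S c d l, Finset.sum_insert (by decide), Finset.sum_insert (by decide),
    Finset.sum_singleton, quad, zpow_neg, zpow_one, zpow_zero]
  field_simp

/-- A mutually dependent pair of reflections of a stepset is monomial if it generates a finite
group. -/
theorem exists_exponents {S : Finset (Fin 3 → ℤ)}
    (hS : ∀ s ∈ S, (∀ c : Fin 3, s c = -1 ∨ s c = 0 ∨ s c = 1) ∧ s ≠ 0)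
    {φ : Fin 3 → K ≃ₐ[ℚ] K} (hφ : ∀ c, IsPhi S c (φ c)) {c d : Fin 3} (h1 : c ≠ d) {n : ℕ}
    (hn : 0 < n) (hfin : (φ c * φ d) ^ n = 1) (hcd : Bm S c (-1) / Bm S c 1 ∉ Free d)
    (hdc : Bm S d (-1) / Bm S d 1 ∉ Free c) :
    ∃ e ∈ exponentPairs, ∃ r t : K, (r ∈ Free c ∧ r ∈ Free d) ∧ (t ∈ Free c ∧ t ∈ Free d) ∧
      Bm S c (-1) / Bm S c 1 = r * Xv d ^ e.1 ∧ Bm S d (-1) / Bm S d 1 = t * Xv c ^ e.2 := by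
  obtain ⟨l, h2, h3⟩ := exists_distinct h1
  have hl := Xv_ne_zero l
  have hq : ∀ {c d : Fin 3}, c ≠ d → c ≠ l → d ≠ l → Bm S c (-1) / Bm S c 1 =
      (Xv l * Xv d * Bm S c (-1)) / (Xv l * Xv d * Bm S c 1) := fun {c d} _ _ _ =>
    (mul_div_mul_left _ _ (mul_ne_zero hl (Xv_ne_zero d))).symm
  refine (reflSystem_of_isPhi hS hφ).exists_exponents_of_masks h1 h2 h3
    ⟨stepMask S c d (-1) (-1), stepMask S c d (-1) 0, stepMask S c d (-1) 1, stepMask S c d 0 (-1),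
      stepMask S c d 0 1, stepMask S c d 1 (-1), stepMask S c d 1 0, stepMask S c d 1 1⟩
    (stepMask_lt ..) (stepMask_lt ..) (stepMask_lt ..) (stepMask_lt ..) (stepMask_lt ..)
    (stepMask_lt ..) (stepMask_lt ..) (stepMask_lt ..) ?_ ?_ hn hfin hcd hdc
  · rw [quad_stepMask hS h1 h2 h3, quad_stepMask hS h1 h2 h3]
    exact hq h1 h2 h3
  · simp only [← stepMask_comm S h1]
    rw [quad_stepMask hS h1.symm h3 h2, quad_stepMask hS h1.symm h3 h2]
    exact hq h1.symm h3 h2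

/-! ### Monomial reflections -/

/-- Exponent vectors. -/
abbrev Row : Type := ℤ × ℤ × ℤ

/-- Exponent matrices. -/
abbrev ExpMat : Type := Row × Row × Row

/-- The exponents of three monomials, each in two of the variables. -/
structure Exponents where
  (cd cl dc dl lc ld : ℤ)

/-- The exponent vector `n p + m q - r`. -/
def Row.comb (n m : ℤ) (p q r : Row) : Row :=
  (n * p.1 + m * q.1 - r.1, n * p.2.1 + m * q.2.1 - r.2.1, n * p.2.2 + m * q.2.2 - r.2.2)

/-- The effect of a reflection on exponent matrices. -/
def Exponents.reflect (N : Exponents) (A : ExpMat) : Fin 3 → ExpMat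
  | 0 => (Row.comb N.cd N.cl A.2.1 A.2.2 A.1, A.2.1, A.2.2)
  | 1 => (A.1, Row.comb N.dc N.dl A.1 A.2.2 A.2.1, A.2.2)
  | 2 => (A.1, A.2.1, Row.comb N.lc N.ld A.1 A.2.1 A.2.2)

/-- The identity matrix. -/
def ExpMat.id : ExpMat := ((1, 0, 0), (0, 1, 0), (0, 0, 1))

/-- The nonpositive nonzero triples. -/
def IsNeg (a b c : ℤ) : Prop := a ≤ 0 ∧ b ≤ 0 ∧ c ≤ 0 ∧ (a < 0 ∨ b < 0 ∨ c < 0)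

/-- The matrix has a nonpositive nonzero column. -/
def ExpMat.HasNegColumn (A : ExpMat) (b : Bool) : Prop :=
  IsNeg A.1.1 A.2.1.1 A.2.2.1 ∨ IsNeg A.1.2.1 A.2.1.2.1 A.2.2.2.1 ∨
    (b = true ∧ IsNeg A.1.2.2 A.2.1.2.2 A.2.2.2.2)

/-- The indices of the reflections which are used. -/
def reflIndices (b : Bool) : List (Fin 3) := cond b [0, 1, 2] [0, 1]

/-- Breadth first enumeration of an orbit of matrices. -/
def Exponents.orbit (N : Exponents) (b : Bool) : ℕ → List ExpMat → List ExpMat → List ExpMat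
  | 0, _, seen => seen
  | n + 1, frontier, seen =>
    (fun new => N.orbit b n new (seen ++ new))
      ((frontier.flatMap fun A => (reflIndices b).map (N.reflect A)).filter (· ∉ seen)).dedup

/-- The list is closed under reflections, and its elements other than the identity have a
negative column. -/
def Exponents.IsClosed (N : Exponents) (b : Bool) (ℓ : List ExpMat) : Prop :=
  ExpMat.id ∈ ℓ ∧ ∀ A ∈ ℓ, (A = ExpMat.id ∨ A.HasNegColumn b) ∧
    ∀ j ∈ reflIndices b, N.reflect A j ∈ ℓ

instance (a b c : ℤ) : Decidable (IsNeg a b c) := by unfold IsNeg; infer_instance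

instance (A : ExpMat) (b : Bool) : Decidable (A.HasNegColumn b) := by
  unfold ExpMat.HasNegColumn; infer_instance

set_option synthInstance.maxSize 1000 in
instance (N : Exponents) (b : Bool) (ℓ : List ExpMat) : Decidable (N.IsClosed b ℓ) := by
  unfold Exponents.IsClosed; infer_instance

/-- The finite reflection groups of rank two. -/
theorem isClosed_orbit_of_pair : ∀ e ∈ ([(1, 1), (1, 2), (2, 1)] : List (ℤ × ℤ)),
    (⟨e.1, 0, e.2, 0, 0, 0⟩ : Exponents).IsClosed false
      ((⟨e.1, 0, e.2, 0, 0, 0⟩ : Exponents).orbit false 10 [ExpMat.id] [ExpMat.id]) := by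
  decide +kernel

/-- The finite reflection groups of rank three. -/
theorem isClosed_orbit_of_path : ∀ e ∈ ([(1, 1), (1, 2), (2, 1)] : List (ℤ × ℤ)),
    ∀ f ∈ ([(1, 1), (1, 2), (2, 1)] : List (ℤ × ℤ)), e.1 * e.2 = 1 ∨ f.1 * f.2 = 1 →
    (⟨e.1, 0, e.2, f.1, 0, f.2⟩ : Exponents).IsClosed true
      ((⟨e.1, 0, e.2, f.1, 0, f.2⟩ : Exponents).orbit true 10 [ExpMat.id] [ExpMat.id]) := by
  decide +kernel

/-- The image of every monomial with positive exponents involves only monomials in which one fixed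
variable has a negative exponent. -/
def Extractable (g : K ≃ₐ[ℚ] K) : Prop :=
  ∃ i, ∃ m : Fin 3 → ℕ, (∃ j, 0 < m j) ∧ ∀ j, g (Xv j) * Xv i ^ m j ∈ Free i

/-- `f` is a Laurent monomial with subtraction-free coefficient in `L`. -/
def IsRow (L : IntermediateField ℚ K) (c d l : Fin 3) (f : K) (p : Row) : Prop :=
  ∃ u ∈ L, SubFree u ∧ f = u * (Xv c ^ p.1 * Xv d ^ p.2.1 * Xv l ^ p.2.2)

section IsRow

variable {L : IntermediateField ℚ K} {c d l : Fin 3}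

theorem IsRow.subFree {f : K} {p : Row} (h : IsRow L c d l f p) : SubFree f := by
  obtain ⟨u, -, hu, rfl⟩ := h
  exact hu.mul ((((SubFree.X c).zpow _).mul ((SubFree.X d).zpow _)).mul ((SubFree.X l).zpow _))

theorem isRow_left : IsRow L c d l (Xv c) (1, 0, 0) := ⟨1, one_mem _, .one, by simp⟩

theorem isRow_mid : IsRow L c d l (Xv d) (0, 1, 0) := ⟨1, one_mem _, .one, by simp⟩

theorem isRow_right : IsRow L c d l (Xv l) (0, 0, 1) := ⟨1, one_mem _, .one, by simp⟩

theorem IsRow.comb {u f g h : K} (huL : u ∈ L) (hu : SubFree u) {p q r : Row}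
    (hf : IsRow L c d l f p) (hg : IsRow L c d l g q) (hh : IsRow L c d l h r) (n m : ℤ) :
    IsRow L c d l (u * (f ^ n * g ^ m) / h) (Row.comb n m p q r) := by
  obtain ⟨a, haL, ha, rfl⟩ := hf
  obtain ⟨b, hbL, hb, rfl⟩ := hg
  obtain ⟨e, heL, he, rfl⟩ := hh
  refine ⟨u * (a ^ n * b ^ m) / e, div_mem (mul_mem huL (mul_mem (zpow_mem haL _)
    (zpow_mem hbL _))) heL, (hu.mul ((ha.zpow n).mul (hb.zpow m))).div he, ?_⟩
  have h1 := Xv_ne_zero c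
  have h2 := Xv_ne_zero d
  have h3 := Xv_ne_zero l
  have h4 := he.ne_zero
  simp only [Row.comb, zpow_sub₀ h1, zpow_sub₀ h2, zpow_sub₀ h3, zpow_add₀ h1, zpow_add₀ h2,
    zpow_add₀ h3, mul_zpow, ← zpow_mul']
  field_simp

theorem IsRow.mul_pow_mem {f : K} {p : Row} (h : IsRow L c d l f p) (h1 : c ≠ d) (h2 : c ≠ l)
    (h3 : d ≠ l) :
    (L ≤ Free c → p.1 ≤ 0 → f * Xv c ^ (-p.1).toNat ∈ Free c) ∧
    (L ≤ Free d → p.2.1 ≤ 0 → f * Xv d ^ (-p.2.1).toNat ∈ Free d) ∧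
    (L ≤ Free l → p.2.2 ≤ 0 → f * Xv l ^ (-p.2.2).toNat ∈ Free l) := by
  obtain ⟨u, huL, -, rfl⟩ := h
  have key : ∀ (x : K) (n : ℤ), x ≠ 0 → n ≤ 0 → x ^ n * x ^ (-n).toNat = 1 := by
    intro x n hx hn
    rw [← zpow_natCast, ← zpow_add₀ hx, Int.toNat_of_nonneg (by omega)]
    simp
  refine ⟨fun hL hp => ?_, fun hL hp => ?_, fun hL hp => ?_⟩
  · have : u * (Xv c ^ p.1 * Xv d ^ p.2.1 * Xv l ^ p.2.2) * Xv c ^ (-p.1).toNat =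
        u * (Xv d ^ p.2.1 * Xv l ^ p.2.2) * (Xv c ^ p.1 * Xv c ^ (-p.1).toNat) := by ring
    rw [this, key _ _ (Xv_ne_zero c) hp, mul_one]
    exact mul_mem (hL huL) (mul_mem (zpow_mem (Xv_mem_free h1.symm) _)
      (zpow_mem (Xv_mem_free h2.symm) _))
  · have : u * (Xv c ^ p.1 * Xv d ^ p.2.1 * Xv l ^ p.2.2) * Xv d ^ (-p.2.1).toNat =
        u * (Xv c ^ p.1 * Xv l ^ p.2.2) * (Xv d ^ p.2.1 * Xv d ^ (-p.2.1).toNat) := by ring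
    rw [this, key _ _ (Xv_ne_zero d) hp, mul_one]
    exact mul_mem (hL huL) (mul_mem (zpow_mem (Xv_mem_free h1) _)
      (zpow_mem (Xv_mem_free h3.symm) _))
  · have : u * (Xv c ^ p.1 * Xv d ^ p.2.1 * Xv l ^ p.2.2) * Xv l ^ (-p.2.2).toNat =
        u * (Xv c ^ p.1 * Xv d ^ p.2.1) * (Xv l ^ p.2.2 * Xv l ^ (-p.2.2).toNat) := by ring
    rw [this, key _ _ (Xv_ne_zero l) hp, mul_one]
    exact mul_mem (hL huL) (mul_mem (zpow_mem (Xv_mem_free h2) _)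
      (zpow_mem (Xv_mem_free h3) _))

end IsRow

theorem extractable_of_forall {g : K ≃ₐ[ℚ] K} {c d l : Fin 3} (h1 : c ≠ d) (h2 : c ≠ l)
    (h3 : d ≠ l) (i : Fin 3) (mc md ml : ℕ) (hm : 0 < mc ∨ 0 < md ∨ 0 < ml)
    (hc : g (Xv c) * Xv i ^ mc ∈ Free i) (hd : g (Xv d) * Xv i ^ md ∈ Free i)
    (hl : g (Xv l) * Xv i ^ ml ∈ Free i) : Extractable g := by
  refine ⟨i, fun j => if j = c then mc else if j = d then md else ml, ?_, fun j => ?_⟩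
  · rcases hm with h | h | h
    · exact ⟨c, by simpa using h⟩
    · exact ⟨d, by simpa [h1.symm] using h⟩
    · exact ⟨l, by simpa [h2.symm, h3.symm] using h⟩
  · rcases eq_or_of_distinct h1 h2 h3 j with rfl | rfl | rfl
    · simpa using hc
    · simpa [h1.symm] using hd
    · simpa [h2.symm, h3.symm] using hl

theorem closure_induction_of_involutions {G : Type*} [Group G] {s : Set G}
    (hs : ∀ y ∈ s, y⁻¹ = y) {P : G → Prop} (one : P 1) (step : ∀ x, ∀ y ∈ s, P x → P (x * y))
    {g : G} (hg : g ∈ Subgroup.closure s) : P g := by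
  induction hg using Subgroup.closure_induction_right with
  | one => exact one
  | mul_right x hx y hy ih => exact step x y hy ih
  | mul_inv_cancel x hx y hy ih => rw [hs y hy]; exact step x y hy ih

/-- The images of the variables are Laurent monomials with the given exponents. -/
def IsMat (L : IntermediateField ℚ K) (c d l : Fin 3) (g : K ≃ₐ[ℚ] K) (A : ExpMat) : Prop :=
  IsRow L c d l (g (Xv c)) A.1 ∧ IsRow L c d l (g (Xv d)) A.2.1 ∧ IsRow L c d l (g (Xv l)) A.2.2

theorem IsMat.extractable {L : IntermediateField ℚ K} {c d l : Fin 3} (h1 : c ≠ d) (h2 : c ≠ l)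
    (h3 : d ≠ l) {b : Bool} (hc : L ≤ Free c) (hd : L ≤ Free d) (hl : b = true → L ≤ Free l)
    {g : K ≃ₐ[ℚ] K} {A : ExpMat} (h : IsMat L c d l g A) (hA : A.HasNegColumn b) :
    Extractable g := by
  obtain ⟨r1, r2, r3⟩ := h
  have e1 := r1.mul_pow_mem h1 h2 h3
  have e2 := r2.mul_pow_mem h1 h2 h3
  have e3 := r3.mul_pow_mem h1 h2 h3
  rcases hA with ⟨a1, a2, a3, a4⟩ | ⟨a1, a2, a3, a4⟩ | ⟨hb, a1, a2, a3, a4⟩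
  · exact extractable_of_forall h1 h2 h3 c _ _ _ (by omega) (e1.1 hc a1) (e2.1 hc a2) (e3.1 hc a3)
  · exact extractable_of_forall h1 h2 h3 d _ _ _ (by omega) (e1.2.1 hd a1) (e2.2.1 hd a2)
      (e3.2.1 hd a3)
  · exact extractable_of_forall h1 h2 h3 l _ _ _ (by omega) (e1.2.2 (hl hb) a1)
      (e2.2.2 (hl hb) a2) (e3.2.2 (hl hb) a3)

theorem exists_isMat_of_mem_closure {φ : Fin 3 → K ≃ₐ[ℚ] K} {R : Fin 3 → K} (H : ReflSystem φ R)
    {L : IntermediateField ℚ K} {c d l : Fin 3} (h1 : c ≠ d) (h2 : c ≠ l) (h3 : d ≠ l) {b : Bool}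
    (hc : L ≤ Free c) (hd : L ≤ Free d) (hl : b = true → L ≤ Free l) {N : Exponents}
    (hRc : IsRow L c d l (R c) (0, N.cd, N.cl)) (hRd : IsRow L c d l (R d) (N.dc, 0, N.dl))
    (hRl : b = true → IsRow L c d l (R l) (N.lc, N.ld, 0)) {ℓ : List ExpMat}
    (hℓ : N.IsClosed b ℓ) {g : K ≃ₐ[ℚ] K}
    (hg : g ∈ Subgroup.closure {ψ | ∃ j ∈ reflIndices b, ψ = φ (![c, d, l] j)}) :
    (∀ u ∈ L, g u = u) ∧ ∃ A ∈ ℓ, IsMat L c d l g A ∧ (b = false → A.2.2 = (0, 0, 1)) := by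
  have step : ∀ (x : K ≃ₐ[ℚ] K), ∀ ψ ∈ {ψ | ∃ j ∈ reflIndices b, ψ = φ (![c, d, l] j)},
      ((∀ u ∈ L, x u = u) ∧ ∃ A ∈ ℓ, IsMat L c d l x A ∧ (b = false → A.2.2 = (0, 0, 1))) →
      ((∀ u ∈ L, (x * ψ) u = u) ∧ ∃ A ∈ ℓ, IsMat L c d l (x * ψ) A ∧ (b = false → A.2.2 = (0, 0, 1))) := by
    rintro x ψ ⟨j, hj, rfl⟩ ⟨hx, A, hA, ⟨rA1, rA2, rA3⟩, hA3⟩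
    have hfix : ∀ i, L ≤ Free i → ∀ u ∈ L, (x * φ i) u = u := fun i hi u hu => by
      rw [AlgEquiv.mul_apply, H.map_free (hi hu), hx u hu]
    have hmem := (hℓ.2 A hA).2 j hj
    have hoth : ∀ i k, k ≠ i → (x * φ i) (Xv k) = x (Xv k) := fun i k hk => by
      rw [AlgEquiv.mul_apply, H.other i k hk]
    have hself : ∀ i, (x * φ i) (Xv i) = x (R i) / x (Xv i) := fun i => by
      rw [AlgEquiv.mul_apply, H.self, map_div₀]
    have hcase : j = 0 ∨ j = 1 ∨ (j = 2 ∧ b = true) := by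
      cases b <;> simp [reflIndices] at hj <;> tauto
    rcases hcase with rfl | rfl | ⟨rfl, hb⟩
    · refine ⟨hfix c hc, _, hmem, ⟨?_, ?_, ?_⟩, hA3⟩
      · change IsRow L c d l ((x * φ c) (Xv c)) _
        obtain ⟨u, huL, hu, hRe⟩ := hRc
        rw [hself, hRe]
        simp only [zpow_zero, one_mul, map_mul, map_zpow₀, hx u huL]
        exact IsRow.comb huL hu rA2 rA3 rA1 _ _
      · change IsRow L c d l ((x * φ c) (Xv d)) _
        rw [hoth c d h1.symm]; exact rA2
      · change IsRow L c d l ((x * φ c) (Xv l)) _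
        rw [hoth c l h2.symm]; exact rA3
    · refine ⟨hfix d hd, _, hmem, ⟨?_, ?_, ?_⟩, hA3⟩
      · change IsRow L c d l ((x * φ d) (Xv c)) _
        rw [hoth d c h1]; exact rA1
      · change IsRow L c d l ((x * φ d) (Xv d)) _
        obtain ⟨u, huL, hu, hRe⟩ := hRd
        rw [hself, hRe]
        simp only [zpow_zero, mul_one, map_mul, map_zpow₀, hx u huL]
        exact IsRow.comb huL hu rA1 rA3 rA2 _ _
      · change IsRow L c d l ((x * φ d) (Xv l)) _
        rw [hoth d l h3.symm]; exact rA3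
    · refine ⟨hfix l (hl hb), _, hmem, ⟨?_, ?_, ?_⟩, by simp [hb]⟩
      · change IsRow L c d l ((x * φ l) (Xv c)) _
        rw [hoth l c h2]; exact rA1
      · change IsRow L c d l ((x * φ l) (Xv d)) _
        rw [hoth l d h3]; exact rA2
      · change IsRow L c d l ((x * φ l) (Xv l)) _
        obtain ⟨u, huL, hu, hRe⟩ := hRl hb
        rw [hself, hRe]
        simp only [zpow_zero, mul_one, map_mul, map_zpow₀, hx u huL]
        exact IsRow.comb huL hu rA1 rA2 rA3 _ _
  refine closure_induction_of_involutions (by rintro y ⟨j, -, rfl⟩; exact H.inv_eq _)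
    ⟨fun u _ => rfl, ExpMat.id, hℓ.1, ⟨isRow_left, isRow_mid, isRow_right⟩, fun _ => rfl⟩ step hg

theorem eq_one_of_isMat_id_of_pair {c d l : Fin 3} (h1 : c ≠ d) (h2 : c ≠ l) (h3 : d ≠ l)
    {g : K ≃ₐ[ℚ] K} {n : ℕ} (hn : 0 < n) (hgn : g ^ n = 1)
    (hL : ∀ u ∈ Free c ⊓ Free d, g u = u) (h : IsMat (Free c ⊓ Free d) c d l g ExpMat.id) :
    g = 1 := by
  obtain ⟨σ, hc, hd, hl⟩ := exists_perm h1 h2 h3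
  obtain ⟨r1, r2, r3⟩ := h
  have key : ∀ x : K, ∀ u : K, (u ∈ Free c ⊓ Free d) → u ≠ 0 → x ≠ 0 →
      topVal σ (u * x) = topVal σ x := fun x u hu hu0 hx => by
    rw [topVal_mul hu0 hx, topVal_eq_zero hc hd hu0 hu.1 hu.2, zero_add]
  refine eq_one_of_topVal_eq hl (eq_or_of_distinct h1 h2 h3) hn hgn
    (hL _ ⟨Xv_mem_free h2.symm, Xv_mem_free h3.symm⟩) (fun i => ?_) ?_ ?_
  · rcases eq_or_of_distinct h1 h2 h3 i with rfl | rfl | rfl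
    · exact r1.subFree.posLead σ
    · exact r2.subFree.posLead σ
    · exact r3.subFree.posLead σ
  · obtain ⟨u, huL, hu, he⟩ := r1
    rw [he]
    simp only [ExpMat.id, zpow_one, zpow_zero, mul_one]
    exact key _ _ huL hu.ne_zero (Xv_ne_zero c)
  · obtain ⟨u, huL, hu, he⟩ := r2
    rw [he]
    simp only [ExpMat.id, zpow_one, zpow_zero, mul_one, one_mul]
    exact key _ _ huL hu.ne_zero (Xv_ne_zero d)

/-- Constants have valuation zero. -/
theorem val_eq_zero_of_mem_free (σ : Equiv.Perm (Fin 3)) {u : K} (hu : u ≠ 0)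
    (h : ∀ j, u ∈ Free j) : val σ u = 0 := by
  refine LexExp.ext fun j => ?_
  by_contra hj
  have := expand_coeff_eq_zero_of_mem_free σ (h (σ.symm j)) (e := val σ u) (by
    rw [Equiv.apply_symm_apply]; simpa using hj)
  rw [val, ← leadingCoeff_eq] at this
  exact (leadingCoeff_ne_zero.mpr (expand_ne_zero σ hu)) this

theorem eq_one_of_isMat_id_of_const {c d l : Fin 3} (h1 : c ≠ d) (h2 : c ≠ l) (h3 : d ≠ l)
    {g : K ≃ₐ[ℚ] K} {n : ℕ} (hn : 0 < n) (hgn : g ^ n = 1)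
    (h : IsMat (Free c ⊓ Free d ⊓ Free l) c d l g ExpMat.id) : g = 1 := by
  obtain ⟨r1, r2, r3⟩ := h
  have hrow : ∀ i, ∃ u, u ∈ Free c ⊓ Free d ⊓ Free l ∧ SubFree u ∧ g (Xv i) = u * Xv i := by
    intro i
    rcases eq_or_of_distinct h1 h2 h3 i with rfl | rfl | rfl
    · obtain ⟨u, huL, hu, he⟩ := r1
      exact ⟨u, huL, hu, by rw [he]; simp [ExpMat.id]⟩
    · obtain ⟨u, huL, hu, he⟩ := r2
      exact ⟨u, huL, hu, by rw [he]; simp [ExpMat.id]⟩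
    · obtain ⟨u, huL, hu, he⟩ := r3
      exact ⟨u, huL, hu, by rw [he]; simp [ExpMat.id]⟩
  have hlead : ∀ i, ∃ a : ℚ, 0 < a ∧ Lead (expand 1 (g (Xv i))) (expBasis i) a := by
    intro i
    obtain ⟨u, huL, hu, he⟩ := hrow i
    have hv : val 1 u = 0 := val_eq_zero_of_mem_free 1 hu.ne_zero fun j => by
      rcases eq_or_of_distinct h1 h2 h3 j with rfl | rfl | rfl
      exacts [huL.1.1, huL.1.2, huL.2]
    have hp := hu.posLead 1
    have h5 := (hp.lead).mul (lead_Xv 1 i)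
    rw [← map_mul, ← he, hv, zero_add, mul_one] at h5
    exact ⟨_, hp, h5⟩
  choose a ha0 ha using hlead
  exact eq_one_of_pow_eq_one 1 g hn hgn (AddMonoidHom.id _) (fun _ _ h => h) a ha ha0

/-- A system of reflections which generates a torsion group and all of whose non-commuting pairs are
monomial with positive exponents. -/
structure FinReflSystem (φ : Fin 3 → K ≃ₐ[ℚ] K) (R : Fin 3 → K) : Prop extends ReflSystem φ R where
  fin : ∀ g ∈ Subgroup.closure (Set.range φ), ∃ n, 0 < n ∧ g ^ n = 1
  pair : ∀ {c d}, c ≠ d → R c ∉ Free d → R d ∉ Free c →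
    ∃ e ∈ ([(1, 1), (1, 2), (2, 1)] : List (ℤ × ℤ)), ∃ r t : K,
      (r ∈ Free c ∧ r ∈ Free d) ∧ (t ∈ Free c ∧ t ∈ Free d) ∧
        R c = r * Xv d ^ e.1 ∧ R d = t * Xv c ^ e.2

namespace FinReflSystem

variable {φ : Fin 3 → K ≃ₐ[ℚ] K} {R : Fin 3 → K}

theorem gen_mem (c : Fin 3) : φ c ∈ Subgroup.closure (Set.range φ) :=
  Subgroup.subset_closure ⟨c, rfl⟩

theorem map_eq_self (H : FinReflSystem φ R) {c d : Fin 3} (hcd : c ≠ d)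
    (h : R c ∈ Free d ∨ R d ∈ Free c) : φ c (R d) = R d := by
  rcases h with h | h
  · obtain ⟨n, hn, hn'⟩ := H.fin _ (mul_mem (gen_mem c) (gen_mem d))
    exact H.map_eq_self_of_free hcd h hn hn'
  · exact H.map_free h

theorem comm (H : FinReflSystem φ R) {c d : Fin 3} (hcd : c ≠ d)
    (h : R c ∈ Free d ∨ R d ∈ Free c) : φ c * φ d = φ d * φ c := by
  have h1 := H.map_eq_self hcd h
  have h2 := H.map_eq_self hcd.symm h.symm
  refine K.algEquiv_ext fun i => ?_
  simp only [AlgEquiv.mul_apply]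
  rcases eq_or_ne i c with rfl | hc
  · rw [H.other d i hcd, H.self, map_div₀, h2, H.other d i hcd]
  rcases eq_or_ne i d with rfl | hd
  · rw [H.other c i hc, H.self, map_div₀, h1, H.other c i hc]
  · rw [H.other d i hd, H.other c i hc, H.other d i hd]

/-- The relation of independence has no cycle of length three in its complement. -/
theorem mem_free_of_cycle (H : FinReflSystem φ R) {x y z : Fin 3} (hxy : x ≠ y) (hyz : y ≠ z)
    (h1 : R y ∈ Free x) (h2 : R x ∈ Free z) (h3 : R x ∉ Free y) : R y ∈ Free z := by
  have h4 := H.map_eq_self hxy.symm (.inl h1)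
  have h5 := H.pd_map hyz.symm (R x)
  rw [h4, pd_eq_zero_of_mem_free h2, map_zero, zero_add, eq_comm, mul_eq_zero,
    div_eq_zero_iff] at h5
  rcases h5 with h5 | h5 | h5
  · exact absurd (H.indep _ _ ((map_eq_zero_iff _ (φ y).injective).mp h5)) h3
  · exact H.indep _ _ h5
  · exact absurd h5 (Xv_ne_zero y)

theorem exists_source (H : FinReflSystem φ R)
    (hno : ∀ c d, c ≠ d → R c ∈ Free d ∨ R d ∈ Free c) {T : Set (Fin 3)} (hT : T.Nonempty) :
    ∃ i ∈ T, ∀ j ∈ T, R j ∈ Free i := by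
  by_contra! hcon
  obtain ⟨i, hi⟩ := hT
  have key : ∀ {i j}, R j ∉ Free i → j ≠ i ∧ R i ∈ Free j := fun {i j} h => by
    have hne : j ≠ i := by rintro rfl; exact h (H.free j)
    exact ⟨hne, (hno j i hne).resolve_left h⟩
  obtain ⟨j, hj, hji⟩ := hcon i hi
  obtain ⟨k, hk, hkj⟩ := hcon j hj
  obtain ⟨m, hm, hmk⟩ := hcon k hk
  have h1 := key hji
  have h2 := key hkj
  have h3 := key hmk
  have hki : k ≠ i := by rintro rfl; exact hkj h1.2
  rcases eq_or_of_distinct h1.1 h2.1.symm hki.symm m with rfl | rfl | rfl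
  · exact hmk h2.2
  · exact hji (H.mem_free_of_cycle h2.1 h1.1 h2.2 h3.2 hkj)
  · exact h3.1 rfl

/-- The case of an abelian group. -/
theorem extractable_of_comm (H : FinReflSystem φ R)
    (hno : ∀ c d, c ≠ d → R c ∈ Free d ∨ R d ∈ Free c) {g : K ≃ₐ[ℚ] K}
    (hg : g ∈ Subgroup.closure (Set.range φ)) (hg1 : g ≠ 1) : Extractable g := by
  classical
  have hfix : ∀ k j, φ k (R j) = R j := fun k j => by
    rcases eq_or_ne k j with rfl | h
    · exact H.map_free (H.free k)
    · exact H.map_eq_self h (hno _ _ h)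
  have step : ∀ (x : K ≃ₐ[ℚ] K) (k : Fin 3),
      (∃ T : Set (Fin 3), (∀ j, x (Xv j) = if j ∈ T then R j / Xv j else Xv j) ∧
        ∀ j, x (R j) = R j) →
      ∃ T : Set (Fin 3), (∀ j, (x * φ k) (Xv j) = if j ∈ T then R j / Xv j else Xv j) ∧
        ∀ j, (x * φ k) (R j) = R j := by
    rintro x k ⟨T, hT, hx⟩
    refine ⟨{j | if j = k then j ∉ T else j ∈ T}, fun j => ?_, fun j => by
      rw [AlgEquiv.mul_apply, hfix, hx]⟩
    rw [AlgEquiv.mul_apply]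
    rcases eq_or_ne j k with rfl | hj
    · rw [H.self, map_div₀, hx, hT]
      have := H.ne_zero j
      have := Xv_ne_zero j
      by_cases hjT : j ∈ T
      · simp only [hjT, if_true, Set.mem_ofPred_eq, not_true, if_false]
        field_simp
      · simp [hjT]
    · rw [H.other k j hj, hT]
      simp [hj]
  obtain ⟨T, hT, -⟩ : ∃ T : Set (Fin 3), (∀ j, g (Xv j) = if j ∈ T then R j / Xv j else Xv j) ∧
      ∀ j, g (R j) = R j := by
    refine closure_induction_of_involutions
      (P := fun x => ∃ T : Set (Fin 3), (∀ j, x (Xv j) = if j ∈ T then R j / Xv j else Xv j) ∧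
        ∀ j, x (R j) = R j) (by rintro y ⟨j, rfl⟩; exact H.inv_eq _)
      ⟨∅, fun j => by simp, fun j => rfl⟩ (by rintro x _ ⟨k, rfl⟩; exact step x k) hg
  have hne : T.Nonempty := by
    by_contra h
    rw [Set.not_nonempty_iff_eq_empty] at h
    exact hg1 (K.algEquiv_ext fun i => by simp [hT, h])
  obtain ⟨i, hi, hall⟩ := H.exists_source hno hne
  refine ⟨i, fun j => if j = i then 1 else 0, ⟨i, by simp⟩, fun j => ?_⟩
  rw [hT]
  beta_reduce
  rcases eq_or_ne j i with rfl | hji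
  · rw [if_pos hi, if_pos rfl, pow_one, div_mul_cancel₀ _ (Xv_ne_zero j)]
    exact H.free j
  · rw [if_neg hji, pow_zero, mul_one]
    split_ifs with h
    · exact div_mem (hall j h) (Xv_mem_free hji)
    · exact Xv_mem_free hji

end FinReflSystem

namespace FinReflSystem

variable {φ : Fin 3 → K ≃ₐ[ℚ] K} {R : Fin 3 → K}

theorem inv_of_mem_range (H : FinReflSystem φ R) : ∀ y ∈ Set.range φ, y⁻¹ = y := by
  rintro _ ⟨j, rfl⟩; exact H.inv_eq j

theorem subFree_coeff (H : FinReflSystem φ R) {c d : Fin 3} {r : K} {n : ℤ}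
    (h : R c = r * Xv d ^ n) : SubFree r := by
  have : r = R c / Xv d ^ n := by
    rw [h, mul_div_cancel_right₀ _ (zpow_ne_zero _ (Xv_ne_zero d))]
  rw [this]
  exact (H.subFree c).div ((SubFree.X d).zpow n)

theorem isMat_of_mem_closure_pair (H : FinReflSystem φ R) {c d l : Fin 3} (h1 : c ≠ d)
    (h2 : c ≠ l) (h3 : d ≠ l) (hcd : R c ∉ Free d) (hdc : R d ∉ Free c) {w : K ≃ₐ[ℚ] K}
    (hw : w ∈ Subgroup.closure ({φ c, φ d} : Set (K ≃ₐ[ℚ] K))) (hw1 : w ≠ 1) :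
    (∀ u ∈ Free c ⊓ Free d, w u = u) ∧ ∃ A : ExpMat, A.HasNegColumn false ∧
      IsMat (Free c ⊓ Free d) c d l w A ∧ A.2.2 = (0, 0, 1) := by
  obtain ⟨e, he, r, t, hr, ht, hRc, hRd⟩ := H.pair h1 hcd hdc
  have hcl := isClosed_orbit_of_pair e he
  have hset : ({φ c, φ d} : Set (K ≃ₐ[ℚ] K)) =
      {ψ | ∃ j ∈ reflIndices false, ψ = φ (![c, d, l] j)} := by
    ext ψ; simp [reflIndices]
  rw [hset] at hw
  obtain ⟨hfix, A, hA, hmat, h001⟩ := exists_isMat_of_mem_closure H.toReflSystem h1 h2 h3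
    (b := false) inf_le_left inf_le_right (by simp)
    (N := ⟨e.1, 0, e.2, 0, 0, 0⟩) ⟨r, hr, H.subFree_coeff hRc, by simp [hRc]⟩
    ⟨t, ht, H.subFree_coeff hRd, by simp [hRd]⟩ (by simp) hcl hw
  rcases (hcl.2 A hA).1 with rfl | hneg
  · rw [← hset] at hw
    obtain ⟨n, hn, hn'⟩ := H.fin w (Subgroup.closure_mono (by
      rintro _ (rfl | rfl) <;> exact ⟨_, rfl⟩) hw)
    exact absurd (eq_one_of_isMat_id_of_pair h1 h2 h3 hn hn' hfix hmat) hw1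
  · exact ⟨hfix, A, hneg, hmat, h001 rfl⟩

theorem mem_closure_eq_or (H : FinReflSystem φ R) {c d l : Fin 3} (h1 : c ≠ d) (h2 : c ≠ l)
    (h3 : d ≠ l) (hc : φ l * φ c = φ c * φ l) (hd : φ l * φ d = φ d * φ l) {g : K ≃ₐ[ℚ] K}
    (hg : g ∈ Subgroup.closure (Set.range φ)) :
    ∃ w ∈ Subgroup.closure ({φ c, φ d} : Set (K ≃ₐ[ℚ] K)), g = w ∨ g = w * φ l := by
  refine closure_induction_of_involutions
    (P := fun g => ∃ w ∈ Subgroup.closure ({φ c, φ d} : Set (K ≃ₐ[ℚ] K)), g = w ∨ g = w * φ l)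
    H.inv_of_mem_range ⟨1, one_mem _, .inl rfl⟩ ?_ hg
  have hc' : φ c ∈ Subgroup.closure ({φ c, φ d} : Set (K ≃ₐ[ℚ] K)) :=
    Subgroup.subset_closure (by simp)
  have hd' : φ d ∈ Subgroup.closure ({φ c, φ d} : Set (K ≃ₐ[ℚ] K)) :=
    Subgroup.subset_closure (by simp)
  rintro x _ ⟨k, rfl⟩ ⟨w, hw, rfl | rfl⟩
  · rcases eq_or_of_distinct h1 h2 h3 k with rfl | rfl | rfl
    · exact ⟨_, mul_mem hw hc', .inl rfl⟩
    · exact ⟨_, mul_mem hw hd', .inl rfl⟩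
    · exact ⟨_, hw, .inr rfl⟩
  · rcases eq_or_of_distinct h1 h2 h3 k with rfl | rfl | rfl
    · exact ⟨_, mul_mem hw hc', .inr (by rw [mul_assoc, hc, mul_assoc])⟩
    · exact ⟨_, mul_mem hw hd', .inr (by rw [mul_assoc, hd, mul_assoc])⟩
    · exact ⟨_, hw, .inl (by rw [mul_assoc, H.mul_self, mul_one])⟩

theorem mem_free_of_map_eq (H : FinReflSystem φ R) {c d l : Fin 3} (h1 : c ≠ d) (h2 : c ≠ l)
    (h3 : d ≠ l) {r : K} {n : ℤ} (hRc : R c = r * Xv d ^ n) (hrc : r ∈ Free c) (hrd : r ∈ Free d)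
    (hfix : φ l r = r) {i : Fin 3} (hi : R l ∉ Free i) : R c ∈ Free l := by
  have hil : i ≠ l := by rintro rfl; exact hi (H.free i)
  have hr : pd l r = 0 := H.pd_eq_zero_of_map_eq hil (fun j hj => by
    rcases eq_or_of_distinct h1 h2 h3 j with rfl | rfl | rfl
    exacts [pd_eq_zero_of_mem_free hrc, pd_eq_zero_of_mem_free hrd, absurd rfl hj]) hfix hi
  refine H.indep _ _ ?_
  rw [hRc, (isDer_pd l).mul, hr, pd_eq_zero_of_mem_free (zpow_mem (Xv_mem_free h3) n)]
  simp

/-- The case of exactly one pair of reflections which do not commute. -/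
theorem extractable_of_pair (H : FinReflSystem φ R) {c d l : Fin 3} (h1 : c ≠ d)
    (h2 : c ≠ l) (h3 : d ≠ l) (hcd : R c ∉ Free d) (hdc : R d ∉ Free c)
    (hcl : R c ∈ Free l ∨ R l ∈ Free c) (hdl : R d ∈ Free l ∨ R l ∈ Free d) {g : K ≃ₐ[ℚ] K}
    (hg : g ∈ Subgroup.closure (Set.range φ)) (hg1 : g ≠ 1) : Extractable g := by
  obtain ⟨w, hw, hgw⟩ := H.mem_closure_eq_or h1 h2 h3 (H.comm h2.symm hcl.symm)
    (H.comm h3.symm hdl.symm) hg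
  have hmat := H.isMat_of_mem_closure_pair h1 h2 h3 hcd hdc hw
  have hfixc := H.map_eq_self h2.symm hcl.symm
  have hfixd := H.map_eq_self h3.symm hdl.symm
  by_cases hbot : R l ∈ Free c ⊓ Free d
  · have hgen : w ≠ 1 → Extractable g := by
      intro hw1
      obtain ⟨hfix, A, hneg, hA, h001⟩ := hmat hw1
      refine IsMat.extractable h1 h2 h3 (L := Free c ⊓ Free d) inf_le_left inf_le_right (by simp)
        (A := A) ?_ hneg
      rcases hgw with rfl | rfl
      · exact hA
      · refine ⟨?_, ?_, ?_⟩
        · rw [AlgEquiv.mul_apply, H.other l c h2]; exact hA.1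
        · rw [AlgEquiv.mul_apply, H.other l d h3]; exact hA.2.1
        · have hXl : Xv l ∈ Free c ⊓ Free d := ⟨Xv_mem_free h2.symm, Xv_mem_free h3.symm⟩
          rw [AlgEquiv.mul_apply, H.self, map_div₀, hfix _ hbot, hfix _ hXl, h001]
          refine ⟨R l / Xv l / Xv l, div_mem (div_mem hbot hXl) hXl,
            ((H.subFree l).div (.X l)).div (.X l), ?_⟩
          have := Xv_ne_zero l
          field_simp
          simp
    by_cases hw1 : w = 1
    · have hgl : g = φ l := by
        rcases hgw with h | h
        · exact absurd (h.trans hw1) hg1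
        · rw [h, hw1, one_mul]
      rw [hgl]
      refine extractable_of_forall h1 h2 h3 l 0 0 1 (by simp) ?_ ?_ ?_
      · rw [H.other l c h2, pow_zero, mul_one]; exact Xv_mem_free h2
      · rw [H.other l d h3, pow_zero, mul_one]; exact Xv_mem_free h3
      · rw [H.self, pow_one, div_mul_cancel₀ _ (Xv_ne_zero l)]; exact H.free l
    · exact hgen hw1
  · obtain ⟨i, hi⟩ : ∃ i, R l ∉ Free i := by
      by_contra! hcon
      exact hbot ⟨hcon c, hcon d⟩
    obtain ⟨e, -, r, t, hr, ht, hRc, hRd⟩ := H.pair h1 hcd hdc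
    have hcancel : ∀ {x r : K} {j : Fin 3} {n : ℤ}, j ≠ l → x = r * Xv j ^ n → φ l x = x →
        φ l r = r := by
      intro x r j n hj hx hfx
      rw [hx, map_mul, map_zpow₀, H.other l j hj] at hfx
      exact mul_right_cancel₀ (zpow_ne_zero _ (Xv_ne_zero j)) hfx
    have hcfree : R c ∈ Free l :=
      H.mem_free_of_map_eq h1 h2 h3 hRc hr.1 hr.2 (hcancel h3 hRc hfixc) hi
    have hdfree : R d ∈ Free l :=
      H.mem_free_of_map_eq h1.symm h3 h2 hRd ht.2 ht.1 (hcancel h2 hRd hfixd) hi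
    rcases hgw with rfl | rfl
    · obtain ⟨-, A, hneg, hA, -⟩ := hmat hg1
      exact hA.extractable h1 h2 h3 inf_le_left inf_le_right (by simp) hneg
    · have hwl : (∀ f ∈ Free l, w f ∈ Free l) ∧ w (Xv l) = Xv l := by
        refine closure_induction_of_involutions
          (P := fun w => (∀ f ∈ Free l, w f ∈ Free l) ∧ w (Xv l) = Xv l)
          (by rintro y (rfl | rfl) <;> exact H.inv_eq _) ⟨fun f hf => hf, rfl⟩ ?_ hw
        rintro x y (rfl | rfl) ⟨ih, ih'⟩
        · exact ⟨fun f hf => ih _ (H.map_mem_free h2 hcfree hf), by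
            rw [AlgEquiv.mul_apply, H.other c l h2.symm, ih']⟩
        · exact ⟨fun f hf => ih _ (H.map_mem_free h3 hdfree hf), by
            rw [AlgEquiv.mul_apply, H.other d l h3.symm, ih']⟩
      refine extractable_of_forall h1 h2 h3 l 0 0 1 (by simp) ?_ ?_ ?_
      · rw [AlgEquiv.mul_apply, H.other l c h2, pow_zero, mul_one]; exact hwl.1 _ (Xv_mem_free h2)
      · rw [AlgEquiv.mul_apply, H.other l d h3, pow_zero, mul_one]; exact hwl.1 _ (Xv_mem_free h3)
      · rw [AlgEquiv.mul_apply, H.self, map_div₀, hwl.2, pow_one,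
          div_mul_cancel₀ _ (Xv_ne_zero l)]
        exact hwl.1 _ (H.free l)

end FinReflSystem

namespace FinReflSystem

variable {φ : Fin 3 → K ≃ₐ[ℚ] K} {R : Fin 3 → K}

theorem map_const (H : FinReflSystem φ R) {g : K ≃ₐ[ℚ] K}
    (hg : g ∈ Subgroup.closure (Set.range φ)) {u : K} (hu : ∀ j, u ∈ Free j) : g u = u := by
  refine closure_induction_of_involutions (P := fun g : K ≃ₐ[ℚ] K => g u = u)
    H.inv_of_mem_range rfl ?_ hg
  rintro x _ ⟨k, rfl⟩ ih
  rw [AlgEquiv.mul_apply, H.map_free (hu k), ih]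

/-- A linear functional of the valuation. -/
def weight (w : LexExp →+ ℤ) (g : K ≃ₐ[ℚ] K) (j : Fin 3) : ℤ := w (val 1 (g (Xv j)))

theorem weight_mul_of_ne (H : FinReflSystem φ R) (w : LexExp →+ ℤ) (g : K ≃ₐ[ℚ] K) {i j : Fin 3}
    (h : j ≠ i) : weight w (g * φ i) j = weight w g j := by
  rw [weight, AlgEquiv.mul_apply, H.other i j h, weight]

theorem weight_mul_self (H : FinReflSystem φ R) (w : LexExp →+ ℤ) {g : K ≃ₐ[ℚ] K}
    (hg : g ∈ Subgroup.closure (Set.range φ)) {c d l : Fin 3} (h1 : c ≠ d) (h2 : c ≠ l)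
    (h3 : d ≠ l) {i : Fin 3} {p : Row} (hR : IsRow (Free c ⊓ Free d ⊓ Free l) c d l (R i) p) :
    weight w (g * φ i) i = p.1 * weight w g c + p.2.1 * weight w g d + p.2.2 * weight w g l
      - weight w g i := by
  obtain ⟨u, huL, hu, he⟩ := hR
  have huall : ∀ j, u ∈ Free j := fun j => by
    rcases eq_or_of_distinct h1 h2 h3 j with rfl | rfl | rfl
    exacts [huL.1.1, huL.1.2, huL.2]
  have hne : ∀ j, g (Xv j) ≠ 0 := fun j => by simpa using Xv_ne_zero j
  rw [weight, AlgEquiv.mul_apply, H.self, he]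
  simp only [map_div₀, map_mul, map_zpow₀, H.map_const hg huall]
  have hz : ∀ j n, g (Xv j) ^ (n : ℤ) ≠ 0 := fun j n => zpow_ne_zero _ (hne j)
  rw [val_div (mul_ne_zero hu.ne_zero (mul_ne_zero (mul_ne_zero (hz _ _) (hz _ _)) (hz _ _)))
    (hne i), val_mul hu.ne_zero (mul_ne_zero (mul_ne_zero (hz _ _) (hz _ _)) (hz _ _)),
    val_mul (mul_ne_zero (hz _ _) (hz _ _)) (hz _ _), val_mul (hz _ _) (hz _ _),
    val_zpow (hne _), val_zpow (hne _), val_zpow (hne _),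
    val_eq_zero_of_mem_free 1 hu.ne_zero huall]
  rw [map_sub, map_add, map_add, map_add, map_zsmul, map_zsmul, map_zsmul, map_zero]
  simp only [weight, smul_eq_mul]
  ring

theorem weight_one (w : LexExp →+ ℤ) (j : Fin 3) : weight w 1 j = w (expBasis j) := by
  rw [weight, AlgEquiv.one_apply, val_Xv]; rfl

/-- Three pairwise non-commuting reflections generate an infinite group. -/
theorem false_of_triangle (H : FinReflSystem φ R) {c d l : Fin 3} (h1 : c ≠ d) (h2 : c ≠ l)
    (h3 : d ≠ l) {N : Exponents}
    (hc : IsRow (Free c ⊓ Free d ⊓ Free l) c d l (R c) (0, N.cd, N.cl))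
    (hd : IsRow (Free c ⊓ Free d ⊓ Free l) c d l (R d) (N.dc, 0, N.dl))
    (hl : IsRow (Free c ⊓ Free d ⊓ Free l) c d l (R l) (N.lc, N.ld, 0))
    (hN : 0 < N.cd ∧ 0 < N.cl ∧ 0 < N.dc ∧ 0 < N.dl ∧ 0 < N.lc ∧ 0 < N.ld) : False := by
  let w : LexExp →+ ℤ := expCoord c + (2 : ℕ) • expCoord d + (3 : ℕ) • expCoord l
  have hw : ∀ j, w (expBasis j) = (if c = j then 1 else 0) + 2 * (if d = j then 1 else 0) +
      3 * (if l = j then 1 else 0) := fun j => by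
    simp only [w, AddMonoidHom.add_apply, AddMonoidHom.nsmul_apply, expCoord_expBasis, nsmul_eq_mul]
    norm_num
  set p := φ c * φ d * φ l with hp
  have hmem : ∀ k : ℕ, p ^ k ∈ Subgroup.closure (Set.range φ) := fun k =>
    pow_mem (mul_mem (mul_mem (gen_mem c) (gen_mem d)) (gen_mem l)) k
  have key : ∀ k : ℕ, (k : ℤ) < weight w (p ^ k) c ∧ weight w (p ^ k) c < weight w (p ^ k) d ∧
      weight w (p ^ k) d < weight w (p ^ k) l := by
    intro k
    induction k with
    | zero =>
      simp only [pow_zero, weight_one, hw]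
      simp [h1, h1.symm, h2, h2.symm, h3, h3.symm]
    | succ k ih =>
      have e : p ^ (k + 1) = p ^ k * φ c * φ d * φ l := by rw [pow_succ, hp]; group
      have m1 := mul_mem (hmem k) (gen_mem (φ := φ) c)
      have m2 := mul_mem m1 (gen_mem (φ := φ) d)
      rw [e, H.weight_mul_self w m2 h1 h2 h3 hl, H.weight_mul_of_ne w _ h2,
        H.weight_mul_of_ne w _ h3, H.weight_mul_self w m1 h1 h2 h3 hd, H.weight_mul_of_ne w _ h1,
        H.weight_mul_of_ne w _ h3.symm, H.weight_mul_self w (hmem k) h1 h2 h3 hc,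
        H.weight_mul_of_ne w _ h1.symm, H.weight_mul_of_ne w _ h2.symm]
      obtain ⟨a1, a2, a3⟩ := ih
      obtain ⟨b1, b2, b3, b4, b5, b6⟩ := hN
      generalize weight w (p ^ k) c = x at *
      generalize weight w (p ^ k) d = y at *
      generalize weight w (p ^ k) l = z at *
      have step : ∀ (x y z n m : ℤ), 0 < x → x < y → y < z → 0 < n → 0 < m →
          z < n * y + m * z - x := fun x y z n m _ _ _ _ _ => by nlinarith
      have s1 := step x y z N.cd N.cl (by omega) a2 a3 b1 b2
      set x' := N.cd * y + N.cl * z - x with hx'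
      have s2 := step y z x' N.dl N.dc (by omega) a3 s1 b4 b3
      set y' := N.dl * z + N.dc * x' - y with hy'
      have s3 := step z x' y' N.lc N.ld (by omega) s1 s2 b5 b6
      have e1 : 0 * x + N.cd * y + N.cl * z - x = x' := by rw [hx']; ring
      have e2 : N.dc * x' + 0 * y + N.dl * z - y = y' := by rw [hy']; ring
      rw [e1, e2]
      refine ⟨?_, s2, ?_⟩
      · push_cast; omega
      · linarith
  obtain ⟨n, hn, hn'⟩ := H.fin p (by simpa using hmem 1)
  have h4 := (key n).1
  rw [hn', weight_one, hw] at h4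
  simp [h1.symm, h2.symm] at h4
  omega

/-- Two adjacent pairs of reflections whose products both have order four generate an infinite
group. -/
theorem false_of_path (H : FinReflSystem φ R) {c d l : Fin 3} (h1 : c ≠ d) (h2 : c ≠ l)
    (h3 : d ≠ l) {a a' b b' : ℤ}
    (hc : IsRow (Free c ⊓ Free d ⊓ Free l) c d l (R c) (0, a, 0))
    (hd : IsRow (Free c ⊓ Free d ⊓ Free l) c d l (R d) (a', 0, b))
    (hl : IsRow (Free c ⊓ Free d ⊓ Free l) c d l (R l) (0, b', 0))
    (ha : a * a' = 2) (hb : b * b' = 2) : False := by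
  have hw : ∀ j, expCoord d (expBasis j) = if d = j then 1 else 0 := fun j => expCoord_expBasis _ _
  set w := expCoord d
  set p := φ c * φ l * φ d with hp
  have hmem : ∀ k : ℕ, p ^ k ∈ Subgroup.closure (Set.range φ) := fun k =>
    pow_mem (mul_mem (mul_mem (gen_mem c) (gen_mem l)) (gen_mem d)) k
  have key : ∀ k : ℕ, weight w (p ^ k) d = 1 + 2 * k ∧
      a' * weight w (p ^ k) c + b * weight w (p ^ k) l = 2 * weight w (p ^ k) d - 2 := by
    intro k
    induction k with
    | zero =>
      simp only [pow_zero, weight_one, hw]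
      simp [h1.symm, h3]
    | succ k ih =>
      have e : p ^ (k + 1) = p ^ k * φ c * φ l * φ d := by rw [pow_succ, hp]; group
      have m1 := mul_mem (hmem k) (gen_mem (φ := φ) c)
      have m2 := mul_mem m1 (gen_mem (φ := φ) l)
      rw [e, H.weight_mul_self w m2 h1 h2 h3 hd, H.weight_mul_of_ne w _ h1,
        H.weight_mul_of_ne w _ h3.symm, H.weight_mul_self w m1 h1 h2 h3 hl,
        H.weight_mul_of_ne w _ h2, H.weight_mul_of_ne w _ h3, H.weight_mul_of_ne w _ h1.symm,
        H.weight_mul_of_ne w _ h2.symm, H.weight_mul_self w (hmem k) h1 h2 h3 hc]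
      obtain ⟨a1, a2⟩ := ih
      generalize weight w (p ^ k) c = x at *
      generalize weight w (p ^ k) d = y at *
      generalize weight w (p ^ k) l = z at *
      push_cast
      constructor
      · linear_combination a1 * (a * a' + b * b' - 3) - a2 + 2 * ha * (k : ℤ) + ha + hb + 2 * hb * (k : ℤ)
      · linear_combination a2 - y * ha - y * hb
  obtain ⟨n, hn, hn'⟩ := H.fin p (by simpa using hmem 1)
  have h4 := (key n).1
  rw [hn', weight_one, hw, if_pos rfl] at h4
  omega

/-- Adjacent pairs of non-commuting reflections are monomial. -/
theorem isRow_center (H : FinReflSystem φ R) {c d l : Fin 3} (h2 : c ≠ l)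
    {t t' : K} {m n : ℤ} (ht : t ∈ Free c ∧ t ∈ Free d)
    (ht' : t' ∈ Free d ∧ t' ∈ Free l) (h : R d = t * Xv c ^ m) (h' : R d = t' * Xv l ^ n)
    (h3 : d ≠ l) :
    ∃ u ∈ Free c ⊓ Free d ⊓ Free l, SubFree u ∧ R d = u * (Xv c ^ m * Xv l ^ n) := by
  have hc := zpow_ne_zero m (Xv_ne_zero c)
  have hl := zpow_ne_zero n (Xv_ne_zero l)
  have e1 : R d / (Xv c ^ m * Xv l ^ n) = t / Xv l ^ n := by rw [h]; field_simp
  have e2 : R d / (Xv c ^ m * Xv l ^ n) = t' / Xv c ^ m := by rw [h']; field_simp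
  refine ⟨R d / (Xv c ^ m * Xv l ^ n), ⟨⟨?_, ?_⟩, ?_⟩,
    (H.subFree d).div (((SubFree.X c).zpow m).mul ((SubFree.X l).zpow n)), by field_simp⟩
  · rw [e1]; exact div_mem ht.1 (zpow_mem (Xv_mem_free h2.symm) _)
  · rw [e1]; exact div_mem ht.2 (zpow_mem (Xv_mem_free h3.symm) _)
  · rw [e2]; exact div_mem ht'.2 (zpow_mem (Xv_mem_free h2) _)

/-- The case of at least two pairs of reflections which do not commute. -/
theorem extractable_of_path (H : FinReflSystem φ R) {c d l : Fin 3} (h1 : c ≠ d)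
    (h2 : c ≠ l) (h3 : d ≠ l) (hcd : R c ∉ Free d) (hdc : R d ∉ Free c) (hdl : R d ∉ Free l)
    (hld : R l ∉ Free d) {g : K ≃ₐ[ℚ] K} (hg : g ∈ Subgroup.closure (Set.range φ))
    (hg1 : g ≠ 1) : Extractable g := by
  obtain ⟨e, he, r, t, hr, ht, hRc, hRd⟩ := H.pair h1 hcd hdc
  obtain ⟨f, hf, t', s, ht', hs, hRd', hRl⟩ := H.pair h3 hdl hld
  obtain ⟨u, huL, hu, hRu⟩ := H.isRow_center h2 ht ht' hRd hRd' h3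
  have hrowd : IsRow (Free c ⊓ Free d ⊓ Free l) c d l (R d) (e.2, 0, f.1) :=
    ⟨u, huL, hu, by simp [hRu]⟩
  by_cases hcl : R c ∉ Free l ∧ R l ∉ Free c
  · exfalso
    obtain ⟨k, hk, r', s', hr', hs', hRc', hRl'⟩ := H.pair h2 hcl.1 hcl.2
    obtain ⟨v, hvL, hv, hRv⟩ := H.isRow_center h3 ⟨hr.2, hr.1⟩ hr' hRc hRc' h2
    obtain ⟨y, hyL, hy, hRy⟩ := H.isRow_center h1 ⟨hs'.1, hs'.2⟩ ⟨hs.2, hs.1⟩ hRl' hRl h3.symm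
    have hpos : ∀ e ∈ ([(1, 1), (1, 2), (2, 1)] : List (ℤ × ℤ)), 0 < e.1 ∧ 0 < e.2 := by decide
    exact H.false_of_triangle h1 h2 h3 (N := ⟨e.1, k.1, e.2, f.1, k.2, f.2⟩)
      ⟨v, ⟨⟨hvL.1.2, hvL.1.1⟩, hvL.2⟩, hv, by simp [hRv]⟩ hrowd
      ⟨y, ⟨⟨hyL.1.1, hyL.2⟩, hyL.1.2⟩, hy, by simp [hRy]⟩
      ⟨(hpos e he).1, (hpos k hk).1, (hpos e he).2, (hpos f hf).1, (hpos k hk).2, (hpos f hf).2⟩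
  · have hcl' : R c ∈ Free l ∨ R l ∈ Free c :=
      (not_and_or.mp hcl).imp not_not.mp not_not.mp
    have hcancel : ∀ {i : Fin 3} {x r : K} {j : Fin 3} {n : ℤ}, j ≠ i → x = r * Xv j ^ n →
        φ i x = x → φ i r = r := by
      intro i x r j n hj hx hfx
      rw [hx, map_mul, map_zpow₀, H.other i j hj] at hfx
      exact mul_right_cancel₀ (zpow_ne_zero _ (Xv_ne_zero j)) hfx
    have hfc := hcancel h3 hRc (H.map_eq_self h2.symm hcl'.symm)
    have hfl := hcancel h1.symm hRl (H.map_eq_self h2 hcl')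
    have hclf : R c ∈ Free l := H.mem_free_of_map_eq h1 h2 h3 hRc hr.1 hr.2 hfc hld
    have hlcf : R l ∈ Free c :=
      H.mem_free_of_map_eq h3.symm h2.symm h1.symm hRl hs.2 hs.1 hfl hcd
    have hcoef : ∀ {i j k : Fin 3} {x r : K} {n : ℤ}, j ≠ k → x = r * Xv j ^ n → x ∈ Free k →
        r ∈ Free k := by
      intro i j k x r n hjk hx hxk
      have : r = x / Xv j ^ n := by
        rw [hx, mul_div_cancel_right₀ _ (zpow_ne_zero _ (Xv_ne_zero j))]
      rw [this]
      exact div_mem hxk (zpow_mem (Xv_mem_free hjk) _)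
    have hrowc : IsRow (Free c ⊓ Free d ⊓ Free l) c d l (R c) (0, e.1, 0) :=
      ⟨r, ⟨hr, hcoef (i := c) h3 hRc hclf⟩, H.subFree_coeff hRc, by simp [hRc]⟩
    have hrowl : IsRow (Free c ⊓ Free d ⊓ Free l) c d l (R l) (0, f.2, 0) :=
      ⟨s, ⟨⟨hcoef (i := c) h1.symm hRl hlcf, hs.1⟩, hs.2⟩, H.subFree_coeff hRl, by simp [hRl]⟩
    by_cases hfinite : e.1 * e.2 = 1 ∨ f.1 * f.2 = 1
    · have hclosed := isClosed_orbit_of_path e he f hf hfinite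
      have hset : Set.range φ = {ψ | ∃ j ∈ reflIndices true, ψ = φ (![c, d, l] j)} := by
        ext ψ
        constructor
        · rintro ⟨k, rfl⟩
          rcases eq_or_of_distinct h1 h2 h3 k with rfl | rfl | rfl
          exacts [⟨0, by simp [reflIndices], rfl⟩, ⟨1, by simp [reflIndices], rfl⟩,
            ⟨2, by simp [reflIndices], rfl⟩]
        · rintro ⟨j, -, rfl⟩
          exact ⟨_, rfl⟩
      obtain ⟨n, hn, hn'⟩ := H.fin g hg
      rw [hset] at hg
      obtain ⟨-, A, hA, hmat, -⟩ := exists_isMat_of_mem_closure H.toReflSystem h1 h2 h3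
        (b := true) (L := Free c ⊓ Free d ⊓ Free l) (inf_le_left.trans inf_le_left)
        (inf_le_left.trans inf_le_right) (fun _ => inf_le_right)
        (N := ⟨e.1, 0, e.2, f.1, 0, f.2⟩) hrowc hrowd (fun _ => hrowl) hclosed hg
      rcases (hclosed.2 A hA).1 with rfl | hneg
      · exact absurd (eq_one_of_isMat_id_of_const h1 h2 h3 hn hn' hmat) hg1
      · exact hmat.extractable h1 h2 h3 (inf_le_left.trans inf_le_left)
          (inf_le_left.trans inf_le_right) (fun _ => inf_le_right) hneg
    · exfalso
      have hprod : ∀ e ∈ ([(1, 1), (1, 2), (2, 1)] : List (ℤ × ℤ)),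
          e.1 * e.2 = 1 ∨ e.1 * e.2 = 2 := by decide
      rw [not_or] at hfinite
      exact H.false_of_path h1 h2 h3 hrowc hrowd hrowl ((hprod e he).resolve_left hfinite.1)
        ((hprod f hf).resolve_left hfinite.2)

/-- Every nontrivial element of a finite reflection group is extractable. -/
theorem extractable (H : FinReflSystem φ R) {g : K ≃ₐ[ℚ] K}
    (hg : g ∈ Subgroup.closure (Set.range φ)) (hg1 : g ≠ 1) : Extractable g := by
  by_cases hno : ∀ c d, c ≠ d → R c ∈ Free d ∨ R d ∈ Free c
  · exact H.extractable_of_comm hno hg hg1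
  push Not at hno
  obtain ⟨c, d, h1, hcd, hdc⟩ := hno
  obtain ⟨l, h2, h3⟩ := exists_distinct h1
  by_cases hdl : R d ∈ Free l ∨ R l ∈ Free d
  · by_cases hcl : R c ∈ Free l ∨ R l ∈ Free c
    · exact H.extractable_of_pair h1 h2 h3 hcd hdc hcl hdl hg hg1
    · rw [not_or] at hcl
      exact H.extractable_of_path h1.symm h3 h2 hdc hcd hcl.1 hcl.2 hg hg1
  · rw [not_or] at hdl
    exact H.extractable_of_path h1 h2 h3 hcd hdc hdl.1 hdl.2 hg hg1

end FinReflSystem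

section Lipshitz

variable {A 𝓡 : Type*} [CommRing A] [CommRing 𝓡] {n : ℕ}

theorem MvPolynomial.totalDegree_pderiv_le {σ : Type*} (i : σ) (p : MvPolynomial σ A) :
    (MvPolynomial.pderiv i p).totalDegree ≤ p.totalDegree := by
  classical
  rw [p.as_sum, map_sum]
  refine (MvPolynomial.totalDegree_finsetSum _ _).trans (Finset.sup_le fun e he => ?_)
  rw [← p.as_sum, MvPolynomial.pderiv_monomial]
  refine (MvPolynomial.totalDegree_monomial_le _ _).trans ?_
  refine le_trans ?_ (MvPolynomial.le_totalDegree he)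
  exact (Finsupp.degree_mono (tsub_le_self : e - _ ≤ e))

/-- Derivations of a ring which restrict to the partial derivatives on a polynomial subring. -/
structure PartialDerivations (j : A →+* 𝓡) (X : Fin n → 𝓡) (D : Fin n → 𝓡 →+ 𝓡) : Prop where
  leibniz : ∀ i f g, D i (f * g) = f * D i g + D i f * g
  const : ∀ i a, D i (j a) = 0
  var : ∀ i k, D i (X k) = if k = i then 1 else 0

namespace PartialDerivations

variable {j : A →+* 𝓡} {X : Fin n → 𝓡} {D : Fin n → 𝓡 →+ 𝓡}

theorem map_eval₂ (H : PartialDerivations j X D) (i : Fin n) (p : MvPolynomial (Fin n) A) :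
    D i (p.eval₂ j X) = (MvPolynomial.pderiv i p).eval₂ j X := by
  induction p using MvPolynomial.induction_on with
  | C a => simp [H.const]
  | add p q hp hq => simp [hp, hq]
  | mul_X p k hp =>
    rw [MvPolynomial.eval₂_mul, H.leibniz, hp, MvPolynomial.eval₂_X, H.var, Derivation.leibniz,
      MvPolynomial.pderiv_X]
    simp only [smul_eq_mul, MvPolynomial.eval₂_add, MvPolynomial.eval₂_mul, MvPolynomial.eval₂_X]
    rcases eq_or_ne k i with rfl | h
    · simp; ring
    · simp [h]; ring

theorem map_pow (H : PartialDerivations j X D) (i : Fin n) (f : 𝓡) (s : ℕ) :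
    D i (f ^ (s + 1)) = (s + 1 : ℕ) * f ^ s * D i f := by
  induction s with
  | zero => simp
  | succ s ih => rw [pow_succ, H.leibniz, ih]; push_cast; ring

/-- `f` becomes a polynomial of degree at most `d (s + 1)` after multiplication by `Q ^ (s + 1)`. -/
def Bounded (j : A →+* 𝓡) (X : Fin n → 𝓡) (Q : MvPolynomial (Fin n) A) (d s : ℕ) (f : 𝓡) : Prop :=
  ∃ p : MvPolynomial (Fin n) A, p.totalDegree ≤ d * (s + 1) ∧
    (Q.eval₂ j X) ^ (s + 1) * f = p.eval₂ j X

variable {Q : MvPolynomial (Fin n) A} {d : ℕ}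

theorem Bounded.succ (hQ : Q.totalDegree ≤ d) {s : ℕ} {f : 𝓡} (h : Bounded j X Q d s f) :
    Bounded j X Q d (s + 1) f := by
  obtain ⟨p, hp, h⟩ := h
  refine ⟨Q * p, (MvPolynomial.totalDegree_mul _ _).trans ?_, ?_⟩
  · calc _ ≤ d + d * (s + 1) := by gcongr
      _ = _ := by ring
  · rw [pow_succ', mul_assoc, h, MvPolynomial.eval₂_mul]

theorem Bounded.mono (hQ : Q.totalDegree ≤ d) {s s' : ℕ} (hs : s ≤ s') {f : 𝓡}
    (h : Bounded j X Q d s f) : Bounded j X Q d s' f :=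
  Nat.le_induction h (fun _ _ ih => ih.succ hQ) s' hs

theorem bounded_map (H : PartialDerivations j X D) (hQ : Q.totalDegree ≤ d) (i : Fin n) {s : ℕ} {f : 𝓡}
    (h : Bounded j X Q d s f) : Bounded j X Q d (s + 1) (D i f) := by
  obtain ⟨p, hp, h⟩ := h
  refine ⟨Q * MvPolynomial.pderiv i p - ((s + 1 : ℕ) : MvPolynomial (Fin n) A) *
    (MvPolynomial.pderiv i Q * p), ?_, ?_⟩
  · have h0 : ∀ q : MvPolynomial (Fin n) A, q.totalDegree ≤ d → ∀ r : MvPolynomial (Fin n) A,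
        r.totalDegree ≤ d * (s + 1) → (q * r).totalDegree ≤ d * (s + 1 + 1) := by
      intro q hq r hr
      refine (MvPolynomial.totalDegree_mul _ _).trans ?_
      calc _ ≤ d + d * (s + 1) := by gcongr
        _ = _ := by ring
    refine (MvPolynomial.totalDegree_sub _ _).trans (max_le ?_ ?_)
    · exact h0 _ hQ _ ((MvPolynomial.totalDegree_pderiv_le _ _).trans hp)
    · refine (MvPolynomial.totalDegree_mul _ _).trans ?_
      rw [← map_natCast MvPolynomial.C, MvPolynomial.totalDegree_C, zero_add]
      exact h0 _ ((MvPolynomial.totalDegree_pderiv_le _ _).trans hQ) _ hp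
  · have h1 := congrArg (D i) h
    rw [H.leibniz, H.map_pow, H.map_eval₂, H.map_eval₂] at h1
    rw [MvPolynomial.eval₂_sub, MvPolynomial.eval₂_mul, MvPolynomial.eval₂_mul,
      MvPolynomial.eval₂_mul, ← h1, ← h, MvPolynomial.eval₂_natCast]
    ring

theorem bounded_iterate (H : PartialDerivations j X D) (hQ : Q.totalDegree ≤ d) (i : Fin n) (k : ℕ)
    {s : ℕ} {f : 𝓡} (h : Bounded j X Q d s f) : Bounded j X Q d (s + k) ((D i)^[k] f) := by
  induction k with
  | zero => exact h
  | succ k ih =>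
    rw [Function.iterate_succ_apply']
    exact H.bounded_map hQ i ih

end PartialDerivations

/-- Polynomials of bounded degree are linearly dependent when there are too many of them. -/
theorem MvPolynomial.exists_sum_eq_zero_of_card_lt [Nontrivial A] {ι : Type*} [Fintype ι] {N : ℕ}
    (p : ι → MvPolynomial (Fin n) A) (hp : ∀ k, (p k).totalDegree ≤ N)
    (hcard : (N + 1) ^ n < Fintype.card ι) :
    ∃ a : ι → A, a ≠ 0 ∧ ∑ k, MvPolynomial.C (a k) * p k = 0 := by
  let v : ι → (Fin n → Fin (N + 1)) → A := fun k e =>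
    (p k).coeff (Finsupp.equivFunOnFinite.symm fun i => (e i : ℕ))
  have hv : ¬ LinearIndependent A v := by
    intro h
    have := h.fintype_card_le_finrank
    rw [Module.finrank_pi, Fintype.card_fun, Fintype.card_fin, Fintype.card_fin] at this
    omega
  obtain ⟨a, ha, k, hk⟩ := Fintype.not_linearIndependent_iff.mp hv
  refine ⟨a, fun h => hk (congrFun h k), ?_⟩
  ext e
  rw [MvPolynomial.coeff_sum]
  simp_rw [MvPolynomial.coeff_C_mul, MvPolynomial.coeff_zero]
  by_cases he : ∀ i, e i < N + 1
  · have := congrFun ha fun i => ⟨e i, he i⟩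
    simp only [Finset.sum_apply, Pi.smul_apply, smul_eq_mul, Pi.zero_apply, v] at this
    convert this using 4
    ext i; simp
  · push Not at he
    obtain ⟨i, hi⟩ := he
    refine Finset.sum_eq_zero fun k _ => ?_
    rw [MvPolynomial.coeff_eq_zero_of_totalDegree_lt, mul_zero]
    have h1 := hp k
    have h2 : e i ≤ ∑ i ∈ e.support, e i := by
      refine Finset.single_le_sum (f := fun i => e i) (fun _ _ => Nat.zero_le _) ?_
      rw [Finsupp.mem_support_iff]; omega
    omega

/-- Iterated derivatives with respect to all variables but the `0`-th one. -/
def iterDeriv (D : Fin 4 → 𝓡 →+ 𝓡) (β : Fin 3 → ℕ) (f : 𝓡) : 𝓡 :=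
  (D 1)^[β 0] ((D 2)^[β 1] ((D 3)^[β 2] f))

/-- **Lipshitz's lemma.** A rational function in four variables satisfies a nontrivial linear
differential equation whose coefficients do not involve the last three variables. -/
theorem exists_differential_relation [NoZeroDivisors 𝓡] [Nontrivial A] {j : A →+* 𝓡} {X : Fin 4 → 𝓡}
    {D : Fin 4 → 𝓡 →+ 𝓡} (H : PartialDerivations j X D) {Q P : MvPolynomial (Fin 4) A} {Φ : 𝓡}
    (hQ0 : Q.eval₂ j X ≠ 0) (hΦ : Q.eval₂ j X * Φ = P.eval₂ j X) :
    ∃ (m : ℕ) (a : Fin m × Fin m × (Fin 3 → Fin m) → A), a ≠ 0 ∧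
      ∑ k, j (a k) * (X 0 ^ (k.1 : ℕ) * (D 0)^[(k.2.1 : ℕ)]
        (iterDeriv D (fun i => (k.2.2 i : ℕ)) Φ)) = 0 := by
  set d := max Q.totalDegree P.totalDegree with hd
  have hQ : Q.totalDegree ≤ d := le_max_left _ _
  set m := (5 * d + 2) ^ 4 + 1 with hm
  have h0 : PartialDerivations.Bounded j X Q d 0 Φ := ⟨P, by simp [hd], by simpa using hΦ⟩
  have h1 : ∀ k : Fin m × Fin m × (Fin 3 → Fin m), ∃ p : MvPolynomial (Fin 4) A,
      p.totalDegree ≤ d * (4 * m + 1) + m ∧ (Q.eval₂ j X) ^ (4 * m + 1) *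
        (X 0 ^ (k.1 : ℕ) * (D 0)^[(k.2.1 : ℕ)] (iterDeriv D (fun i => (k.2.2 i : ℕ)) Φ))
          = p.eval₂ j X := by
    intro k
    have h2 := H.bounded_iterate hQ 0 k.2.1 (H.bounded_iterate hQ 1 (k.2.2 0)
      (H.bounded_iterate hQ 2 (k.2.2 1) (H.bounded_iterate hQ 3 (k.2.2 2) h0)))
    obtain ⟨p, hp, h3⟩ := PartialDerivations.Bounded.mono hQ (s' := 4 * m) (by omega) h2
    refine ⟨MvPolynomial.X 0 ^ (k.1 : ℕ) * p, (MvPolynomial.totalDegree_mul _ _).trans ?_, ?_⟩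
    · rw [MvPolynomial.totalDegree_X_pow, add_comm]
      exact add_le_add hp k.1.2.le
    · rw [mul_left_comm, iterDeriv, h3, MvPolynomial.eval₂_mul, MvPolynomial.eval₂_pow,
        MvPolynomial.eval₂_X]
  choose p hp h2 using h1
  have hcard : (d * (4 * m + 1) + m + 1) ^ 4 < Fintype.card (Fin m × Fin m × (Fin 3 → Fin m)) := by
    simp only [Fintype.card_prod, Fintype.card_fin, Fintype.card_fun]
    have h4 : d * (4 * m + 1) + m + 1 ≤ (5 * d + 2) * m := by
      have : 1 ≤ m := by omega
      nlinarith [Nat.zero_le d]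
    calc _ ≤ ((5 * d + 2) * m) ^ 4 := Nat.pow_le_pow_left h4 4
      _ = (5 * d + 2) ^ 4 * m ^ 4 := mul_pow _ _ _
      _ < m * m ^ 4 := by
        have : 0 < m ^ 4 := by positivity
        exact Nat.mul_lt_mul_of_pos_right (by omega) this
      _ = _ := by ring
  obtain ⟨a, ha, h3⟩ := MvPolynomial.exists_sum_eq_zero_of_card_lt p hp hcard
  refine ⟨m, a, ha, ?_⟩
  have h5 := congrArg (MvPolynomial.eval₂ j X) h3
  rw [MvPolynomial.eval₂_sum, MvPolynomial.eval₂_zero] at h5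
  refine (mul_eq_zero.mp ?_).resolve_left (pow_ne_zero (4 * m + 1) hQ0)
  rw [Finset.mul_sum, ← h5]
  refine Finset.sum_congr rfl fun k _ => ?_
  rw [mul_left_comm, h2, MvPolynomial.eval₂_mul, MvPolynomial.eval₂_C]

end Lipshitz

section Coefficientwise

variable {R R' : Type*} [CommRing R] [CommRing R'] (σ : Type*)

/-- The additive map on power series which acts coefficientwise. -/
def coeffwise (l : R →+ R') : MvPowerSeries σ R →+ MvPowerSeries σ R' where
  toFun f := fun e => l (MvPowerSeries.coeff e f)
  map_zero' := by funext e; rw [map_zero, map_zero]; rfl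
  map_add' f g := by funext e; rw [map_add, map_add]; rfl

variable {σ}

theorem coeff_coeffwise (l : R →+ R') (f : MvPowerSeries σ R) (e : σ →₀ ℕ) :
    MvPowerSeries.coeff e (coeffwise σ l f) = l (MvPowerSeries.coeff e f) := rfl

theorem coeffwise_leibniz {δ : R →+ R} (h : ∀ a b, δ (a * b) = a * δ b + δ a * b)
    (f g : MvPowerSeries σ R) :
    coeffwise σ δ (f * g) = f * coeffwise σ δ g + coeffwise σ δ f * g := by
  classical
  ext e
  rw [coeff_coeffwise, map_add, MvPowerSeries.coeff_mul, MvPowerSeries.coeff_mul,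
    MvPowerSeries.coeff_mul, map_sum, ← Finset.sum_add_distrib]
  simp_rw [h, coeff_coeffwise]

theorem coeffwise_map {T : Type*} [CommRing T] {δ : R →+ R'} {ι : T →+* R}
    (h : ∀ a, δ (ι a) = 0) (f : MvPowerSeries σ T) :
    coeffwise σ δ (MvPowerSeries.map ι f) = 0 := by
  ext e
  rw [coeff_coeffwise, MvPowerSeries.coeff_map, h, map_zero]

theorem coeffwise_map_mul {l : R →+ R'} {ι : R' →+* R} (h : ∀ a b, l (ι a * b) = a * l b)
    (g : MvPowerSeries σ R') (f : MvPowerSeries σ R) :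
    coeffwise σ l (MvPowerSeries.map ι g * f) = g * coeffwise σ l f := by
  classical
  ext e
  rw [coeff_coeffwise, MvPowerSeries.coeff_mul, MvPowerSeries.coeff_mul, map_sum]
  simp_rw [MvPowerSeries.coeff_map, h, coeff_coeffwise]

theorem coeffwise_C {l : R →+ R'} (a : R) :
    coeffwise σ l (MvPowerSeries.C a) = MvPowerSeries.C (l a) := by
  classical
  ext e
  rw [coeff_coeffwise, MvPowerSeries.coeff_C, MvPowerSeries.coeff_C]
  split_ifs <;> simp

theorem coeffwise_derivative {l : R →+ R'} (f : PowerSeries R) :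
    coeffwise Unit l (PowerSeries.derivative R f) =
      PowerSeries.derivative R' (coeffwise Unit l f) := by
  have h0 : ∀ (n : ℕ) (f : PowerSeries R), PowerSeries.coeff n (coeffwise Unit l f : PowerSeries R') =
    l (PowerSeries.coeff n f) := fun n f => rfl
  refine PowerSeries.ext fun n => ?_
  rw [h0, PowerSeries.coeff_derivative, PowerSeries.coeff_derivative, h0]
  have h1 : ∀ (r : R), r * ((n : R) + 1) = (n + 1) • r := fun r => by
    rw [nsmul_eq_mul]; push_cast; ring
  rw [h1, map_nsmul, nsmul_eq_mul]
  push_cast; ring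

end Coefficientwise

/-- The derivation `∂/∂x_i` on Hahn series. -/
def hahnDeriv (i : Fin 3) : Hahn3 →+ Hahn3 where
  toFun h := single (-expBasis i) 1 * hahnEuler i h
  map_zero' := by
    have : hahnEuler i 0 = 0 := by ext e; simp [hahnEuler]
    rw [this, mul_zero]
  map_add' u v := by rw [hahnEuler_add, mul_add]

theorem hahnDeriv_mul (i : Fin 3) (u v : Hahn3) :
    hahnDeriv i (u * v) = u * hahnDeriv i v + hahnDeriv i u * v := by
  change single (-expBasis i) 1 * hahnEuler i (u * v) = u * (single (-expBasis i) 1 * hahnEuler i v)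
    + single (-expBasis i) 1 * hahnEuler i u * v
  rw [hahnEuler_mul]; ring

theorem coeff_hahnDeriv (i : Fin 3) (h : Hahn3) (v : Fin 3 → ℤ) :
    (hahnDeriv i h).coeff (toLex v) =
      (v i + 1) • h.coeff (toLex (Function.update v i (v i + 1))) := by
  change (single (-expBasis i) 1 * hahnEuler i h).coeff (toLex v) = _
  rw [coeff_single_mul, one_mul, sub_neg_eq_add]
  have h1 : toLex v + expBasis i = toLex (Function.update v i (v i + 1)) := by
    refine LexExp.ext fun j => ?_
    rw [map_add, expCoord_expBasis]
    change v j + _ = Function.update v i (v i + 1) j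
    rcases eq_or_ne j i with rfl | h
    · simp
    · simp [h]
  rw [h1]
  change ((Function.update v i (v i + 1) i : ℤ) : ℚ) * _ = _
  rw [Function.update_self, zsmul_eq_mul]

theorem hahnDeriv_C (i : Fin 3) (q : ℚ) : hahnDeriv i (HahnSeries.C q) = 0 := by
  have : hahnEuler i (HahnSeries.C q) = 0 := by
    ext e
    change (expCoord i e : ℚ) * (HahnSeries.C q : Hahn3).coeff e = 0
    rw [HahnSeries.C_apply, coeff_single]
    split_ifs with h
    · simp [h]
    · simp
  change _ * hahnEuler i _ = 0
  rw [this, mul_zero]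

theorem hahnDeriv_single (i k : Fin 3) :
    hahnDeriv i (single (expBasis k) 1) = if k = i then 1 else 0 := by
  have : hahnEuler i (single (expBasis k) 1) = if k = i then single (expBasis k) 1 else 0 := by
    ext e
    change (expCoord i e : ℚ) * (single (expBasis k) (1 : ℚ) : Hahn3).coeff e = _
    rw [coeff_single]
    split_ifs with h1 h2 h2
    · rw [h1, expCoord_expBasis, if_pos h2.symm]; simp
    · rw [h1, expCoord_expBasis, if_neg (Ne.symm h2)]; simp
    · simp [h1]
    · simp
  change _ * hahnEuler i _ = _
  rw [this]
  split_ifs with h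
  · rw [single_mul_single, h, neg_add_cancel, one_mul]; rfl
  · rw [mul_zero]

/-- Power series in `t` and three further variables, whose coefficients are Hahn series. -/
abbrev SeriesRing : Type := PowerSeries (MvPowerSeries (Fin 3) Hahn3)

/-- The embedding of the constant coefficient power series. -/
def constSeries : PowerSeries (MvPowerSeries (Fin 3) ℚ) →+* SeriesRing :=
  PowerSeries.map (MvPowerSeries.map HahnSeries.C)

/-- The embedding of the polynomials into the power series. -/
def polySeries : MvPolynomial (Fin 3) ℚ →+* PowerSeries (MvPowerSeries (Fin 3) ℚ) :=
  PowerSeries.C.comp MvPolynomial.coeToMvPowerSeries.ringHom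

/-- The variables `t, x, y, z` of the series ring. -/
def seriesVar : Fin 4 → SeriesRing :=
  Fin.cons PowerSeries.X fun i => PowerSeries.C (MvPowerSeries.C (single (expBasis i) 1))

/-- The derivations with respect to `t, x, y, z`. -/
def seriesDeriv : Fin 4 → SeriesRing →+ SeriesRing :=
  Fin.cons (PowerSeries.derivative (MvPowerSeries (Fin 3) Hahn3)).toLinearMap.toAddMonoidHom
    fun i => coeffwise Unit (coeffwise (Fin 3) (hahnDeriv i))

theorem coeffwise_constSeries (i : Fin 3) (g : PowerSeries (MvPowerSeries (Fin 3) ℚ)) :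
    coeffwise Unit (coeffwise (Fin 3) (hahnDeriv i)) (constSeries g) = 0 :=
  coeffwise_map (σ := Unit) (δ := coeffwise (Fin 3) (hahnDeriv i))
    (ι := MvPowerSeries.map (HahnSeries.C : ℚ →+* Hahn3))
    (fun a => coeffwise_map (hahnDeriv_C i) a) g

theorem constSeries_polySeries (q : MvPolynomial (Fin 3) ℚ) :
    constSeries (polySeries q) =
      PowerSeries.C (MvPowerSeries.map HahnSeries.C (q : MvPowerSeries (Fin 3) ℚ)) :=
  PowerSeries.map_C _ _

theorem constSeries_X : constSeries PowerSeries.X = seriesVar 0 := PowerSeries.map_X _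

theorem seriesDeriv_zero (f : SeriesRing) : seriesDeriv 0 f = PowerSeries.derivative _ f := rfl

theorem seriesVar_succ (i : Fin 3) : seriesVar i.succ =
    PowerSeries.C (MvPowerSeries.C (single (expBasis i) 1)) := rfl

theorem partialDerivations_seriesDeriv :
    PartialDerivations (constSeries.comp polySeries) seriesVar seriesDeriv where
  leibniz i f g := by
    induction i using Fin.cases with
    | zero =>
      simp only [seriesDeriv_zero]
      rw [Derivation.leibniz, smul_eq_mul, smul_eq_mul]; ring
    | succ i => exact coeffwise_leibniz (coeffwise_leibniz (hahnDeriv_mul i)) f g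
  const i a := by
    induction i using Fin.cases with
    | zero =>
      rw [RingHom.comp_apply, constSeries_polySeries, seriesDeriv_zero, PowerSeries.derivative_C]
    | succ i => exact coeffwise_constSeries i _
  var i k := by
    induction i using Fin.cases with
    | zero =>
      rw [seriesDeriv_zero]
      induction k using Fin.cases with
      | zero => simp [seriesVar]
      | succ k =>
        rw [seriesVar_succ, PowerSeries.derivative_C, if_neg (Fin.succ_ne_zero k)]
    | succ i =>
      change coeffwise Unit (coeffwise (Fin 3) (hahnDeriv i)) _ = _
      induction k using Fin.cases with
      | zero =>
        rw [if_neg (Fin.succ_ne_zero i).symm]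
        rw [← constSeries_X]
        exact coeffwise_constSeries i _
      | succ k =>
        change coeffwise Unit (coeffwise (Fin 3) (hahnDeriv i))
          (MvPowerSeries.C (MvPowerSeries.C (single (expBasis k) 1))) = _
        rw [coeffwise_C, coeffwise_C, hahnDeriv_single]
        simp only [Fin.succ_inj]
        split_ifs <;> simp

/-- The additive map extracting the coefficient of a Hahn series. -/
def hahnCoeff (v : Fin 3 → ℤ) : Hahn3 →+ ℚ where
  toFun h := h.coeff (toLex v)
  map_zero' := rfl
  map_add' _ _ := rfl

/-- Extraction of the coefficient of a monomial in `x, y, z`. -/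
def extract (v : Fin 3 → ℤ) : SeriesRing →+ PowerSeries (MvPowerSeries (Fin 3) ℚ) :=
  coeffwise Unit (coeffwise (Fin 3) (hahnCoeff v))

theorem extract_constSeries_mul (v : Fin 3 → ℤ) (g : PowerSeries (MvPowerSeries (Fin 3) ℚ))
    (f : SeriesRing) : extract v (constSeries g * f) = g * extract v f := by
  refine coeffwise_map_mul (fun a b => coeffwise_map_mul (fun q h => ?_) a b) g f
  change (HahnSeries.C q * h).coeff (toLex v) = q * h.coeff (toLex v)
  rw [HahnSeries.C_mul_eq_smul, HahnSeries.coeff_smul, smul_eq_mul]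

theorem extract_var_zero_pow_mul (v : Fin 3 → ℤ) (k : ℕ) (f : SeriesRing) :
    extract v (seriesVar 0 ^ k * f) = PowerSeries.X ^ k * extract v f := by
  rw [← constSeries_X, ← map_pow, extract_constSeries_mul]

theorem extract_deriv_zero_iterate (v : Fin 3 → ℤ) (k : ℕ) (f : SeriesRing) :
    extract v ((seriesDeriv 0)^[k] f) = (PowerSeries.derivative _)^[k] (extract v f) := by
  induction k with
  | zero => rfl
  | succ k ih =>
    rw [Function.iterate_succ_apply', Function.iterate_succ_apply', ← ih]
    exact coeffwise_derivative _

theorem extract_deriv_succ (v : Fin 3 → ℤ) (i : Fin 3) (f : SeriesRing) :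
    extract v (seriesDeriv i.succ f) =
      (v i + 1) • extract (Function.update v i (v i + 1)) f := by
  refine PowerSeries.ext fun n => MvPowerSeries.ext fun p => ?_
  rw [map_zsmul, map_zsmul]
  exact coeff_hahnDeriv i _ v

theorem extract_deriv_succ_iterate (v : Fin 3 → ℤ) (i : Fin 3) (k : ℕ) (f : SeriesRing) :
    extract v ((seriesDeriv i.succ)^[k] f) =
      (∏ j ∈ Finset.range k, (v i + 1 + j)) • extract (Function.update v i (v i + k)) f := by
  induction k generalizing f with
  | zero => simp
  | succ k ih =>
    rw [Function.iterate_succ_apply, ih, extract_deriv_succ, Function.update_idem,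
      Function.update_self, Finset.prod_range_succ, mul_smul, Nat.cast_succ]
    simp only [add_assoc, add_comm, add_left_comm]

theorem extract_iterDeriv (α β : Fin 3 → ℕ) (f : SeriesRing) :
    extract (fun i => -1 - (α i : ℤ)) (iterDeriv seriesDeriv β f) =
      (∏ i, ∏ j ∈ Finset.range (β i), ((j : ℤ) - α i)) •
        extract (fun i => -1 - (α i : ℤ) + β i) f := by
  have h1 : ∀ (x : ℤ) (i : Fin 3), x = -1 - (α i : ℤ) →
      ∏ j ∈ Finset.range (β i), (x + 1 + j) = ∏ j ∈ Finset.range (β i), ((j : ℤ) - α i) := by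
    intro x i h
    refine Finset.prod_congr rfl fun j _ => ?_
    rw [h]; ring
  rw [iterDeriv, show (1 : Fin 4) = Fin.succ 0 from rfl, show (2 : Fin 4) = Fin.succ 1 from rfl,
    show (3 : Fin 4) = Fin.succ 2 from rfl, extract_deriv_succ_iterate, extract_deriv_succ_iterate,
    extract_deriv_succ_iterate, smul_smul, smul_smul, Fin.prod_univ_three, h1 _ 0 rfl,
    h1 _ 1 (by simp), h1 _ 2 (by simp)]
  congr 3
  funext i
  fin_cases i <;> simp

/-- The series `∑ p, X ^ p / x ^ (p + 1)`. -/
def cauchySeries : MvPowerSeries (Fin 3) Hahn3 :=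
  fun p => single (toLex fun i => -1 - (p i : ℤ)) 1

theorem coeff_C_sub_X_mul {f : MvPowerSeries (Fin 3) Hahn3} {i : Fin 3} {u : Hahn3}
    {P : (Fin 3 →₀ ℕ) → Prop} {g : (Fin 3 →₀ ℕ) → Hahn3} [DecidablePred P]
    (hf : ∀ p, MvPowerSeries.coeff p f = if P p then g p else 0)
    (hP : ∀ p, P (p + Finsupp.single i 1) ↔ P p)
    (hg : ∀ p, u * g (p + Finsupp.single i 1) = g p) (p : Fin 3 →₀ ℕ) :
    MvPowerSeries.coeff p ((MvPowerSeries.C u - MvPowerSeries.X i) * f) =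
      if P p ∧ p i = 0 then u * g p else 0 := by
  rw [sub_mul, map_sub, MvPowerSeries.coeff_C_mul, MvPowerSeries.X, MvPowerSeries.coeff_monomial_mul,
    hf]
  by_cases h : p i = 0
  · have h1 : ¬ Finsupp.single i 1 ≤ p := by
      intro h2
      have := h2 i
      simp [h] at this
    rw [if_neg h1, sub_zero, mul_ite, mul_zero]
    simp [h]
  · have h1 : Finsupp.single i 1 ≤ p := by
      rw [Finsupp.single_le_iff]; omega
    obtain ⟨q, rfl⟩ := exists_add_of_le h1
    rw [if_neg (fun h2 : P _ ∧ _ => h h2.2), if_pos h1, add_tsub_cancel_left, add_comm, hf, one_mul]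
    by_cases h3 : P q
    · rw [if_pos ((hP q).mpr h3), if_pos h3, hg, sub_self]
    · rw [if_neg (fun h4 => h3 ((hP q).mp h4)), if_neg h3, mul_zero, sub_zero]

theorem prod_mul_cauchySeries :
    (∏ i, (MvPowerSeries.C (single (expBasis i) 1) - MvPowerSeries.X i)) * cauchySeries = 1 := by
  classical
  rw [Fin.prod_univ_three, mul_assoc, mul_assoc]
  set u : Fin 3 → Hahn3 := fun i => single (expBasis i) 1 with hu
  let g : (Fin 3 →₀ ℕ) → Hahn3 := fun p => single (toLex fun i => -1 - (p i : ℤ)) 1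
  have hg : ∀ i p, u i * g (p + Finsupp.single i 1) = g p := by
    intro i p
    simp only [u, g, single_mul_single, one_mul]
    congr 2
    refine LexExp.ext fun j => ?_
    rw [map_add, expCoord_expBasis]
    change _ + (-1 - ((p + Finsupp.single i 1 : Fin 3 →₀ ℕ) j : ℤ)) = -1 - (p j : ℤ)
    rcases eq_or_ne j i with rfl | h
    · simp; ring
    · simp [h]
  have h0 : ∀ p, MvPowerSeries.coeff p cauchySeries = if True then g p else 0 := fun p => by
    rw [if_pos trivial]; rfl
  have h1 := coeff_C_sub_X_mul (i := 2) h0 (by simp) (hg 2)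
  have h2 := coeff_C_sub_X_mul (i := 1) h1 (by simp) fun p => by rw [mul_left_comm, hg]
  have h3 := coeff_C_sub_X_mul (i := 0) h2 (by simp) fun p => by
    rw [mul_left_comm, mul_left_comm (u 0), hg]
  ext1 p
  rw [h3, MvPowerSeries.coeff_one]
  have h4 : (((True ∧ p 2 = 0) ∧ p 1 = 0) ∧ p 0 = 0) ↔ p = 0 := by
    constructor
    · rintro ⟨⟨⟨-, h⟩, h'⟩, h''⟩
      ext i
      fin_cases i <;> assumption
    · rintro rfl
      simp
  simp only [h4]
  split_ifs with h
  · rw [h]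
    simp only [u, g, single_mul_single, one_mul]
    have : expBasis 0 + (expBasis 1 + (expBasis 2 +
        toLex fun i => -1 - ((0 : Fin 3 →₀ ℕ) i : ℤ))) = 0 := by
      refine LexExp.ext fun j => ?_
      simp only [map_add, expCoord_expBasis]
      change _ + (_ + (_ + (-1 - 0))) = (0 : ℤ)
      fin_cases j <;> simp
    rw [this]
    rfl
  · rfl

/-- The inclusion of the polynomials in `x, y, z` into those in `t, x, y, z` with coefficients in
another copy of the polynomial ring. -/
def polyVar : MvPolynomial (Fin 3) ℚ →+* MvPolynomial (Fin 4) (MvPolynomial (Fin 3) ℚ) :=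
  MvPolynomial.eval₂Hom (MvPolynomial.C.comp MvPolynomial.C) fun i => MvPolynomial.X i.succ

/-- The embedding of the Hahn series into the series ring. -/
def hahnSeries : Hahn3 →+* SeriesRing := PowerSeries.C.comp MvPowerSeries.C

theorem eval₂_polyVar (q : MvPolynomial (Fin 3) ℚ) :
    (polyVar q).eval₂ (constSeries.comp polySeries) seriesVar = hahnSeries (polyExpand 1 q) := by
  have : (MvPolynomial.eval₂Hom (constSeries.comp polySeries) seriesVar).comp polyVar =
      hahnSeries.comp (polyExpand 1 : MvPolynomial (Fin 3) ℚ →+* Hahn3) := by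
    apply MvPolynomial.ringHom_ext
    · intro r
      simp only [RingHom.comp_apply, polyVar, MvPolynomial.coe_eval₂Hom, MvPolynomial.eval₂_C,
        constSeries_polySeries, MvPolynomial.coe_C, MvPowerSeries.map_C, hahnSeries, AlgHom.coe_toRingHom]
      rw [← MvPolynomial.algebraMap_eq, AlgHom.commutes, HahnSeries.algebraMap_apply]
      rfl
    · intro i
      simp only [RingHom.comp_apply, polyVar, MvPolynomial.coe_eval₂Hom, MvPolynomial.eval₂_X,
        hahnSeries, AlgHom.coe_toRingHom, polyExpand_X]
      rw [seriesVar_succ]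
      rfl
  exact congrArg (fun f => f q) this

/-- The generating function `∑ n, a s ^ n t ^ n` times the series `∑ p, X ^ p / x ^ (p + 1)`. -/
def kernelSeries (a s : K) : SeriesRing :=
  PowerSeries.mk fun n => MvPowerSeries.C (expand 1 (a * s ^ n)) * cauchySeries

theorem sub_mul_kernelSeries (a s w : K) :
    (hahnSeries (expand 1 w) - PowerSeries.X * hahnSeries (expand 1 (w * s))) * kernelSeries a s =
      hahnSeries (expand 1 (w * a)) * PowerSeries.C cauchySeries := by
  refine PowerSeries.ext fun n => ?_
  have h0 : ∀ (h : Hahn3) (n : ℕ) (f : SeriesRing), PowerSeries.coeff n (hahnSeries h * f) =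
    MvPowerSeries.C h * PowerSeries.coeff n f := fun h n f => PowerSeries.coeff_C_mul _ _ _
  rw [sub_mul, map_sub, mul_assoc, h0, h0]
  cases n with
  | zero =>
    rw [PowerSeries.coeff_zero_X_mul, kernelSeries, PowerSeries.coeff_mk, PowerSeries.coeff_zero_C,
      pow_zero, mul_one, sub_zero, ← mul_assoc, ← map_mul, ← map_mul]
  | succ n =>
    rw [PowerSeries.coeff_succ_X_mul, h0, kernelSeries, PowerSeries.coeff_mk, PowerSeries.coeff_mk,
      PowerSeries.coeff_C, if_neg (Nat.succ_ne_zero n), ← mul_assoc, ← mul_assoc, ← map_mul,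
      ← map_mul, ← map_mul, ← map_mul, pow_succ']
    rw [show w * (a * (s * s ^ n)) = w * s * (a * s ^ n) by ring, sub_self, mul_zero]

theorem coeff_extract_kernelSeries (a s : K) (n : ℕ) (p : Fin 3 →₀ ℕ) :
    MvPowerSeries.coeff p (PowerSeries.coeff n (extract (fun _ => -1) (kernelSeries a s))) =
      (expand 1 (a * s ^ n)).coeff (monExp 1 p) := by
  have h0 : MvPowerSeries.coeff p (PowerSeries.coeff n (extract (fun _ => -1) (kernelSeries a s))) =
      (MvPowerSeries.coeff p (PowerSeries.coeff n (kernelSeries a s))).coeff (toLex fun _ => -1) := rfl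
  have h1 : MvPowerSeries.coeff p cauchySeries = single (toLex fun i => -1 - (p i : ℤ)) 1 := rfl
  rw [h0, kernelSeries, PowerSeries.coeff_mk, MvPowerSeries.coeff_C_mul, h1, mul_comm,
    coeff_single_mul, one_mul]
  congr 1
  refine LexExp.ext fun j => ?_
  rw [map_sub]
  change (-1 : ℤ) - (-1 - p j) = p j
  ring

/-- The rational function `kernelSeries` is a quotient of polynomials. -/
theorem exists_kernelSeries_eq {a s : K} {u q : MvPolynomial (Fin 3) ℚ} (hu : u ≠ 0)
    (hs : algebraMap _ K u * s = algebraMap _ K q) :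
    ∃ Q P : MvPolynomial (Fin 4) (MvPolynomial (Fin 3) ℚ),
      Q.eval₂ (constSeries.comp polySeries) seriesVar ≠ 0 ∧
      Q.eval₂ (constSeries.comp polySeries) seriesVar * kernelSeries a s =
        P.eval₂ (constSeries.comp polySeries) seriesVar := by
  obtain ⟨num, den, hden, rfl⟩ := IsFractionRing.div_surjective (A := MvPolynomial (Fin 3) ℚ) a
  have hden0 : den ≠ 0 := nonZeroDivisors.ne_zero hden
  have hden1 : algebraMap (MvPolynomial (Fin 3) ℚ) K den ≠ 0 := by
    rwa [Ne, FaithfulSMul.algebraMap_eq_zero_iff]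
  set w := algebraMap (MvPolynomial (Fin 3) ℚ) K (den * u) with hw
  have h1 : w * s = algebraMap _ K (den * q) := by rw [hw, map_mul, mul_assoc, hs, map_mul]
  have h2 : w * (algebraMap _ K num / algebraMap _ K den) = algebraMap _ K (num * u) := by
    rw [hw, map_mul, map_mul]; field_simp
  have h3 := sub_mul_kernelSeries (algebraMap _ K num / algebraMap _ K den) s w
  rw [h1, h2, hw, expand_algebraMap, expand_algebraMap, expand_algebraMap, ← eval₂_polyVar,
    ← eval₂_polyVar, ← eval₂_polyVar] at h3
  let Q1 : MvPolynomial (Fin 4) (MvPolynomial (Fin 3) ℚ) :=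
    polyVar (den * u) - MvPolynomial.X 0 * polyVar (den * q)
  let Q2 : MvPolynomial (Fin 4) (MvPolynomial (Fin 3) ℚ) :=
    ∏ i : Fin 3, (MvPolynomial.X i.succ - MvPolynomial.C (MvPolynomial.X i))
  have hQ1 : Q1.eval₂ (constSeries.comp polySeries) seriesVar =
      (polyVar (den * u)).eval₂ (constSeries.comp polySeries) seriesVar -
        PowerSeries.X * (polyVar (den * q)).eval₂ (constSeries.comp polySeries) seriesVar := by
    simp only [Q1, MvPolynomial.eval₂_sub, MvPolynomial.eval₂_mul, MvPolynomial.eval₂_X]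
    rfl
  have hQ2 : Q2.eval₂ (constSeries.comp polySeries) seriesVar * PowerSeries.C cauchySeries = 1 := by
    have h4 := congrArg PowerSeries.C prod_mul_cauchySeries
    rw [map_mul, map_prod, map_one] at h4
    rw [← h4, ← MvPolynomial.coe_eval₂Hom, map_prod]
    congr 1
    refine Finset.prod_congr rfl fun i _ => ?_
    rw [map_sub, MvPolynomial.coe_eval₂Hom, MvPolynomial.eval₂_X, MvPolynomial.eval₂_C,
      RingHom.comp_apply, constSeries_polySeries, seriesVar_succ, MvPolynomial.coe_X,
      MvPowerSeries.map_X, map_sub]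
  refine ⟨Q2 * Q1, polyVar (num * u), ?_, ?_⟩
  · rw [MvPolynomial.eval₂_mul]
    refine mul_ne_zero (left_ne_zero_of_mul (hQ2.trans_ne one_ne_zero)) ?_
    rw [hQ1]
    intro h5
    have h6 := congrArg (PowerSeries.coeff 0) h5
    rw [map_sub, PowerSeries.coeff_zero_X_mul, sub_zero, map_zero, eval₂_polyVar] at h6
    have h7 : MvPowerSeries.C (polyExpand 1 (den * u)) = (0 : MvPowerSeries (Fin 3) Hahn3) :=
      (PowerSeries.coeff_zero_C _).symm.trans h6
    rw [← map_zero MvPowerSeries.C] at h7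
    have h8 := MvPowerSeries.C_injective h7
    rw [map_eq_zero_iff _ (polyExpand_injective 1)] at h8
    exact mul_ne_zero hden0 hu h8
  · rw [MvPolynomial.eval₂_mul, mul_assoc, hQ1, h3, mul_left_comm, hQ2, mul_one]

/-- The embedding of power series with polynomial coefficients. -/
def coePolySeries : PowerSeries (MvPolynomial (Fin 3) ℚ) →+*
    PowerSeries (MvPowerSeries (Fin 3) ℚ) :=
  PowerSeries.map MvPolynomial.coeToMvPowerSeries.ringHom

theorem coePolySeries_injective : Function.Injective coePolySeries := by
  intro f g h
  refine PowerSeries.ext fun n => MvPolynomial.coe_injective _ _ ?_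
  have := congrArg (PowerSeries.coeff n) h
  rwa [coePolySeries, PowerSeries.coeff_map, PowerSeries.coeff_map] at this

theorem coePolySeries_derivative_iterate (k : ℕ) (f : PowerSeries (MvPolynomial (Fin 3) ℚ)) :
    coePolySeries ((PowerSeries.derivative _)^[k] f) =
      (PowerSeries.derivative _)^[k] (coePolySeries f) := by
  induction k with
  | zero => rfl
  | succ k ih =>
    rw [Function.iterate_succ_apply', Function.iterate_succ_apply', ← ih]
    exact coeffwise_derivative
      (l := (MvPolynomial.coeToMvPowerSeries.ringHom (σ := Fin 3) (R := ℚ)).toAddMonoidHom) _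

/-- The nonnegative part of the rational generating function `∑ n, a s ^ n t ^ n` is D-finite. -/
theorem exists_differential_equation {a s : K} {u q : MvPolynomial (Fin 3) ℚ} (hu : u ≠ 0)
    (hs : algebraMap _ K u * s = algebraMap _ K q) {F : PowerSeries (MvPolynomial (Fin 3) ℚ)}
    (hF : ∀ n p, (PowerSeries.coeff n F).coeff p = (expand 1 (a * s ^ n)).coeff (monExp 1 p)) :
    ∃ (r : ℕ) (c : Fin (r + 1) → Polynomial (MvPolynomial (Fin 3) ℚ)),
      c ≠ 0 ∧ ∑ m : Fin (r + 1), ((c m : PowerSeries (MvPolynomial (Fin 3) ℚ)) *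
        ((PowerSeries.derivative _)^[(m : ℕ)] F)) = 0 := by
  obtain ⟨Q, P, hQ, hQP⟩ := exists_kernelSeries_eq (a := a) hu hs
  obtain ⟨m, b, hb, hsum⟩ := exists_differential_relation partialDerivations_seriesDeriv hQ hQP
  have hF' : extract (fun _ => -1) (kernelSeries a s) = coePolySeries F := by
    refine PowerSeries.ext fun n => MvPowerSeries.ext fun p => ?_
    rw [coeff_extract_kernelSeries, ← hF, coePolySeries, PowerSeries.coeff_map]
    rfl
  let T : Set (Fin 3 → Fin m) := {β | ∃ i j, b (i, j, β) ≠ 0}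
  have hT : T.Nonempty := by
    obtain ⟨⟨i, j, β⟩, h⟩ := Function.ne_iff.mp hb
    exact ⟨β, i, j, h⟩
  obtain ⟨α, hα⟩ := T.toFinite.exists_minimal hT
  obtain ⟨i₀, j₀, hα0⟩ := hα.prop
  have hmin : ∀ i j β, b (i, j, β) ≠ 0 → β ≠ α → ∃ l, α l < β l := by
    intro i j β h hβ
    by_contra hcon
    push Not at hcon
    exact hβ (le_antisymm hcon (hα.le_of_le ⟨i, j, h⟩ hcon))
  set C : ℤ := ∏ l, ∏ j ∈ Finset.range (α l : ℕ), ((j : ℤ) - (α l : ℕ)) with hC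
  have hC0 : C ≠ 0 := by
    refine Finset.prod_ne_zero_iff.mpr fun l _ => Finset.prod_ne_zero_iff.mpr fun j hj => ?_
    have := Finset.mem_range.mp hj
    omega
  have h1 := congrArg (extract fun l => -1 - ((α l : ℕ) : ℤ)) hsum
  rw [map_sum, map_zero, Fintype.sum_prod_type] at h1
  simp_rw [Fintype.sum_prod_type] at h1
  have h2 : ∀ i j, (∑ β, extract (fun l => -1 - ((α l : ℕ) : ℤ))
      ((constSeries.comp polySeries) (b (i, j, β)) * (seriesVar 0 ^ (i : ℕ) *
        (seriesDeriv 0)^[(j : ℕ)] (iterDeriv seriesDeriv (fun l => (β l : ℕ)) (kernelSeries a s))))) =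
      C • coePolySeries (((Polynomial.C (b (i, j, α)) * Polynomial.X ^ (i : ℕ) :
        Polynomial (MvPolynomial (Fin 3) ℚ)) : PowerSeries (MvPolynomial (Fin 3) ℚ)) *
          (PowerSeries.derivative _)^[(j : ℕ)] F) := by
    intro i j
    rw [Finset.sum_eq_single α]
    · rw [RingHom.comp_apply, extract_constSeries_mul, extract_var_zero_pow_mul,
        extract_deriv_zero_iterate, extract_iterDeriv fun l => (α l : ℕ)]
      simp only [sub_add_cancel]
      rw [hF', map_mul, coePolySeries_derivative_iterate, iterate_map_zsmul, mul_smul_comm,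
        mul_smul_comm, ← mul_assoc]
      congr 2
      rw [Polynomial.coe_mul, Polynomial.coe_C, Polynomial.coe_pow, Polynomial.coe_X, map_mul,
        map_pow, coePolySeries, PowerSeries.map_C, PowerSeries.map_X]
      rfl
    · intro β _ hβ
      by_cases h : b (i, j, β) = 0
      · rw [h, map_zero, zero_mul, map_zero]
      · obtain ⟨l, hl⟩ := hmin i j β h hβ
        rw [RingHom.comp_apply, extract_constSeries_mul, extract_var_zero_pow_mul,
          extract_deriv_zero_iterate, extract_iterDeriv fun l => (α l : ℕ),
          Finset.prod_eq_zero (Finset.mem_univ l), zero_smul, iterate_map_zero, mul_zero, mul_zero]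
        exact Finset.prod_eq_zero (i := (α l : ℕ)) (Finset.mem_range.mpr hl) (by simp)
    · simp
  obtain ⟨r, rfl⟩ : ∃ r, m = r + 1 := ⟨m - 1, by have := i₀.2; omega⟩
  refine ⟨r, fun j => ∑ i, Polynomial.C (b (i, j, α)) * Polynomial.X ^ (i : ℕ), fun h => ?_, ?_⟩
  · have h3 := congrArg (fun f => f.coeff (i₀ : ℕ)) (congrFun h j₀)
    simp only [Polynomial.finsetSum_coeff, Polynomial.coeff_C_mul_X_pow, Pi.zero_apply,
      Polynomial.coeff_zero] at h3
    rw [Finset.sum_eq_single i₀] at h3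
    · rw [if_pos rfl] at h3
      exact hα0 h3
    · intro i _ hi
      rw [if_neg fun h => hi (Fin.ext h.symm)]
    · simp
  · have hcancel : ∀ f : PowerSeries (MvPowerSeries (Fin 3) ℚ), C • f = 0 → f = 0 := by
      refine fun f hf => PowerSeries.ext fun n => MvPowerSeries.ext fun p => ?_
      have := congrArg (fun f => MvPowerSeries.coeff p (PowerSeries.coeff n f)) hf
      simp only [map_zsmul, map_zero] at this ⊢
      exact (smul_eq_zero.mp this).resolve_left hC0
    refine coePolySeries_injective (Eq.trans (hcancel _ ?_) (map_zero _).symm)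
    rw [← h1, Finset.sum_comm, map_sum, Finset.smul_sum]
    refine Finset.sum_congr rfl fun j _ => ?_
    simp_rw [h2]
    rw [← Finset.smul_sum, ← map_sum, ← Finset.sum_mul]
    have h4 := map_sum Polynomial.coeToPowerSeries.ringHom
      (fun i => Polynomial.C (b (i, j, α)) * Polynomial.X ^ (i : ℕ)) Finset.univ
    simp only [Polynomial.coeToPowerSeries.ringHom_apply] at h4
    rw [h4]

section OrbitSum

variable {G : Subgroup (K ≃ₐ[ℚ] K)} [Finite G]

/-- The alternating sum of the images of a rational function under a finite group. -/
def orbitSum (sgn : G →* ℤˣ) : K →+ K where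
  toFun f := ∑ᶠ g : G, ((sgn g : ℤ) : K) * (g : K ≃ₐ[ℚ] K) f
  map_zero' := by simp
  map_add' f f' := by
    rw [← finsum_add_distrib (Set.toFinite _) (Set.toFinite _)]
    simp only [map_add, mul_add]

theorem orbitSum_apply (sgn : G →* ℤˣ) (f : K) :
    orbitSum sgn f = ∑ᶠ g : G, ((sgn g : ℤ) : K) * (g : K ≃ₐ[ℚ] K) f := rfl

theorem orbitSum_eq_zero {sgn : G →* ℤˣ} {h : G} (hs : sgn h = -1) {f : K}
    (hf : (h : K ≃ₐ[ℚ] K) f = f) : orbitSum sgn f = 0 := by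
  have h1 : orbitSum sgn f = -orbitSum sgn f := by
    conv_lhs => rw [orbitSum_apply, ← finsum_comp_equiv (Equiv.mulRight h)]
    rw [orbitSum_apply, ← finsum_neg_distrib]
    refine finsum_congr fun g => ?_
    rw [Equiv.coe_mulRight, map_mul, hs, Subgroup.coe_mul, AlgEquiv.mul_apply, hf]
    simp
  exact self_eq_neg.mp h1

theorem orbitSum_mul {sgn : G →* ℤˣ} (f : K) {u : K} (hu : ∀ g : G, (g : K ≃ₐ[ℚ] K) u = u) :
    orbitSum sgn (f * u) = orbitSum sgn f * u := by
  rw [orbitSum_apply, orbitSum_apply, finsum_mul]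
  refine finsum_congr fun g => ?_
  rw [map_mul, hu, mul_assoc]

theorem map_orbitSum (sgn : G →* ℤˣ) (L : K →+ ℚ) {f : K}
    (h : ∀ g : G, g ≠ 1 → L ((g : K ≃ₐ[ℚ] K) f) = 0) : L (orbitSum sgn f) = L f := by
  have h1 : ∀ g : G, L (((sgn g : ℤ) : K) * (g : K ≃ₐ[ℚ] K) f) =
      (sgn g : ℤ) • L ((g : K ≃ₐ[ℚ] K) f) := fun g => by rw [← zsmul_eq_mul, map_zsmul]
  rw [orbitSum_apply, L.map_finsum (Set.toFinite _), finsum_congr h1,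
    finsum_eq_single _ 1 fun g hg => by rw [h g hg, smul_zero]]
  simp

end OrbitSum

theorem Xv_prod_eq {c d l : Fin 3} (h1 : c ≠ d) (h2 : c ≠ l) (h3 : d ≠ l) :
    Xv 0 * Xv 1 * Xv 2 = Xv c * Xv d * Xv l := by
  rw [← Fin.prod_univ_three, ← Finset.mul_prod_erase _ _ (Finset.mem_univ c),
    univ_erase_eq h1 h2 h3, Finset.prod_pair h3, mul_assoc]

/-- A pair of reflections with a negative exponent kills the orbit sum. -/
theorem ReflSystem.orbitSum_eq_zero {φ : Fin 3 → K ≃ₐ[ℚ] K} {R : Fin 3 → K} (H : ReflSystem φ R)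
    {G : Subgroup (K ≃ₐ[ℚ] K)} [Finite G] {sgn : G →* ℤˣ} (hmem : ∀ c, φ c ∈ G)
    (hs : ∀ c, sgn ⟨φ c, hmem c⟩ = -1) {c d : Fin 3} (h1 : c ≠ d) {r : K} (hr : r ∈ Free d)
    (hR : R c = r * Xv d ^ (-1 : ℤ)) : orbitSum sgn (Xv 0 * Xv 1 * Xv 2) = 0 := by
  obtain ⟨l, h2, h3⟩ := exists_distinct h1
  have hd := Xv_ne_zero d
  have hc := Xv_ne_zero c
  have h4 : φ c (Xv 0 * Xv 1 * Xv 2) = r * Xv l / Xv c := by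
    rw [Xv_prod_eq h1 h2 h3, map_mul, map_mul, H.self, H.other c d h1.symm, H.other c l h2.symm, hR,
      zpow_neg_one]
    field_simp
  have h5 : φ d (r * Xv l / Xv c) = r * Xv l / Xv c :=
    H.map_free (div_mem (mul_mem hr (Xv_mem_free h3.symm)) (Xv_mem_free h1))
  refine _root_.orbitSum_eq_zero (h := ⟨φ c, hmem c⟩ * ⟨φ d, hmem d⟩ * ⟨φ c, hmem c⟩) ?_ ?_
  · rw [map_mul, map_mul, hs, hs]; rfl
  · rw [Subgroup.coe_mul, Subgroup.coe_mul, AlgEquiv.mul_apply, AlgEquiv.mul_apply, h4, h5, ← h4,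
      H.apply_apply]

theorem finReflSystem_of_isPhi {S : Finset (Fin 3 → ℤ)}
    (hS : ∀ s ∈ S, (∀ c : Fin 3, s c = -1 ∨ s c = 0 ∨ s c = 1) ∧ s ≠ 0)
    {φ : Fin 3 → K ≃ₐ[ℚ] K} (hφ : ∀ c, IsPhi S c (φ c)) {G : Subgroup (K ≃ₐ[ℚ] K)} [Finite G]
    (hG : Subgroup.closure (Set.range φ) = G) {sgn : G →* ℤˣ} (hmem : ∀ c, φ c ∈ G)
    (hs : ∀ c, sgn ⟨φ c, hmem c⟩ = -1) (hos : orbitSum sgn (Xv 0 * Xv 1 * Xv 2) ≠ 0) :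
    FinReflSystem φ (fun c => Bm S c (-1) / Bm S c 1) := by
  have H := reflSystem_of_isPhi hS hφ
  have hfin : ∀ g ∈ G, ∃ n, 0 < n ∧ g ^ n = 1 := by
    intro g hg
    obtain ⟨n, hn, h⟩ := isOfFinOrder_iff_pow_eq_one.mp (isOfFinOrder_of_finite (⟨g, hg⟩ : G))
    exact ⟨n, hn, congrArg Subtype.val h⟩
  refine { H with fin := hG ▸ hfin, pair := ?_ }
  intro c d hcd h1 h2
  obtain ⟨n, hn, hgn⟩ := hfin _ (mul_mem (hmem c) (hmem d))
  obtain ⟨e, he, r, t, hr, ht, hc, hd⟩ := exists_exponents hS hφ hcd hn hgn h1 h2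
  refine ⟨e, ?_, r, t, hr, ht, hc, hd⟩
  have k1 : e.1 ≠ -1 := fun h => hos (H.orbitSum_eq_zero hmem hs hcd hr.2 (hc.trans (by rw [h])))
  have k2 : e.2 ≠ -1 := fun h =>
    hos (H.orbitSum_eq_zero hmem hs hcd.symm ht.1 (hd.trans (by rw [h])))
  clear hc hd
  fin_cases he <;> simp_all

/-- The Laurent monomial with exponent vector `v`. -/
def laurentMonomial (v : Fin 3 → ℤ) : K := ∏ i, Xv i ^ v i

theorem laurentMonomial_add (v w : Fin 3 → ℤ) :
    laurentMonomial (v + w) = laurentMonomial v * laurentMonomial w := by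
  rw [laurentMonomial, laurentMonomial, laurentMonomial, ← Finset.prod_mul_distrib]
  exact Finset.prod_congr rfl fun i _ => zpow_add₀ (Xv_ne_zero i) _ _

theorem laurentMonomial_one : laurentMonomial 1 = Xv 0 * Xv 1 * Xv 2 := by
  simp [laurentMonomial, Fin.prod_univ_three]

theorem laurentMonomial_natCast (v : Fin 3 → ℕ) :
    laurentMonomial (fun i => (v i : ℤ)) = ∏ i, Xv i ^ v i :=
  Finset.prod_congr rfl fun _ _ => zpow_natCast _ _

theorem laurentMonomial_mem_free {v : Fin 3 → ℤ} {c : Fin 3} (h : v c = 0) :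
    laurentMonomial v ∈ Free c := by
  refine prod_mem fun i _ => ?_
  rcases eq_or_ne i c with rfl | hi
  · rw [h, zpow_zero]; exact one_mem _
  · exact zpow_mem (Xv_mem_free hi) _

theorem laurentMonomial_eq (v : Fin 3 → ℤ) (c : Fin 3) :
    laurentMonomial v = Xv c ^ v c * ∏ i ∈ Finset.univ.erase c, Xv i ^ v i :=
  (Finset.mul_prod_erase _ _ (Finset.mem_univ c)).symm

theorem expand_laurentMonomial_natCast (v : Fin 3 → ℕ) :
    expand 1 (laurentMonomial fun i => (v i : ℤ)) = single (toLex fun i => (v i : ℤ)) 1 := by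
  have h : laurentMonomial (fun i => (v i : ℤ)) = algebraMap (MvPolynomial (Fin 3) ℚ) K
      (MvPolynomial.monomial (Finsupp.equivFunOnFinite.symm v) 1) := by
    rw [laurentMonomial_natCast, MvPolynomial.monomial_eq, Finsupp.prod_fintype _ _ (by simp)]
    simp [Xv]
  rw [h, expand_algebraMap, polyExpand_monomial]
  rfl

theorem expand_laurentMonomial_mul (v : Fin 3 → ℕ) (f : K) (e : Fin 3 → ℤ) :
    (expand 1 (laurentMonomial (fun i => (v i : ℤ)) * f)).coeff (toLex fun i => e i + v i) =
      (expand 1 f).coeff (toLex e) := by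
  rw [map_mul, expand_laurentMonomial_natCast, coeff_single_mul, one_mul]
  congr 1
  refine LexExp.ext fun j => ?_
  rw [map_sub]
  exact add_sub_cancel_right _ _

/-- The sum of the Laurent monomials of the steps. -/
def stepSum (S : Finset (Fin 3 → ℤ)) : K := ∑ s ∈ S, laurentMonomial s

theorem stepSum_eq {S : Finset (Fin 3 → ℤ)}
    (hS : ∀ s ∈ S, (∀ c : Fin 3, s c = -1 ∨ s c = 0 ∨ s c = 1) ∧ s ≠ 0) (c : Fin 3) :
    stepSum S = (Xv c)⁻¹ * Bm S c (-1) + Bm S c 0 + Xv c * Bm S c 1 := by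
  have h1 : ∀ s ∈ S, s c ∈ entries := by
    intro s hs
    simpa using (hS s hs).1 c
  have h2 : ∀ e : ℤ, ∑ s ∈ S with s c = e, laurentMonomial s = Xv c ^ e * Bm S c e := by
    intro e
    rw [Bm, Finset.mul_sum]
    refine Finset.sum_congr rfl fun s hs => ?_
    rw [laurentMonomial_eq s c, (Finset.mem_filter.mp hs).2]
  rw [stepSum, ← Finset.sum_fiberwise_of_maps_to h1]
  simp only [h2]
  simp [entries]
  ring

theorem map_stepSum {S : Finset (Fin 3 → ℤ)}
    (hS : ∀ s ∈ S, (∀ c : Fin 3, s c = -1 ∨ s c = 0 ∨ s c = 1) ∧ s ≠ 0)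
    {φ : Fin 3 → K ≃ₐ[ℚ] K} (hφ : ∀ c, IsPhi S c (φ c)) (c : Fin 3) :
    φ c (stepSum S) = stepSum S := by
  have H := reflSystem_of_isPhi hS hφ
  have h0 := H.ne_zero c
  have h1 : Bm S c 1 ≠ 0 := (div_ne_zero_iff.mp h0).2
  have h2 : Bm S c (-1) ≠ 0 := (div_ne_zero_iff.mp h0).1
  have hx := Xv_ne_zero c
  rw [stepSum_eq hS c, map_add, map_add, map_mul, map_mul, map_inv₀, H.map_free (Bm_mem_free S c _),
    H.map_free (Bm_mem_free S c _), H.map_free (Bm_mem_free S c _), H.self]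
  field_simp
  ring

theorem map_stepSum_of_mem {S : Finset (Fin 3 → ℤ)}
    (hS : ∀ s ∈ S, (∀ c : Fin 3, s c = -1 ∨ s c = 0 ∨ s c = 1) ∧ s ≠ 0)
    {φ : Fin 3 → K ≃ₐ[ℚ] K} (hφ : ∀ c, IsPhi S c (φ c)) {g : K ≃ₐ[ℚ] K}
    (hg : g ∈ Subgroup.closure (Set.range φ)) : g (stepSum S) = stepSum S := by
  refine closure_induction_of_involutions (P := fun g : K ≃ₐ[ℚ] K => g (stepSum S) = stepSum S)
    ?_ rfl ?_ hg
  · rintro _ ⟨c, rfl⟩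
    exact (reflSystem_of_isPhi hS hφ).inv_eq c
  · rintro x _ ⟨c, rfl⟩ hx
    rw [AlgEquiv.mul_apply, map_stepSum hS hφ, hx]

/-- The sum of the Laurent monomials of the steps is a quotient of polynomials. -/
theorem exists_eq_mul_stepSum {S : Finset (Fin 3 → ℤ)}
    (hS : ∀ s ∈ S, (∀ c : Fin 3, s c = -1 ∨ s c = 0 ∨ s c = 1) ∧ s ≠ 0) :
    ∃ q : MvPolynomial (Fin 3) ℚ,
      algebraMap (MvPolynomial (Fin 3) ℚ) K
        (MvPolynomial.X 0 * MvPolynomial.X 1 * MvPolynomial.X 2) * stepSum S =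
          algebraMap _ K q := by
  refine ⟨∑ s ∈ S, ∏ i, MvPolynomial.X i ^ (s i + 1).toNat, ?_⟩
  have h1 : algebraMap (MvPolynomial (Fin 3) ℚ) K
      (MvPolynomial.X 0 * MvPolynomial.X 1 * MvPolynomial.X 2) = laurentMonomial 1 := by
    rw [laurentMonomial_one, map_mul, map_mul]; rfl
  rw [h1, stepSum, Finset.mul_sum, map_sum]
  refine Finset.sum_congr rfl fun s hs => ?_
  have h2 : (1 + s : Fin 3 → ℤ) = fun i => ((s i + 1).toNat : ℤ) := by
    funext i
    rw [Int.toNat_of_nonneg (by rcases (hS s hs).1 i with h | h | h <;> omega), add_comm]; rfl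
  rw [← laurentMonomial_add, h2, laurentMonomial_natCast, map_prod]
  simp only [map_pow]
  rfl

/-- The image of a positive Laurent monomial under an extractable automorphism has no nonnegative
terms. -/
theorem Extractable.coeff_eq_zero {g : K ≃ₐ[ℚ] K} (hg : Extractable g) (v : Fin 3 → ℕ)
    (hv : ∀ i, 0 < v i) (p : Fin 3 →₀ ℕ) :
    (expand 1 (g (laurentMonomial fun i => (v i : ℤ)))).coeff (monExp 1 p) = 0 := by
  obtain ⟨i, m, ⟨j, hj⟩, h⟩ := hg
  set N := ∑ j, m j * v j with hN
  have hN0 : 0 < N := Finset.sum_pos' (fun _ _ => Nat.zero_le _)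
    ⟨j, Finset.mem_univ _, Nat.mul_pos hj (hv j)⟩
  have h1 : Xv i ^ N * g (laurentMonomial fun i => (v i : ℤ)) ∈ Free i := by
    rw [laurentMonomial_natCast, map_prod, hN, ← Finset.prod_pow_eq_pow_sum,
      ← Finset.prod_mul_distrib]
    refine prod_mem fun k _ => ?_
    rw [map_pow, pow_mul, ← mul_pow, mul_comm]
    exact pow_mem (h k) _
  have h2 : Xv i ^ N = laurentMonomial fun k => ((if k = i then N else 0 : ℕ) : ℤ) := by
    rw [laurentMonomial_natCast]
    simp [Finset.prod_ite_eq']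
  rw [h2] at h1
  have h3 := expand_laurentMonomial_mul (fun k => if k = i then N else 0)
    (g (laurentMonomial fun i => (v i : ℤ))) (fun k => (p k : ℤ))
  refine h3.symm.trans (expand_coeff_eq_zero_of_mem_free 1 h1 ?_)
  change ((p i : ℤ) + ((if i = i then N else 0 : ℕ) : ℤ)) ≠ 0
  rw [if_pos rfl]
  omega

/-- The octant walks of length `n`. -/
def octantWalks (S : Finset (Fin 3 → ℤ)) : ℕ → Finset (List (Fin 3 → ℤ))
  | 0 => {[]}
  | n + 1 => {w ∈ (octantWalks S n ×ˢ S).image fun p => p.1 ++ [p.2] | ∀ c, 0 ≤ w.sum c}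

theorem mem_octantWalks {S : Finset (Fin 3 → ℤ)} {n : ℕ} {w : List (Fin 3 → ℤ)} :
    w ∈ octantWalks S n ↔ w.length = n ∧ (∀ s ∈ w, s ∈ S) ∧
      ∀ m : ℕ, ∀ c : Fin 3, 0 ≤ (w.take m).sum c := by
  induction n generalizing w with
  | zero =>
    rw [octantWalks, Finset.mem_singleton]
    constructor
    · rintro rfl
      simp
    · exact fun h => List.length_eq_zero_iff.mp h.1
  | succ n ih =>
    simp only [octantWalks, Finset.mem_filter, Finset.mem_image, Finset.mem_product, Prod.exists]
    constructor
    · rintro ⟨⟨v, s, ⟨hv, hs⟩, rfl⟩, h0⟩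
      obtain ⟨h1, h2, h3⟩ := ih.mp hv
      refine ⟨by simp [h1], ?_, fun m c => ?_⟩
      · intro t ht
        rcases List.mem_append.mp ht with ht | ht
        · exact h2 t ht
        · rwa [List.mem_singleton.mp ht]
      · rcases le_or_gt m n with hm | hm
        · rw [List.take_append_of_le_length (by omega)]
          exact h3 m c
        · rw [List.take_of_length_le (by simp; omega)]
          exact h0 c
    · rintro ⟨h1, h2, h3⟩
      have hne : w ≠ [] := by rintro rfl; simp at h1
      refine ⟨⟨w.dropLast, w.getLast hne, ⟨ih.mpr ⟨by simp [h1], fun s hs =>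
        h2 s (List.mem_of_mem_dropLast hs), fun m c => ?_⟩, h2 _ (List.getLast_mem hne)⟩,
          List.dropLast_append_getLast hne⟩, fun c => ?_⟩
      · rw [List.dropLast_eq_take, List.take_take]
        exact h3 _ c
      · have := h3 w.length c
        rwa [List.take_length] at this

theorem walkCount_eq_card (S : Finset (Fin 3 → ℤ)) (p : Fin 3 → ℤ) (n : ℕ) :
    walkCount S p n = ((octantWalks S n).filter fun w => w.sum = p).card := by
  rw [walkCount, ← Set.ncard_coe_finset]
  congr 1
  ext w
  simp only [Set.mem_ofPred_eq, Finset.coe_filter, mem_octantWalks, and_assoc]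

theorem sum_nonneg_of_mem_octantWalks {S : Finset (Fin 3 → ℤ)} {n : ℕ} {w : List (Fin 3 → ℤ)}
    (hw : w ∈ octantWalks S n) (c : Fin 3) : 0 ≤ w.sum c := by
  have := (mem_octantWalks.mp hw).2.2 w.length c
  rwa [List.take_length] at this

theorem sum_le_of_mem_octantWalks {S : Finset (Fin 3 → ℤ)}
    (hS : ∀ s ∈ S, (∀ c : Fin 3, s c = -1 ∨ s c = 0 ∨ s c = 1) ∧ s ≠ 0) {n : ℕ}
    {w : List (Fin 3 → ℤ)} (hw : w ∈ octantWalks S n) (c : Fin 3) : w.sum c ≤ n := by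
  induction n generalizing w with
  | zero =>
    rw [octantWalks, Finset.mem_singleton] at hw
    simp [hw]
  | succ n ih =>
    simp only [octantWalks, Finset.mem_filter, Finset.mem_image, Finset.mem_product,
      Prod.exists] at hw
    obtain ⟨⟨v, s, ⟨hv, hs⟩, rfl⟩, -⟩ := hw
    have h1 := ih hv
    have h2 := (hS s hs).1 c
    rw [List.sum_append, List.sum_singleton, Pi.add_apply]
    push_cast
    omega

theorem coeff_genFun {S : Finset (Fin 3 → ℤ)}
    (hS : ∀ s ∈ S, (∀ c : Fin 3, s c = -1 ∨ s c = 0 ∨ s c = 1) ∧ s ≠ 0) (n : ℕ)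
    (p : Fin 3 →₀ ℕ) :
    (PowerSeries.coeff n (genFun S)).coeff p = walkCount S (fun i => (p i : ℤ)) n := by
  have h1 : ∀ i j k : ℕ, (MvPolynomial.X 0 ^ i * MvPolynomial.X 1 ^ j * MvPolynomial.X 2 ^ k :
      MvPolynomial (Fin 3) ℚ) =
        MvPolynomial.monomial (Finsupp.equivFunOnFinite.symm ![i, j, k]) 1 := by
    intro i j k
    rw [MvPolynomial.monomial_eq, Finsupp.prod_fintype _ _ (by simp), Fin.prod_univ_three]
    simp
  have h2 : ∀ i j k : ℕ, Finsupp.equivFunOnFinite.symm ![i, j, k] = p ↔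
      i = p 0 ∧ j = p 1 ∧ k = p 2 := by
    intro i j k
    rw [Equiv.symm_apply_eq, funext_iff, Fin.forall_fin_succ, Fin.forall_fin_succ, Fin.forall_fin_one]
    rfl
  have h3 : (fun i => (p i : ℤ)) = ![((p 0 : ℕ) : ℤ), ((p 1 : ℕ) : ℤ), ((p 2 : ℕ) : ℤ)] := by
    funext i
    fin_cases i <;> rfl
  simp only [genFun, PowerSeries.coeff_mk, h1, MvPolynomial.coeff_sum, MvPolynomial.coeff_smul,
    MvPolynomial.coeff_monomial, h2, smul_eq_mul, mul_ite, mul_one, mul_zero, ite_and,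
    Finset.sum_ite_irrel, Finset.sum_const_zero, Finset.sum_ite_eq', Finset.mem_range,
    ← h3]
  split_ifs with k0 k1 k2
  · rfl
  all_goals
    symm
    rw [Nat.cast_eq_zero, walkCount_eq_card, Finset.card_eq_zero, Finset.filter_eq_empty_iff]
    intro w hw hp
    have h4 := fun c => sum_le_of_mem_octantWalks hS hw c
    simp only [hp] at h4
  · have := h4 2; omega
  · have := h4 1; omega
  · have := h4 0; omega

/-- The sum of the Laurent monomials of the end points of the octant walks of length `n`. -/
def walkSum (S : Finset (Fin 3 → ℤ)) (n : ℕ) : K :=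
  ∑ w ∈ octantWalks S n, laurentMonomial w.sum

theorem walkSum_zero (S : Finset (Fin 3 → ℤ)) : walkSum S 0 = 1 := by
  simp [walkSum, octantWalks, laurentMonomial]

theorem walkSum_mul_stepSum (S : Finset (Fin 3 → ℤ)) (n : ℕ) :
    walkSum S n * stepSum S = walkSum S (n + 1) +
      ∑ w ∈ (octantWalks S n ×ˢ S).image (fun p => p.1 ++ [p.2]) with ¬ ∀ c, 0 ≤ w.sum c,
        laurentMonomial w.sum := by
  rw [walkSum, walkSum, octantWalks, Finset.sum_filter_add_sum_filter_not, Finset.sum_image, stepSum,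
    Finset.sum_mul_sum, ← Finset.sum_product']
  · refine Finset.sum_congr rfl fun p _ => ?_
    rw [List.sum_append, List.sum_singleton, laurentMonomial_add]
  · rintro ⟨v, s⟩ _ ⟨v', s'⟩ _ h
    obtain ⟨h1, h2⟩ := List.append_inj' h rfl
    rw [Prod.mk.injEq]
    exact ⟨h1, List.singleton_inj.mp h2⟩

section KernelEquation

variable {S : Finset (Fin 3 → ℤ)} {φ : Fin 3 → K ≃ₐ[ℚ] K} {G : Subgroup (K ≃ₐ[ℚ] K)} [Finite G]
  {sgn : G →* ℤˣ}

theorem orbitSum_eq_zero_of_mem_free (hφ : ∀ c, IsPhi S c (φ c)) (hmem : ∀ c, φ c ∈ G)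
    (hs : ∀ c, sgn ⟨φ c, hmem c⟩ = -1) {c : Fin 3} {f : K} (hf : f ∈ Free c) :
    orbitSum sgn f = 0 :=
  orbitSum_eq_zero (hs c) (map_eq_self_of_mem_free (hφ c).2 hf)

/-- The orbit sums of the multiples of the generating polynomials of octant walks. -/
theorem orbitSum_mul_walkSum
    (hS : ∀ s ∈ S, (∀ c : Fin 3, s c = -1 ∨ s c = 0 ∨ s c = 1) ∧ s ≠ 0)
    (hφ : ∀ c, IsPhi S c (φ c)) (hG : Subgroup.closure (Set.range φ) = G) (hmem : ∀ c, φ c ∈ G)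
    (hs : ∀ c, sgn ⟨φ c, hmem c⟩ = -1) (n : ℕ) :
    orbitSum sgn (laurentMonomial 1 * walkSum S n) =
      orbitSum sgn (laurentMonomial 1) * stepSum S ^ n := by
  induction n with
  | zero => rw [walkSum_zero, pow_zero, mul_one, mul_one]
  | succ n ih =>
    rw [pow_succ, ← mul_assoc, ← ih, ← orbitSum_mul _ fun g => map_stepSum_of_mem hS hφ (hG ▸ g.2),
      mul_assoc, walkSum_mul_stepSum, mul_add, map_add, Finset.mul_sum, map_sum, left_eq_add]
    refine Finset.sum_eq_zero fun w hw => ?_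
    obtain ⟨hw1, hw2⟩ := Finset.mem_filter.mp hw
    obtain ⟨⟨v, s⟩, hvs, rfl⟩ := Finset.mem_image.mp hw1
    obtain ⟨hv, hsS⟩ := Finset.mem_product.mp hvs
    push Not at hw2
    obtain ⟨c, hc⟩ := hw2
    rw [← laurentMonomial_add]
    refine orbitSum_eq_zero_of_mem_free hφ hmem hs (c := c) (laurentMonomial_mem_free ?_)
    have h1 := sum_nonneg_of_mem_octantWalks hv c
    have h2 := (hS s hsS).1 c
    dsimp only at h1 hc ⊢
    rw [List.sum_append, List.sum_singleton, Pi.add_apply] at hc ⊢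
    rw [Pi.add_apply, Pi.one_apply]
    omega

/-- The numbers of octant walks are the coefficients of the nonnegative terms of a rational
function. -/
theorem coeff_expand_eq_walkCount
    (hS : ∀ s ∈ S, (∀ c : Fin 3, s c = -1 ∨ s c = 0 ∨ s c = 1) ∧ s ≠ 0)
    (hφ : ∀ c, IsPhi S c (φ c)) (hG : Subgroup.closure (Set.range φ) = G) (hmem : ∀ c, φ c ∈ G)
    (hs : ∀ c, sgn ⟨φ c, hmem c⟩ = -1) (hos : orbitSum sgn (Xv 0 * Xv 1 * Xv 2) ≠ 0) (n : ℕ)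
    (p : Fin 3 →₀ ℕ) :
    (expand 1 (orbitSum sgn (laurentMonomial 1) / laurentMonomial 1 * stepSum S ^ n)).coeff
      (monExp 1 p) = walkCount S (fun i => (p i : ℤ)) n := by
  have H := finReflSystem_of_isPhi hS hφ hG hmem hs hos
  have hpos : ∀ w ∈ octantWalks S n, (1 + w.sum : Fin 3 → ℤ) =
      fun i => (((1 + w.sum) i).toNat : ℤ) := by
    intro w hw
    funext i
    have := sum_nonneg_of_mem_octantWalks hw i
    rw [Int.toNat_of_nonneg]
    rw [Pi.add_apply, Pi.one_apply]
    omega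
  have hone : laurentMonomial 1 ≠ 0 := by
    rw [laurentMonomial_one]
    exact mul_ne_zero (mul_ne_zero (Xv_ne_zero 0) (Xv_ne_zero 1)) (Xv_ne_zero 2)
  let L : K →+ ℚ :=
    { toFun := fun f => (expand 1 f).coeff (monExp 1 (p + Finsupp.equivFunOnFinite.symm 1))
      map_zero' := by rw [map_zero]; rfl
      map_add' := fun f g => by rw [map_add]; rfl }
  have h1 : L (orbitSum sgn (laurentMonomial 1) * stepSum S ^ n) =
      L (laurentMonomial 1 * walkSum S n) := by
    rw [← orbitSum_mul_walkSum hS hφ hG hmem hs]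
    refine map_orbitSum sgn L fun g hg => ?_
    rw [walkSum, Finset.mul_sum, map_sum, map_sum]
    refine Finset.sum_eq_zero fun w hw => ?_
    rw [← laurentMonomial_add, hpos w hw]
    refine (H.extractable (hG ▸ g.2) fun h => hg (Subtype.ext h)).coeff_eq_zero _ (fun i => ?_) _
    have := sum_nonneg_of_mem_octantWalks hw i
    rw [Pi.add_apply, Pi.one_apply]
    omega
  have h2 : (expand 1 (orbitSum sgn (laurentMonomial 1) / laurentMonomial 1 * stepSum S ^ n)).coeff
      (monExp 1 p) = L (orbitSum sgn (laurentMonomial 1) * stepSum S ^ n) := by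
    have := expand_laurentMonomial_mul 1
      (orbitSum sgn (laurentMonomial 1) / laurentMonomial 1 * stepSum S ^ n) fun i => (p i : ℤ)
    refine this.symm.trans ?_
    have h3 : laurentMonomial (fun i => (((1 : Fin 3 → ℕ) i : ℕ) : ℤ)) = laurentMonomial 1 := by
      congr 1
    rw [h3, ← mul_assoc, mul_div_cancel₀ _ hone]
    rfl
  rw [h2, h1, walkCount_eq_card, Finset.card_filter, Nat.cast_sum, walkSum, Finset.mul_sum, map_sum]
  refine Finset.sum_congr rfl fun w hw => ?_
  rw [← laurentMonomial_add, hpos w hw]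
  change (expand 1 _).coeff _ = _
  rw [expand_laurentMonomial_natCast, ← hpos w hw, coeff_single, Nat.cast_ite, Nat.cast_one,
    Nat.cast_zero]
  congr 1
  rw [eq_iff_iff]
  constructor
  · intro h
    funext i
    have h4 : (p i : ℤ) + 1 = 1 + w.sum i := by
      have := congrArg (expCoord i) h
      exact this
    omega
  · intro h
    refine LexExp.ext fun i => ?_
    change ((p i + 1 : ℕ) : ℤ) = 1 + w.sum i
    rw [h]
    push_cast
    ring

end KernelEquation

end OrbitSumMethod

/-- **Main theorem.**  Let `S ⊆ {−1,0,1}³ \ {0}` be a stepset such that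
(i) the model is genuinely three-dimensional: for each coordinate `c` there
is a finite sequence of steps from `S` whose partial sums are nonnegative in
the other two coordinates but attain a negative value in coordinate `c`;
(ii) the group `G` of automorphisms of `ℚ(x,y,z)` generated by the associated
automorphisms `φ_x, φ_y, φ_z` is finite;
(iii) there is a group homomorphism `sgn : G → {±1}` sending the three
generators to `−1`; and
(iv) the orbit sum `Σ_{g∈G} sgn(g)·g(xyz)` is nonzero in `ℚ(x,y,z)`.
Then the generating function `F(x,y,z;t)` of octant walks with steps from `S`
is D-finite in `t`: it satisfies a nontrivial linear differential equation
`Σ_{m≤r} c_m (d/dt)^m F = 0` with coefficients `c_m ∈ ℚ[x,y,z][t]`. -/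
theorem main_theorem (S : Finset (Fin 3 → ℤ))
    (hS : ∀ s ∈ S, (∀ c : Fin 3, s c = -1 ∨ s c = 0 ∨ s c = 1) ∧ s ≠ 0)
    (h3d : ∀ c : Fin 3, ∃ w : List (Fin 3 → ℤ),
      (∀ s ∈ w, s ∈ S) ∧
      (∀ m : ℕ, ∀ i : Fin 3, i ≠ c → 0 ≤ (w.take m).sum i) ∧
      (∃ m : ℕ, (w.take m).sum c < 0))
    (φx φy φz : K ≃ₐ[ℚ] K)
    (hφx : IsPhi S 0 φx) (hφy : IsPhi S 1 φy) (hφz : IsPhi S 2 φz)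
    (hGfin : Finite (Subgroup.closure {φx, φy, φz} : Subgroup (K ≃ₐ[ℚ] K)))
    (sgn : (Subgroup.closure {φx, φy, φz} : Subgroup (K ≃ₐ[ℚ] K)) →* ℤˣ)
    (hsx : sgn ⟨φx, Subgroup.subset_closure (Set.mem_insert _ _)⟩ = -1)
    (hsy : sgn ⟨φy, Subgroup.subset_closure
      (Set.mem_insert_of_mem _ (Set.mem_insert _ _))⟩ = -1)
    (hsz : sgn ⟨φz, Subgroup.subset_closure
      (Set.mem_insert_of_mem _ (Set.mem_insert_of_mem _ rfl))⟩ = -1)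
    (hos : ∑ᶠ g : (Subgroup.closure {φx, φy, φz} : Subgroup (K ≃ₐ[ℚ] K)),
      ((sgn g : ℤ) : K) * (g : K ≃ₐ[ℚ] K) (Xv 0 * Xv 1 * Xv 2) ≠ 0) :
    ∃ (r : ℕ) (c : Fin (r + 1) → Polynomial (MvPolynomial (Fin 3) ℚ)),
      c ≠ 0 ∧
      ∑ m : Fin (r + 1), ((c m : PowerSeries (MvPolynomial (Fin 3) ℚ)) *
        (PowerSeries.derivativeFun^[(m : ℕ)] (genFun S))) = 0 := by
  have hφ : ∀ c, IsPhi S c (![φx, φy, φz] c) := by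
    intro c
    fin_cases c
    exacts [hφx, hφy, hφz]
  have hG : Subgroup.closure (Set.range ![φx, φy, φz]) = Subgroup.closure {φx, φy, φz} := by
    congr 1
    ext g
    simp [eq_comm]
    tauto
  have hmem : ∀ c : Fin 3, ![φx, φy, φz] c ∈ Subgroup.closure {φx, φy, φz} :=
    fun c => hG ▸ Subgroup.subset_closure ⟨c, rfl⟩
  have hs : ∀ c : Fin 3, sgn ⟨![φx, φy, φz] c, hmem c⟩ = -1 := by
    intro c
    fin_cases c
    exacts [hsx, hsy, hsz]
  obtain ⟨q, hq⟩ := exists_eq_mul_stepSum hS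
  have hu : (MvPolynomial.X 0 * MvPolynomial.X 1 * MvPolynomial.X 2 : MvPolynomial (Fin 3) ℚ) ≠ 0 :=
    mul_ne_zero (mul_ne_zero (MvPolynomial.X_ne_zero 0) (MvPolynomial.X_ne_zero 1))
      (MvPolynomial.X_ne_zero 2)
  refine exists_differential_equation (a := orbitSum sgn (laurentMonomial 1) / laurentMonomial 1)
    hu hq fun n p => ?_
  rw [coeff_genFun hS]
  exact (coeff_expand_eq_walkCount hS hφ hG hmem hs hos n p).symm
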